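/- Let d≥2, γ>1, p,q>3 and α>1/3. Let (ρ,v) be a weak solution of the isentropic compressible Euler equations on (0,T)×𝕋^d. Suppose there is a constant c>0 with ρ≥c a.e., that ρ ∈ L^{max{p/(p−3), p(γ−1)/2}}(0,T; L^{max{q/(q−3), q(γ−1)/2}}(𝕋^d)), that the weak derivatives satisfy ∇ρ ∈ L^{p/(p−3)}(0,T;L^{q/(q−3)}(𝕋^d)) and ∂_t ρ ∈ L^{p/(p−3)}(0,T;L^{q/(q−3)}(𝕋^d)), and that v ∈ L^p(0,T;B^α_{q,∞}(𝕋^d)). Then the energy is locally conserved: for every φ ∈ C_c^∞((0,T)), ∫₀^T φ'(t) ∫_{𝕋^d} (½ρ|v|² + κρ^γ/(γ−1)) dx dt = 0. -/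

import Mathlib

open MeasureTheory ENNReal

noncomputable section

namespace CompressibleEuler

variable {d : ℕ} {E : Type*} [NormedAddCommGroup E]

/-- Euclidean norm on `Fin d → ℝ`. -/
def euNorm (x : Fin d → ℝ) : ℝ := Real.sqrt (∑ i, x i ^ 2)

/-- The fundamental domain `[0,1)^d` of the torus `𝕋^d = [0,1]^d`. -/
def unitCube (d : ℕ) : Set (Fin d → ℝ) := Set.univ.pi fun _ => Set.Ico (0 : ℝ) 1

/-- Lebesgue measure on the torus `𝕋^d`, realized on the fundamental domain. -/
def cubeVol (d : ℕ) : Measure (Fin d → ℝ) := volume.restrict (unitCube d)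

/-- Product measure on `(0,T) × 𝕋^d`. -/
def spaceTime (d : ℕ) (T : ℝ) : Measure (ℝ × (Fin d → ℝ)) :=
  (volume.restrict (Set.Ioo 0 T)).prod (cubeVol d)

/-- `ℤ^d`-periodicity of a function on `ℝ^d` (i.e. a function on the torus `𝕋^d`). -/
def SpacePeriodic (f : (Fin d → ℝ) → E) : Prop :=
  ∀ (x : Fin d → ℝ) (n : Fin d → ℤ), f (x + fun i => (n i : ℝ)) = f x

/-- The `L^p` norm in time (exponent possibly `∞`) of an `ℝ≥0∞`-valued quantity,
over a time set `s`. -/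
def timeLpOn (s : Set ℝ) (p : ℝ≥0∞) (F : ℝ → ℝ≥0∞) : ℝ≥0∞ :=
  if p = ∞ then essSup F (volume.restrict s)
  else (∫⁻ t in s, F t ^ p.toReal) ^ (1 / p.toReal)

/-- The `L^p(0,T;L^q(𝕋^d))` norm. -/
def LpLqNorm (T : ℝ) (p q : ℝ≥0∞) (u : ℝ → (Fin d → ℝ) → E) : ℝ≥0∞ :=
  timeLpOn (Set.Ioo 0 T) p fun t => eLpNorm (u t) q (cubeVol d)

/-- `u ∈ L^p(0,T;L^q(𝕋^d))`. -/
def MemLpLq (T : ℝ) (p q : ℝ≥0∞) (u : ℝ → (Fin d → ℝ) → E) : Prop :=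
  LpLqNorm T p q u < ∞

/-- The homogeneous Besov seminorm `‖·‖_{Ḃ^α_{q,∞}(𝕋^d)}`. -/
def besovSeminorm (α : ℝ) (q : ℝ≥0∞) (f : (Fin d → ℝ) → E) : ℝ≥0∞ :=
  ⨆ (y : Fin d → ℝ) (_ : y ≠ 0),
    eLpNorm (fun x => f (x - y) - f x) q (cubeVol d) / ENNReal.ofReal (euNorm y ^ α)

/-- The Besov norm of `B^α_{q,∞}(𝕋^d)`. -/
def besovNorm (α : ℝ) (q : ℝ≥0∞) (f : (Fin d → ℝ) → E) : ℝ≥0∞ :=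
  eLpNorm f q (cubeVol d) + besovSeminorm α q f

/-- The `L^p(0,T;B^α_{q,∞}(𝕋^d))` norm. -/
def LpBesovNorm (T : ℝ) (p : ℝ≥0∞) (α : ℝ) (q : ℝ≥0∞) (u : ℝ → (Fin d → ℝ) → E) : ℝ≥0∞ :=
  timeLpOn (Set.Ioo 0 T) p fun t => besovNorm α q (u t)

/-- `u ∈ L^p(0,T;B^α_{q,∞}(𝕋^d))`. -/
def MemLpBesov (T : ℝ) (p : ℝ≥0∞) (α : ℝ) (q : ℝ≥0∞) (u : ℝ → (Fin d → ℝ) → E) : Prop :=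
  LpBesovNorm T p α q u < ∞

/-- The norm of the space-time Besov space `B^β_{p,∞}((0,T);B^α_{q,∞}(𝕋^d))`:
the `L^p(0,T;B^α_{q,∞})` norm plus the time-translation seminorm
`sup_{τ≠0} |τ|^{-β} ‖u(·-τ)-u(·)‖_{L^p(B^α_{q,∞})}`, the inner norm being taken
over the times where both terms are defined. -/
def besovBesovNorm (T β : ℝ) (p : ℝ≥0∞) (α : ℝ) (q : ℝ≥0∞)
    (u : ℝ → (Fin d → ℝ) → E) : ℝ≥0∞ :=
  LpBesovNorm T p α q u
    + ⨆ (τ : ℝ) (_ : τ ≠ 0),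
        timeLpOn (Set.Ioo (max 0 τ) (min T (T + τ))) p
            (fun t => besovNorm α q fun x => u (t - τ) x - u t x)
          / ENNReal.ofReal (|τ| ^ β)

/-- `u ∈ B^β_{p,∞}((0,T);B^α_{q,∞}(𝕋^d))`. -/
def MemBesovBesov (T β : ℝ) (p : ℝ≥0∞) (α : ℝ) (q : ℝ≥0∞)
    (u : ℝ → (Fin d → ℝ) → E) : Prop :=
  besovBesovNorm T β p α q u < ∞

/-- Classical partial derivative in time of a space-time function. -/
def pderivT (φ : ℝ → (Fin d → ℝ) → ℝ) (t : ℝ) (x : Fin d → ℝ) : ℝ :=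
  deriv (fun s => φ s x) t

/-- Classical partial derivative in the `i`-th space direction of a space-time function. -/
def pderivX (i : Fin d) (φ : ℝ → (Fin d → ℝ) → ℝ) (t : ℝ) (x : Fin d → ℝ) : ℝ :=
  fderiv ℝ (φ t) x (Pi.single i 1)

/-- Smooth test functions on `(0,T) × 𝕋^d`, compactly supported away from `t = 0` and
`t = T`, and periodic in space. -/
structure IsTestFunction (T : ℝ) (φ : ℝ → (Fin d → ℝ) → ℝ) : Prop where
  smooth : ContDiff ℝ (⊤ : ℕ∞) (Function.uncurry φ)
  periodic : ∀ t, SpacePeriodic (φ t)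
  supp : ∃ a b : ℝ, 0 < a ∧ b < T ∧ ∀ t x, t ∉ Set.Icc a b → φ t x = 0

/-- Smooth test functions on `[0,T) × 𝕋^d` (allowed to be nonzero at the initial time),
vanishing near `t = T`, and periodic in space. -/
structure IsTestFunctionIC (T : ℝ) (φ : ℝ → (Fin d → ℝ) → ℝ) : Prop where
  smooth : ContDiff ℝ (⊤ : ℕ∞) (Function.uncurry φ)
  periodic : ∀ t, SpacePeriodic (φ t)
  supp : ∃ b : ℝ, b < T ∧ ∀ t x, b ≤ t → φ t x = 0

/-- `g` is the weak time derivative of `f` on `(0,T) × 𝕋^d`. -/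
def HasWeakDerivT (T : ℝ) (f g : ℝ → (Fin d → ℝ) → ℝ) : Prop :=
  ∀ φ : ℝ → (Fin d → ℝ) → ℝ, IsTestFunction T φ →
    ∫ t in Set.Ioo 0 T, ∫ x in unitCube d, f t x * pderivT φ t x
      = - ∫ t in Set.Ioo 0 T, ∫ x in unitCube d, g t x * φ t x

/-- `g` is the weak `i`-th spatial derivative of `f` on `(0,T) × 𝕋^d`. -/
def HasWeakDerivX (T : ℝ) (i : Fin d) (f g : ℝ → (Fin d → ℝ) → ℝ) : Prop :=
  ∀ φ : ℝ → (Fin d → ℝ) → ℝ, IsTestFunction T φ →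
    ∫ t in Set.Ioo 0 T, ∫ x in unitCube d, f t x * pderivX i φ t x
      = - ∫ t in Set.Ioo 0 T, ∫ x in unitCube d, g t x * φ t x

/-- The weak time derivative of `f` belongs to `L^a(0,T;L^b(𝕋^d))`. -/
def DtInLpLq (T : ℝ) (a b : ℝ≥0∞) (f : ℝ → (Fin d → ℝ) → ℝ) : Prop :=
  ∃ g : ℝ → (Fin d → ℝ) → ℝ, HasWeakDerivT T f g ∧ MemLpLq T a b g

/-- The weak spatial gradient of `f` belongs to `L^a(0,T;L^b(𝕋^d))`. -/
def GradInLpLq (T : ℝ) (a b : ℝ≥0∞) (f : ℝ → (Fin d → ℝ) → ℝ) : Prop :=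
  ∃ G : ℝ → (Fin d → ℝ) → Fin d → ℝ,
    (∀ i, HasWeakDerivX T i f fun t x => G t x i) ∧ MemLpLq T a b G

/-- The constant `κ = (γ-1)²/(4γ)` in the pressure law `π(ρ) = κ ρ^γ`. -/
def kappa (γ : ℝ) : ℝ := (γ - 1) ^ 2 / (4 * γ)

/-- The total energy `E(t) = ∫_{𝕋^d} (½ ρ|v|² + κργ/(γ-1)) dx` at time `t`. -/
def energyAt (d : ℕ) (γ : ℝ) (ρ : ℝ → (Fin d → ℝ) → ℝ)
    (v : ℝ → (Fin d → ℝ) → Fin d → ℝ) (t : ℝ) : ℝ :=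
  ∫ x in unitCube d,
    ((1 / 2 : ℝ) * ρ t x * euNorm (v t x) ^ 2 + (kappa γ / (γ - 1)) * ρ t x ^ γ)

/-- The initial energy `E(0)`. -/
def energyInit (d : ℕ) (γ : ℝ) (ρ₀ : (Fin d → ℝ) → ℝ)
    (v₀ : (Fin d → ℝ) → Fin d → ℝ) : ℝ :=
  ∫ x in unitCube d,
    ((1 / 2 : ℝ) * ρ₀ x * euNorm (v₀ x) ^ 2 + (kappa γ / (γ - 1)) * ρ₀ x ^ γ)

/-- A weak solution of the isentropic compressible Euler equations
`∂ₜρ + div(ρv) = 0`, `∂ₜ(ρv) + div(ρv⊗v) + ∇(κρ^γ) = 0` on `(0,T) × 𝕋^d`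
with initial data `ρ(0) = ρ₀`, `(ρv)(0) = ρ₀v₀`:
both equations hold in the sense of distributions, `ρ^γ, ρ|v|² ∈ L^∞(0,T;L¹(𝕋^d))`,
`ρ` is a renormalized solution of the continuity equation, and the energy
inequality `E(t) ≤ E(0)` holds. -/
structure IsWeakSolution (d : ℕ) (T γ : ℝ) (ρ : ℝ → (Fin d → ℝ) → ℝ)
    (v : ℝ → (Fin d → ℝ) → Fin d → ℝ) (ρ₀ : (Fin d → ℝ) → ℝ)
    (v₀ : (Fin d → ℝ) → Fin d → ℝ) : Prop where
  rho_meas : Measurable (Function.uncurry ρ)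
  v_meas : Measurable (Function.uncurry v)
  rho_periodic : ∀ t, SpacePeriodic (ρ t)
  v_periodic : ∀ t, SpacePeriodic (v t)
  rho0_periodic : SpacePeriodic ρ₀
  v0_periodic : SpacePeriodic v₀
  rho_nonneg : ∀ t x, 0 ≤ ρ t x
  rho0_nonneg : ∀ x, 0 ≤ ρ₀ x
  v0_vacuum : ∀ x, ρ₀ x = 0 → v₀ x = 0
  pressure_int : MemLpLq T ∞ 1 fun t x => ρ t x ^ γ
  kinetic_int : MemLpLq T ∞ 1 fun t x => ρ t x * euNorm (v t x) ^ 2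
  mass : ∀ φ : ℝ → (Fin d → ℝ) → ℝ, IsTestFunctionIC T φ →
    (∫ t in Set.Ioo 0 T, ∫ x in unitCube d,
        (ρ t x * pderivT φ t x + ρ t x * (∑ i, v t x i * pderivX i φ t x)))
      + (∫ x in unitCube d, ρ₀ x * φ 0 x) = 0
  momentum : ∀ Φ : ℝ → (Fin d → ℝ) → Fin d → ℝ,
    (∀ j, IsTestFunctionIC T fun s y => Φ s y j) →
    (∫ t in Set.Ioo 0 T, ∫ x in unitCube d,
        ((∑ j, ρ t x * v t x j * pderivT (fun s y => Φ s y j) t x)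
          + (∑ i, ∑ j, ρ t x * v t x i * v t x j * pderivX i (fun s y => Φ s y j) t x)
          + kappa γ * ρ t x ^ γ * (∑ j, pderivX j (fun s y => Φ s y j) t x)))
      + (∫ x in unitCube d, (∑ j, ρ₀ x * v₀ x j * Φ 0 x j)) = 0
  renormalized : ∃ w : ℝ → (Fin d → ℝ) → ℝ,
    (∀ φ : ℝ → (Fin d → ℝ) → ℝ, IsTestFunction T φ →
      ∫ t in Set.Ioo 0 T, ∫ x in unitCube d, (∑ i, v t x i * pderivX i φ t x)
        = - ∫ t in Set.Ioo 0 T, ∫ x in unitCube d, w t x * φ t x) ∧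
    ∀ b : ℝ → ℝ, ContDiff ℝ 1 b → HasCompactSupport (deriv b) →
      ∀ φ : ℝ → (Fin d → ℝ) → ℝ, IsTestFunctionIC T φ →
        (∫ t in Set.Ioo 0 T, ∫ x in unitCube d,
            (b (ρ t x) * pderivT φ t x + b (ρ t x) * (∑ i, v t x i * pderivX i φ t x)
              - (deriv b (ρ t x) * ρ t x - b (ρ t x)) * w t x * φ t x))
          + (∫ x in unitCube d, b (ρ₀ x) * φ 0 x) = 0
  energy_ineq : ∀ᵐ t ∂(volume.restrict (Set.Ioo 0 T)),
    energyAt d γ ρ v t ≤ energyInit d γ ρ₀ v₀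

/-- The exponent `p/(p-3)`, read as `∞` when `p ≤ 3`. -/
def div3Exp (p : ℝ) : ℝ≥0∞ := if p ≤ 3 then ∞ else ENNReal.ofReal (p / (p - 3))

/-- The standard (non-normalized) spatial bump `e^{-1/(1-|x|²)}` for `|x| < 1`. -/
def bump (d : ℕ) (x : Fin d → ℝ) : ℝ :=
  if euNorm x < 1 then Real.exp (-(1 - euNorm x ^ 2)⁻¹) else 0

/-- The normalizing constant `C₀` with `∫ C₀ e^{-1/(1-|x|²)} dx = 1`. -/
def bumpConst (d : ℕ) : ℝ := (∫ x : Fin d → ℝ, bump d x)⁻¹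

/-- The rescaled standard spatial mollifier `η_ε(x) = ε^{-d} η(x/ε)`,
`η(x) = C₀ e^{-1/(1-|x|²)}`. -/
def sKer (d : ℕ) (ε : ℝ) (x : Fin d → ℝ) : ℝ :=
  (ε ^ d)⁻¹ * (bumpConst d * bump d (ε⁻¹ • x))

/-- Mollification in the space variable: `f^ε = f * η_ε`. -/
def sMollify {d : ℕ} {E : Type*} [NormedAddCommGroup E] [NormedSpace ℝ E]
    (ε : ℝ) (f : (Fin d → ℝ) → E) (x : Fin d → ℝ) : E :=
  ∫ y : Fin d → ℝ, sKer d ε (x - y) • f y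

/-- A space-time mollifying kernel: nonnegative, smooth, supported in the unit ball of
`ℝ^{1+d}`, with integral 1. -/
structure IsSTMollifier (d : ℕ) (η : ℝ → (Fin d → ℝ) → ℝ) : Prop where
  smooth : ContDiff ℝ (⊤ : ℕ∞) (Function.uncurry η)
  nonneg : ∀ t x, 0 ≤ η t x
  supp : ∀ t x, 1 ≤ t ^ 2 + euNorm x ^ 2 → η t x = 0
  integral_one : (∫ z : ℝ × (Fin d → ℝ), η z.1 z.2) = 1

/-- The rescaled space-time kernel `η_ε(t,x) = ε^{-(d+1)} η(t/ε, x/ε)`. -/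
def stKer (d : ℕ) (η : ℝ → (Fin d → ℝ) → ℝ) (ε : ℝ) (t : ℝ) (x : Fin d → ℝ) : ℝ :=
  (ε ^ (d + 1))⁻¹ * η (t / ε) (ε⁻¹ • x)

/-- Space-time mollification `f^ε(t,x) = ∫∫ η_ε(t-s, x-y) f(s,y) dy ds`. -/
def stMollify {d : ℕ} {E : Type*} [NormedAddCommGroup E] [NormedSpace ℝ E]
    (η : ℝ → (Fin d → ℝ) → ℝ) (ε : ℝ) (f : ℝ → (Fin d → ℝ) → E)
    (t : ℝ) (x : Fin d → ℝ) : E :=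
  ∫ z : ℝ × (Fin d → ℝ), stKer d η ε (t - z.1) (x - z.2) • f z.1 z.2


instance cubeVol_prob : IsProbabilityMeasure (cubeVol d) := by
  constructor
  rw [cubeVol, Measure.restrict_apply_univ, unitCube, Real.volume_pi_Ico]
  simp

lemma unitCube_eq : unitCube d = ZSpan.fundamentalDomain (Pi.basisFun ℝ (Fin d)) := by
  rw [ZSpan.fundamentalDomain_pi_basisFun]; rfl

lemma measurableSet_unitCube : MeasurableSet (unitCube d) :=
  MeasurableSet.univ_pi fun _ => measurableSet_Ico

lemma lattice_int (g : Submodule.span ℤ (Set.range (Pi.basisFun ℝ (Fin d)))) :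
    ∃ n : Fin d → ℤ, (g : Fin d → ℝ) = fun i => (n i : ℝ) := by
  have h := (Pi.basisFun ℝ (Fin d)).mem_span_iff_repr_mem ℤ (g : Fin d → ℝ)
  have h2 := h.1 g.2
  choose n hn using h2
  refine ⟨n, ?_⟩
  funext i
  have := hn i
  simpa using this.symm

open scoped Pointwise in
lemma shift_fd (y : Fin d → ℝ) :
    IsAddFundamentalDomain (Submodule.span ℤ (Set.range (Pi.basisFun ℝ (Fin d)))).toAddSubgroup
      (y +ᵥ unitCube d) (volume : Measure (Fin d → ℝ)) := by
  have h := ZSpan.isAddFundamentalDomain' (Pi.basisFun ℝ (Fin d)) (volume : Measure (Fin d → ℝ))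
  rw [← unitCube_eq] at h
  have : VAddCommClass (Fin d → ℝ) (Submodule.span ℤ (Set.range (Pi.basisFun ℝ (Fin d)))).toAddSubgroup
    (Fin d → ℝ) := ⟨fun a b c => by
      change a + ((b : Fin d → ℝ) + c) = (b : Fin d → ℝ) + (a + c)
      abel⟩
  exact h.vadd_of_comm y

lemma cube_fd :
    IsAddFundamentalDomain (Submodule.span ℤ (Set.range (Pi.basisFun ℝ (Fin d)))).toAddSubgroup
      (unitCube d) (volume : Measure (Fin d → ℝ)) := by
  have h := ZSpan.isAddFundamentalDomain' (Pi.basisFun ℝ (Fin d)) (volume : Measure (Fin d → ℝ))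
  rwa [← unitCube_eq] at h

lemma lintegral_cube_shift (f : (Fin d → ℝ) → ℝ≥0∞)
    (hf : ∀ (x : Fin d → ℝ) (n : Fin d → ℤ), f (x + fun i => (n i : ℝ)) = f x)
    (y : Fin d → ℝ) : ∫⁻ x, f (x + y) ∂(cubeVol d) = ∫⁻ x, f x ∂(cubeVol d) := by
  have : Countable (Submodule.span ℤ (Set.range (Pi.basisFun ℝ (Fin d)))).toAddSubgroup :=
    inferInstanceAs (Countable (Submodule.span ℤ (Set.range (Pi.basisFun ℝ (Fin d)))))
  have h1 := (cube_fd (d := d)).setLIntegral_eq (shift_fd y) f (by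
    intro g x
    obtain ⟨n, hn⟩ := lattice_int g
    change f ((g : Fin d → ℝ) + x) = f x
    rw [hn, add_comm, hf])
  rw [cubeVol, h1]
  have h2 := (measurePreserving_add_right (volume : Measure (Fin d → ℝ)) y).setLIntegral_comp_emb
    (measurableEmbedding_addRight y) f (unitCube d)
  rw [h2]
  congr 2
  ext z; simp [Set.mem_vadd_set_iff_neg_vadd_mem, add_comm]

lemma integral_cube_shift {F : Type*} [NormedAddCommGroup F] [NormedSpace ℝ F]
    (f : (Fin d → ℝ) → F)
    (hf : SpacePeriodic f)
    (y : Fin d → ℝ) : ∫ x, f (x + y) ∂(cubeVol d) = ∫ x, f x ∂(cubeVol d) := by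
  have : Countable (Submodule.span ℤ (Set.range (Pi.basisFun ℝ (Fin d)))).toAddSubgroup :=
    inferInstanceAs (Countable (Submodule.span ℤ (Set.range (Pi.basisFun ℝ (Fin d)))))
  have h1 := (cube_fd (d := d)).setIntegral_eq (shift_fd y) (f := f) (by
    intro g x
    obtain ⟨n, hn⟩ := lattice_int g
    change f ((g : Fin d → ℝ) + x) = f x
    rw [hn, add_comm, hf])
  rw [cubeVol, h1]
  have h2 := (measurePreserving_add_right (volume : Measure (Fin d → ℝ)) y).setIntegral_image_emb
    (measurableEmbedding_addRight y) f (unitCube d)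
  rw [← h2]
  congr 2
  ext z; simp [Set.mem_vadd_set_iff_neg_vadd_mem, add_comm]

/-- zero mean of a directional derivative of a periodic function -/
lemma integral_dir_deriv_zero (f f' : (Fin d → ℝ) → ℝ) (w : Fin d → ℝ)
    (hf : SpacePeriodic f) (hfm : Measurable f) (hfb : ∃ B, ∀ x, |f x| ≤ B)
    (hd : ∀ x, HasDerivAt (fun s : ℝ => f (x + s • w)) (f' x) 0)
    (hf'm : Measurable f') (hb : ∃ B, ∀ x, |f' x| ≤ B) :
    ∫ x, f' x ∂(cubeVol d) = 0 := by
  obtain ⟨B, hB⟩ := hb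
  obtain ⟨A, hA⟩ := hfb
  have key := hasDerivAt_integral_of_dominated_loc_of_deriv_le (μ := cubeVol d)
    (F := fun (s : ℝ) x => f (x + s • w)) (F' := fun s x => f' (x + s • w)) (x₀ := (0:ℝ))
    (s := Set.univ) (bound := fun _ => B) Filter.univ_mem
    (Filter.Eventually.of_forall fun s =>
      (hfm.comp (measurable_id.add_const _)).aestronglyMeasurable)
    (by
      refine Integrable.of_bound (C := A) ((hfm.comp (measurable_id.add_const _)).aestronglyMeasurable) ?_
      exact Filter.Eventually.of_forall fun x => hA _)
    ((hf'm.comp (measurable_id.add_const _)).aestronglyMeasurable)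
    (Filter.Eventually.of_forall fun x s _ => hB _)
    (integrable_const _)
    (Filter.Eventually.of_forall fun x s _ => by
      have h := hd (x + s • w)
      have h2 : HasDerivAt (fun u : ℝ => u - s) 1 s := (hasDerivAt_id s).sub_const s
      have h3 := HasDerivAt.comp (x := s) (h := fun u : ℝ => u - s)
        (h₂ := fun u : ℝ => f (x + s • w + u • w)) (h₂' := f' (x + s • w)) (h' := 1)
        (by simpa using h) h2
      have e : (fun u : ℝ => f (x + u • w)) =
          (fun u : ℝ => f (x + s • w + u • w)) ∘ (fun u : ℝ => u - s) := by
        funext u; simp only [Function.comp]; congr 1; module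
      rw [e]; simpa using h3)
  have h2 := key.2
  have e : (fun s : ℝ => ∫ x, f (x + s • w) ∂(cubeVol d)) = fun _ => ∫ x, f x ∂(cubeVol d) := by
    funext s; exact integral_cube_shift f hf _
  rw [e] at h2
  have := h2.unique (hasDerivAt_const _ _)
  simpa using this

/-- A mollifying kernel on the torus. -/
structure IsKer (K : (Fin d → ℝ) → ℝ) (L : ℝ) : Prop where
  smooth : ContDiff ℝ (⊤ : ℕ∞) K
  per : SpacePeriodic K
  pos : ∀ x, 0 < K x
  even : ∀ x, K (-x) = K x
  bdd : ∃ B, ∀ x, K x ≤ B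
  int_one : ∫⁻ x, ENNReal.ofReal (K x) ∂(cubeVol d) = 1
  L_nonneg : 0 ≤ L
  deriv_le : ∀ i x, |fderiv ℝ K x (Pi.single i 1)| ≤ L * K x

/-- Double integral change of variables. -/
lemma ker_change (K : (Fin d → ℝ) → ℝ) (L : ℝ) (hK : IsKer K L)
    (F : (Fin d → ℝ) → ℝ≥0∞) 
    (hF : ∀ (y : Fin d → ℝ) (n : Fin d → ℤ), F (y + fun i => (n i : ℝ)) = F y) (x : Fin d → ℝ) :
    ∫⁻ y, ENNReal.ofReal (K (x - y)) * F y ∂(cubeVol d)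
      = ∫⁻ h, ENNReal.ofReal (K h) * F (x + h) ∂(cubeVol d) := by
  rw [← lintegral_cube_shift (fun y => ENNReal.ofReal (K (x - y)) * F y) _ x]
  · refine lintegral_congr fun h => ?_
    have : x - (h + x) = -h := by abel
    simp only [this, hK.even]
    rw [add_comm h x]
  · intro y n
    rw [hF]
    have : x - (y + fun i => (n i : ℝ)) = (x - y) + fun i => ((-n) i : ℝ) := by
      funext i; simp; ring
    rw [this]
    have := hK.per (x - y) (-n)
    simp only [Pi.neg_apply] at this ⊢
    rw [this]

lemma ker_mass (K : (Fin d → ℝ) → ℝ) (L : ℝ) (hK : IsKer K L) (x : Fin d → ℝ) :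
    ∫⁻ y, ENNReal.ofReal (K (x - y)) ∂(cubeVol d) = 1 := by
  have := ker_change K L hK (fun _ => 1) (fun _ _ => rfl) x
  simp only [mul_one] at this
  rw [this, hK.int_one]

lemma ker_mass' (K : (Fin d → ℝ) → ℝ) (L : ℝ) (hK : IsKer K L) (y : Fin d → ℝ) :
    ∫⁻ x, ENNReal.ofReal (K (x - y)) ∂(cubeVol d) = 1 := by
  rw [← ker_mass K L hK y]
  refine lintegral_congr fun x => ?_
  rw [← hK.even (y - x), neg_sub]

/-- base profile -/
def kb (ε s : ℝ) : ℝ := 1 + (Real.sin (Real.pi * s) / ε) ^ 2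

lemma kb_ge_one (ε s : ℝ) : 1 ≤ kb ε s := by unfold kb; nlinarith [sq_nonneg (Real.sin (Real.pi * s) / ε)]
lemma kb_pos (ε s : ℝ) : 0 < kb ε s := lt_of_lt_of_le one_pos (kb_ge_one ε s)

lemma kb_contDiff (ε : ℝ) : ContDiff ℝ (⊤ : ℕ∞) (kb ε) := by
  unfold kb; fun_prop

lemma kb_cont (ε : ℝ) : Continuous (kb ε) := (kb_contDiff ε).continuous

lemma kb_per (ε s : ℝ) (n : ℤ) : kb ε (s + n) = kb ε s := by
  unfold kb
  have : Real.pi * (s + n) = Real.pi * s + n * Real.pi := by ring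
  rw [this, Real.sin_add_int_mul_pi, mul_div_assoc, mul_pow]
  have : ((-1 : ℝ) ^ n) ^ 2 = 1 := by
    rcases Int.even_or_odd n with h | h
    · simp [h.neg_one_zpow]
    · simp [h.neg_one_zpow]
  rw [this, one_mul]

lemma kb_neg (ε s : ℝ) : kb ε (-s) = kb ε s := by
  unfold kb; rw [mul_neg, Real.sin_neg, neg_div, neg_sq]

lemma kb_hasDeriv (ε s : ℝ) : HasDerivAt (kb ε)
    (2 * (Real.sin (Real.pi * s) / ε) * (Real.cos (Real.pi * s) * Real.pi / ε)) s := by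
  have h1 : HasDerivAt (fun s : ℝ => Real.pi * s) Real.pi s := by
    simpa using (hasDerivAt_id s).const_mul Real.pi
  have h2 := ((h1.sin).div_const ε).pow 2
  have h3 := h2.const_add 1
  convert! h3 using 1
  simp

lemma kb_deriv_le (ε s : ℝ) (hε : 0 < ε) : 
    |2 * (Real.sin (Real.pi * s) / ε) * (Real.cos (Real.pi * s) * Real.pi / ε)|
      ≤ Real.pi / ε * kb ε s := by
  have h1 : |Real.cos (Real.pi * s) * Real.pi / ε| ≤ Real.pi / ε := by
    rw [mul_div_assoc, abs_mul, abs_of_pos (div_pos Real.pi_pos hε)]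
    have := Real.abs_cos_le_one (Real.pi * s)
    have := div_pos Real.pi_pos hε
    nlinarith
  set a := Real.sin (Real.pi * s) / ε with ha
  have h2 : |2 * a| ≤ kb ε s := by
    unfold kb; rw [← ha, abs_mul, abs_two]
    nlinarith [sq_nonneg (|a| - 1), sq_abs a]
  rw [abs_mul, mul_comm (Real.pi / ε)]
  exact mul_le_mul h2 h1 (abs_nonneg _) (kb_pos _ _).le

lemma sin_ge_round (s : ℝ) : 2 * |s - round s| ≤ |Real.sin (Real.pi * s)| := by
  have h0 : |Real.sin (Real.pi * s)| = |Real.sin (Real.pi * (s - round s))| := by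
    have : Real.pi * s = Real.pi * (s - round s) + round s * Real.pi := by ring
    rw [this, Real.sin_add_int_mul_pi, abs_mul]
    have : |((-1 : ℝ) ^ (round s))| = 1 := by
      rw [abs_zpow]; simp
    rw [this, one_mul]
  rw [h0]
  have hr := abs_sub_round s
  set u := s - round s
  have h1 : |Real.sin (Real.pi * u)| = |Real.sin (Real.pi * |u|)| := by
    rcases abs_choice u with h | h
    · rw [h]
    · rw [h, mul_neg, Real.sin_neg, abs_neg]
  rw [h1]
  have h2 := Real.mul_le_sin (x := Real.pi * |u|) (by positivity) (by nlinarith [Real.pi_pos])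
  refine le_trans (le_of_eq ?_) (h2.trans (le_abs_self _))
  field_simp

lemma kb_upper (ε : ℝ) (hε : 0 < ε) :
    ∫ s in Set.Ico (0:ℝ) 1, (kb ε s)⁻¹ ≤ Real.pi * ε := by
  have hg : Integrable (fun s : ℝ => (1 + (2 / ε * s) ^ 2)⁻¹) :=
    (integrable_inv_one_add_sq).comp_mul_left' (R := 2 / ε) (by positivity)
  have hg2 : Integrable (fun s : ℝ => (1 + (2 / ε * (1 - s)) ^ 2)⁻¹) := hg.comp_sub_left 1
  have i1 : ∫ s : ℝ, (1 + (2 / ε * s) ^ 2)⁻¹ = ε / 2 * Real.pi := by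
    rw [Measure.integral_comp_mul_left (fun s : ℝ => (1 + s ^ 2)⁻¹), integral_univ_inv_one_add_sq]
    rw [abs_of_pos (by positivity)]; simp
  have i2 : ∫ s : ℝ, (1 + (2 / ε * (1 - s)) ^ 2)⁻¹ = ε / 2 * Real.pi := by
    rw [integral_sub_left_eq_self (fun s : ℝ => (1 + (2 / ε * s) ^ 2)⁻¹) volume 1, i1]
  have hpos : ∀ a : ℝ, 0 ≤ (1 + a ^ 2)⁻¹ := fun a => by positivity
  calc ∫ s in Set.Ico (0:ℝ) 1, (kb ε s)⁻¹ 
      ≤ ∫ s in Set.Ico (0:ℝ) 1, ((1 + (2 / ε * s) ^ 2)⁻¹ + (1 + (2 / ε * (1 - s)) ^ 2)⁻¹) := by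
        refine integral_mono_of_nonneg (Filter.Eventually.of_forall fun s => (inv_pos.2 (kb_pos _ _)).le)
          ((hg.add hg2).integrableOn) ?_
        refine (ae_restrict_mem measurableSet_Ico).mono fun s hs => ?_
        simp only [Pi.add_apply]
        have hsn : 0 ≤ Real.sin (Real.pi * s) :=
          Real.sin_nonneg_of_nonneg_of_le_pi (by nlinarith [Real.pi_pos, hs.1])
            (by nlinarith [Real.pi_pos, hs.2])
        rcases le_total s (1/2) with h | h
        · have h2 := Real.mul_le_sin (x := Real.pi * s) (by nlinarith [Real.pi_pos, hs.1])
            (by nlinarith [Real.pi_pos])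
          have h3 : 2 / Real.pi * (Real.pi * s) = 2 * s := by field_simp
          rw [h3] at h2
          have : 1 + (2 / ε * s) ^ 2 ≤ kb ε s := by
            unfold kb
            have : 2 / ε * s = (2 * s) / ε := by ring
            rw [this]
            have : 0 ≤ 2 * s := by linarith [hs.1]
            gcongr
          have := inv_anti₀ (by positivity) this
          linarith [hpos (2 / ε * (1 - s))]
        · have h2 := Real.mul_le_sin (x := Real.pi * (1 - s)) (by nlinarith [Real.pi_pos, hs.2])
            (by nlinarith [Real.pi_pos])
          have h3 : 2 / Real.pi * (Real.pi * (1 - s)) = 2 * (1 - s) := by field_simp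
          have h4 : Real.sin (Real.pi * (1 - s)) = Real.sin (Real.pi * s) := by
            rw [mul_sub, mul_one, Real.sin_pi_sub]
          rw [h3, h4] at h2
          have : 1 + (2 / ε * (1 - s)) ^ 2 ≤ kb ε s := by
            unfold kb
            have : 2 / ε * (1 - s) = (2 * (1 - s)) / ε := by ring
            rw [this]
            have : 0 ≤ 2 * (1 - s) := by linarith [hs.2]
            gcongr
          have := inv_anti₀ (by positivity) this
          linarith [hpos (2 / ε * s)]
    _ ≤ ∫ s : ℝ, ((1 + (2 / ε * s) ^ 2)⁻¹ + (1 + (2 / ε * (1 - s)) ^ 2)⁻¹) :=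
        setIntegral_le_integral (hg.add hg2)
          (Filter.Eventually.of_forall fun s => add_nonneg (hpos _) (hpos _))
    _ = Real.pi * ε := by
        rw [integral_add hg hg2, i1, i2]; ring

lemma kb_integrable (ε : ℝ) (N : ℕ) :
    IntegrableOn (fun s => ((kb ε s)⁻¹) ^ N) (Set.Ico (0:ℝ) 1) := by
  refine IntegrableOn.mono_set ?_ Set.Ico_subset_Icc_self
  refine ContinuousOn.integrableOn_Icc ?_
  exact ((kb_cont ε).inv₀ (fun s => (kb_pos ε s).ne')).pow N |>.continuousOn

lemma kb_lower (ε : ℝ) (hε : 0 < ε) (hε1 : ε < 1) (N : ℕ) :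
    (2⁻¹) ^ N * (ε / Real.pi) ≤ ∫ s in Set.Ico (0:ℝ) 1, ((kb ε s)⁻¹) ^ N := by
  have hsub : Set.Ico (0:ℝ) (ε / Real.pi) ⊆ Set.Ico 0 1 := by
    apply Set.Ico_subset_Ico_right
    rw [div_le_one Real.pi_pos]; linarith [Real.pi_gt_three]
  have h1 : ∫ s in Set.Ico (0:ℝ) (ε / Real.pi), ((2:ℝ)⁻¹) ^ N = (2⁻¹) ^ N * (ε / Real.pi) := by
    rw [setIntegral_const]
    simp [abs_of_pos, Measure.real, hε.le, Real.pi_pos.le, div_nonneg]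
    ring
  rw [← h1]
  refine le_trans ?_ (setIntegral_mono_set (kb_integrable ε N)
    (Filter.Eventually.of_forall fun s => by have := kb_pos ε s; positivity) hsub.eventuallyLE)
  refine setIntegral_mono_on (by simp [integrableOn_const_iff]) ((kb_integrable ε N).mono_set hsub)
    measurableSet_Ico fun s hs => ?_
  have hk : kb ε s ≤ 2 := by
    have h2 : Real.pi * s ≤ ε := by
      have := hs.2.le
      rw [le_div_iff₀ Real.pi_pos] at this; linarith
    have h0 : 0 ≤ Real.pi * s := mul_nonneg Real.pi_pos.le hs.1
    have h3 : Real.sin (Real.pi * s) ≤ ε := (Real.sin_le h0).trans h2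
    have h4 : 0 ≤ Real.sin (Real.pi * s) :=
      Real.sin_nonneg_of_nonneg_of_le_pi h0 (by linarith [Real.pi_gt_three])
    have h5 : Real.sin (Real.pi * s) / ε ≤ 1 := by rwa [div_le_one hε]
    have h6 : 0 ≤ Real.sin (Real.pi * s) / ε := by positivity
    unfold kb; nlinarith
  have := kb_pos ε s
  gcongr

lemma cubeVol_pi : cubeVol d = Measure.pi (fun _ : Fin d => (volume : Measure ℝ).restrict (Set.Ico 0 1)) := by
  rw [cubeVol, unitCube, volume_pi, Measure.restrict_pi_pi]

/-- unnormalized product kernel -/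
def kprod (d N : ℕ) (ε : ℝ) (x : Fin d → ℝ) : ℝ := ∏ i, ((kb ε (x i))⁻¹) ^ N

lemma kprod_pos (N : ℕ) (ε : ℝ) (x : Fin d → ℝ) : 0 < kprod d N ε x :=
  Finset.prod_pos fun i _ => pow_pos (inv_pos.2 (kb_pos _ _)) _

lemma kprod_le_one (N : ℕ) (ε : ℝ) (x : Fin d → ℝ) : kprod d N ε x ≤ 1 :=
  Finset.prod_le_one (fun i _ => (pow_pos (inv_pos.2 (kb_pos _ _)) _).le) fun i _ =>
    pow_le_one₀ (inv_pos.2 (kb_pos _ _)).le (inv_le_one_of_one_le₀ (kb_ge_one _ _))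

lemma kprod_smooth (N : ℕ) (ε : ℝ) : ContDiff ℝ (⊤ : ℕ∞) (kprod d N ε) := by
  unfold kprod
  refine contDiff_prod fun i _ => ?_
  exact (((kb_contDiff ε).comp (contDiff_apply ℝ ℝ i)).inv (fun x => (kb_pos _ _).ne')).pow N

lemma kprod_integrable (N : ℕ) (ε : ℝ) : Integrable (kprod d N ε) (cubeVol d) := by
  refine Integrable.of_bound (C := 1) (kprod_smooth N ε).continuous.aestronglyMeasurable ?_
  refine Filter.Eventually.of_forall fun x => ?_
  rw [Real.norm_of_nonneg (kprod_pos N ε x).le]; exact kprod_le_one N ε x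

lemma kprod_integral (N : ℕ) (ε : ℝ) : ∫ x, kprod d N ε x ∂(cubeVol d) =
    (∫ s in Set.Ico (0:ℝ) 1, ((kb ε s)⁻¹) ^ N) ^ d := by
  rw [cubeVol_pi]
  unfold kprod
  rw [integral_fintype_prod_eq_pow (fun s => ((kb ε s)⁻¹) ^ N)]
  simp

lemma kprod_deriv (N : ℕ) (ε : ℝ) (hε : 0 < ε) (i : Fin d) (x : Fin d → ℝ) :
    |fderiv ℝ (kprod d N ε) x (Pi.single i 1)| ≤ (N * (Real.pi / ε)) * kprod d N ε x := by
  have h1 : HasDerivAt (fun s : ℝ => kprod d N ε (x + s • (Pi.single i 1 : Fin d → ℝ)))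
      (fderiv ℝ (kprod d N ε) x (Pi.single i 1)) 0 := by
    have hf := ((kprod_smooth (d := d) N ε).differentiable (by simp) x).hasFDerivAt
    exact hf.hasLineDerivAt (Pi.single i 1)
  have heq : ∀ s : ℝ, kprod d N ε (x + s • (Pi.single i 1 : Fin d → ℝ)) =
      ((kb ε (x i + s))⁻¹) ^ N * ∏ j ∈ Finset.univ.erase i, ((kb ε (x j))⁻¹) ^ N := by
    intro s
    unfold kprod
    rw [← Finset.mul_prod_erase _ _ (Finset.mem_univ i)]
    congr 1
    · simp
    · refine Finset.prod_congr rfl fun j hj => ?_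
      simp [Pi.single_eq_of_ne (Finset.ne_of_mem_erase hj)]
  have hk : HasDerivAt (fun s : ℝ => kb ε (x i + s)) _ 0 :=
    HasDerivAt.comp_const_add (x i) 0 (by simpa using kb_hasDeriv ε (x i))
  have h2 := ((hk.inv (kb_pos ε _).ne').pow N).mul_const
    (∏ j ∈ Finset.univ.erase i, ((kb ε (x j))⁻¹) ^ N)
  have h3 := h1.unique (h2.congr_of_eventuallyEq (Filter.Eventually.of_forall heq))
  have h0 := heq 0
  simp only [zero_smul, add_zero] at h0 h3
  rw [h3, h0]
  have hP : 0 ≤ ∏ j ∈ Finset.univ.erase i, ((kb ε (x j))⁻¹) ^ N :=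
    Finset.prod_nonneg fun i _ => (pow_pos (inv_pos.2 (kb_pos _ _)) _).le
  rw [abs_mul, abs_of_nonneg hP, ← mul_assoc]
  refine mul_le_mul_of_nonneg_right ?_ hP
  have hd := kb_deriv_le ε (x i) hε
  have hb := kb_pos ε (x i)
  simp only [Pi.inv_apply, add_zero]
  set D := 2 * (Real.sin (Real.pi * x i) / ε) * (Real.cos (Real.pi * x i) * Real.pi / ε)
  set b := kb ε (x i)
  rcases N with _ | n
  · simp
  · rw [abs_mul, abs_mul, abs_div, abs_neg, abs_of_nonneg (by positivity : (0:ℝ) ≤ ((n+1:ℕ):ℝ)),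
      abs_of_nonneg (by positivity : (0:ℝ) ≤ b^2), abs_of_nonneg (by positivity)]
    simp only [Nat.add_sub_cancel]
    have : |D| / b^2 ≤ Real.pi / ε * b⁻¹ := by
      rw [div_le_iff₀ (by positivity)]
      calc |D| ≤ _ := hd
        _ = _ := by field_simp
    calc _ ≤ ((n+1:ℕ):ℝ) * b⁻¹ ^ n * (Real.pi / ε * b⁻¹) := by gcongr
      _ = _ := by ring

lemma one_add_sum_le_prod {ι : Type*} (s : Finset ι) (f : ι → ℝ) (hf : ∀ i, 0 ≤ f i) :
    1 + ∑ i ∈ s, f i ≤ ∏ i ∈ s, (1 + f i) := by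
  classical
  induction s using Finset.induction_on with
  | empty => simp
  | insert a s ha ih =>
    rw [Finset.sum_insert ha, Finset.prod_insert ha]
    have h1 : 0 ≤ ∑ i ∈ s, f i := Finset.sum_nonneg fun i _ => hf i
    nlinarith [hf a, mul_nonneg (hf a) h1]

/-- distance to lattice vector -/
def lat (h : Fin d → ℝ) : Fin d → ℝ := fun i => h i - round (h i)

lemma euNorm_nonneg (x : Fin d → ℝ) : 0 ≤ euNorm x := Real.sqrt_nonneg _

lemma kprod_moment (J : ℕ) (ε : ℝ) (hε : 0 < ε) (h : Fin d → ℝ) (s : ℝ) (hs : 0 ≤ s)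
    (hsJ : s ≤ 2 * J) :
    kprod d (J+1) ε h * euNorm (lat h) ^ s ≤ ε ^ s * kprod d 1 ε h := by
  set u := euNorm (lat h) / ε with hu
  have hu0 : 0 ≤ u := div_nonneg (euNorm_nonneg _) hε.le
  have h1 : euNorm (lat h) = ε * u := by rw [hu]; field_simp
  rw [h1, Real.mul_rpow hε.le hu0]
  have h2 : u ^ s ≤ (1 + u^2) ^ J := by
    rcases le_total u 1 with h | h
    · exact (Real.rpow_le_one hu0 h hs).trans (one_le_pow₀ (by nlinarith))
    · calc u ^ s ≤ u ^ (2 * J : ℝ) := Real.rpow_le_rpow_of_exponent_le h hsJ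
        _ = (u^2) ^ J := by rw [Real.rpow_mul hu0]; norm_cast
        _ ≤ _ := by gcongr; linarith
  have h3 : 1 + u^2 ≤ ∏ i, kb ε (h i) := by
    have : u^2 = ∑ i, (lat h i / ε)^2 := by
      rw [hu, div_pow, euNorm, Real.sq_sqrt (Finset.sum_nonneg fun i _ => sq_nonneg _), Finset.sum_div]
      exact Finset.sum_congr rfl fun i _ => by rw [div_pow]
    rw [this]
    refine (one_add_sum_le_prod _ _ fun i => sq_nonneg _).trans ?_
    refine Finset.prod_le_prod (fun i _ => by positivity) fun i _ => ?_
    unfold kb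
    rw [add_le_add_iff_left]
    rw [sq_le_sq, abs_div, abs_div]
    refine div_le_div_of_nonneg_right ?_ (abs_nonneg _)
    have := sin_ge_round (h i)
    unfold lat
    linarith [abs_nonneg (h i - round (h i))]
  have h4 : kprod d (J+1) ε h * (∏ i, kb ε (h i)) ^ J = kprod d 1 ε h := by
    unfold kprod
    rw [← Finset.prod_pow, ← Finset.prod_mul_distrib]
    refine Finset.prod_congr rfl fun i _ => ?_
    have := (kb_pos ε (h i)).ne'
    rw [pow_succ, pow_one, mul_right_comm, ← mul_pow, inv_mul_cancel₀ this, one_pow, one_mul]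
  calc kprod d (J+1) ε h * (ε ^ s * u ^ s) = ε ^ s * (kprod d (J+1) ε h * u ^ s) := by ring
    _ ≤ ε ^ s * (kprod d (J+1) ε h * (∏ i, kb ε (h i)) ^ J) := by
        have := (kprod_pos (J+1) ε h).le
        have h5 : (1 + u^2)^J ≤ (∏ i, kb ε (h i)) ^ J := by gcongr
        have h6 := Real.rpow_nonneg hε.le s
        gcongr
        exact h2.trans h5
    _ = _ := by rw [h4]

lemma exists_ker (d J : ℕ) : ∃ C L : ℝ, 0 < C ∧ 0 < L ∧ ∀ ε : ℝ, 0 < ε → ε < 1 →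
    ∃ K : (Fin d → ℝ) → ℝ, IsKer K (L / ε) ∧ ∀ s : ℝ, 0 ≤ s → s ≤ 2 * J →
      ∫⁻ h, ENNReal.ofReal (K h) * ENNReal.ofReal (euNorm (lat h) ^ s) ∂(cubeVol d)
        ≤ ENNReal.ofReal (C * ε ^ s) := by
  refine ⟨(Real.pi ^ 2 * 2 ^ (J+1)) ^ d, (J+1 : ℕ) * Real.pi, by positivity, by positivity, ?_⟩
  intro ε hε hε1
  set Z := ∫ x, kprod d (J+1) ε x ∂(cubeVol d) with hZ
  have hlow : ((2⁻¹) ^ (J+1) * (ε / Real.pi)) ^ d ≤ Z := by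
    rw [hZ, kprod_integral]
    exact pow_le_pow_left₀ (by positivity) (kb_lower ε hε hε1 _) d
  have hlp : 0 < ((2⁻¹) ^ (J+1) * (ε / Real.pi)) ^ d := by positivity
  have hZp : 0 < Z := lt_of_lt_of_le hlp hlow
  have hZi : 0 < Z⁻¹ := inv_pos.2 hZp
  have hsm : ContDiff ℝ (⊤ : ℕ∞) (fun x => Z⁻¹ * kprod d (J+1) ε x) :=
    contDiff_const.mul (kprod_smooth _ _)
  refine ⟨fun x => Z⁻¹ * kprod d (J+1) ε x, ⟨hsm, ?_, ?_, ?_, ?_, ?_, by positivity, ?_⟩, ?_⟩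
  · intro x n
    simp only [kprod, Pi.add_apply, kb_per]
  · intro x; exact mul_pos hZi (kprod_pos _ _ _)
  · intro x; simp only [kprod, Pi.neg_apply, kb_neg]
  · exact ⟨Z⁻¹, fun x => mul_le_of_le_one_right hZi.le (kprod_le_one _ _ _)⟩
  · rw [← ofReal_integral_eq_lintegral_ofReal ((kprod_integrable _ _).const_mul _)
      (Filter.Eventually.of_forall fun x => (mul_pos hZi (kprod_pos _ _ _)).le),
      integral_const_mul, ← hZ, inv_mul_cancel₀ hZp.ne', ENNReal.ofReal_one]
  · intro i x
    rw [fderiv_const_mul ((kprod_smooth _ _).differentiable (by simp) x)]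
    simp only [_root_.smul_apply, smul_eq_mul]
    rw [abs_mul, abs_of_pos hZi]
    have := kprod_deriv (J+1) ε hε i x
    calc _ ≤ _ := mul_le_mul_of_nonneg_left this hZi.le
      _ = _ := by ring
  · intro s hs hsJ
    calc _ ≤ ∫⁻ h, ENNReal.ofReal (Z⁻¹ * ε ^ s * kprod d 1 ε h) ∂(cubeVol d) := by
          refine lintegral_mono fun h => ?_
          rw [← ENNReal.ofReal_mul (mul_pos hZi (kprod_pos _ _ _)).le]
          refine ENNReal.ofReal_le_ofReal ?_
          have := kprod_moment J ε hε h s hs hsJ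
          calc _ = Z⁻¹ * (kprod d (J+1) ε h * euNorm (lat h) ^ s) := by ring
            _ ≤ Z⁻¹ * (ε ^ s * kprod d 1 ε h) := mul_le_mul_of_nonneg_left this hZi.le
            _ = _ := by ring
      _ = ENNReal.ofReal (Z⁻¹ * ε ^ s * ∫ h, kprod d 1 ε h ∂(cubeVol d)) := by
          rw [← ofReal_integral_eq_lintegral_ofReal ((kprod_integrable _ _).const_mul _)
            (Filter.Eventually.of_forall fun x => mul_nonneg (mul_nonneg hZi.le (Real.rpow_nonneg hε.le s)) (kprod_pos 1 ε x).le),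
            integral_const_mul]
      _ ≤ _ := by
          refine ENNReal.ofReal_le_ofReal ?_
          have h1 : ∫ h, kprod d 1 ε h ∂(cubeVol d) ≤ (Real.pi * ε) ^ d := by
            rw [kprod_integral]
            simp only [pow_one]
            exact pow_le_pow_left₀ (integral_nonneg fun s => (inv_pos.2 (kb_pos _ _)).le)
              (kb_upper ε hε) d
          have h2 : Z⁻¹ ≤ (((2⁻¹) ^ (J+1) * (ε / Real.pi)) ^ d)⁻¹ := inv_anti₀ hlp hlow
          have h3 : (((2⁻¹) ^ (J+1) * (ε / Real.pi)) ^ d)⁻¹ * (Real.pi * ε) ^ d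
              = (Real.pi ^ 2 * 2 ^ (J+1)) ^ d := by
            rw [← inv_pow, ← mul_pow]
            congr 1
            field_simp
            rw [← mul_pow]; norm_num
          have h4 : 0 ≤ ∫ h, kprod d 1 ε h ∂(cubeVol d) := integral_nonneg fun h => (kprod_pos _ _ _).le
          calc _ = (Z⁻¹ * ∫ h, kprod d 1 ε h ∂(cubeVol d)) * ε ^ s := by ring
            _ ≤ ((((2⁻¹) ^ (J+1) * (ε / Real.pi)) ^ d)⁻¹ * (Real.pi * ε) ^ d) * ε ^ s := by
                gcongr
            _ = _ := by rw [h3]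

/-- compact support in `(0,T)` -/
def TSupp (T : ℝ) (φ : ℝ → ℝ) : Prop := ∃ a b : ℝ, 0 < a ∧ b < T ∧ ∀ t, t ∉ Set.Icc a b → φ t = 0

lemma tsupp_of_compact (T : ℝ) (g : ℝ → ℝ) (hg : HasCompactSupport g)
    (hs : tsupport g ⊆ Set.Ioo 0 T) : TSupp T g := by
  by_cases hne : (tsupport g).Nonempty
  · obtain ⟨a, ha, hal⟩ := hg.exists_isLeast hne
    obtain ⟨b, hb, hbl⟩ := hg.exists_isGreatest hne
    refine ⟨a, b, (hs ha).1, (hs hb).2, fun t ht => ?_⟩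
    by_contra h
    have := subset_tsupport g (Function.mem_support.2 h)
    exact ht ⟨hal this, hbl this⟩
  · rw [Set.not_nonempty_iff_eq_empty] at hne
    refine ⟨1, T - 1, one_pos, by linarith, fun t _ => ?_⟩
    by_contra h
    have := subset_tsupport g (Function.mem_support.2 h)
    rw [hne] at this; exact this

lemma dbr (T : ℝ) (F : ℝ → ℝ) (hF : IntegrableOn F (Set.Ioo 0 T))
    (h : ∀ ψ : ℝ → ℝ, ContDiff ℝ (⊤ : ℕ∞) ψ → TSupp T ψ → ∫ t in Set.Ioo 0 T, ψ t * F t = 0) :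
    ∀ᵐ t ∂(volume.restrict (Set.Ioo 0 T)), F t = 0 := by
  rw [ae_restrict_iff' measurableSet_Ioo]
  refine IsOpen.ae_eq_zero_of_integral_contDiff_smul_eq_zero isOpen_Ioo hF.locallyIntegrableOn ?_
  intro g hg hgc hgs
  rw [← h g hg (tsupp_of_compact T g hgc hgs)]
  rw [← setIntegral_eq_integral_of_forall_compl_eq_zero (s := Set.Ioo 0 T)]
  · rfl
  · intro x hx
    have : g x = 0 := by
      by_contra h'
      exact hx (hgs (subset_tsupport g (Function.mem_support.2 h')))
    simp [this]

lemma ioo_interval (T : ℝ) (hT : 0 < T) (F : ℝ → ℝ) :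
    ∫ t in Set.Ioo 0 T, F t = ∫ t in (0:ℝ)..T, F t := by
  rw [intervalIntegral.integral_of_le hT.le, integral_Ioc_eq_integral_Ioo]

lemma ioo_intervalIntegrable (T : ℝ) (hT : 0 < T) (F : ℝ → ℝ) (hF : IntegrableOn F (Set.Ioo 0 T)) :
    IntervalIntegrable F volume 0 T := by
  rw [intervalIntegrable_iff_integrableOn_Ioo_of_le hT.le]; exact hF

lemma smooth_ac (χ : ℝ → ℝ) (hχ : ContDiff ℝ (⊤ : ℕ∞) χ) (a b : ℝ) :
    AbsolutelyContinuousOnInterval χ a b := by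
  have hc : Continuous (deriv χ) := hχ.continuous_deriv (by simp)
  obtain ⟨C, hC⟩ := (isCompact_uIcc (a := a) (b := b)).exists_bound_of_continuousOn hc.continuousOn
  have hL : LipschitzOnWith (Real.toNNReal C) χ (Set.uIcc a b) := by
    refine (convex_uIcc a b).lipschitzOnWith_of_nnnorm_hasDerivWithin_le (f' := deriv χ)
      (fun x _ => ((hχ.differentiable (by simp)) x).hasDerivAt.hasDerivWithinAt) fun x hx => ?_
    rw [← NNReal.coe_le_coe]
    exact (hC x hx).trans (Real.le_coe_toNNReal C)
  exact hL.absolutelyContinuousOnInterval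

/-- From the weak-in-time formulation to the integrated one. -/
lemma time_int (T : ℝ) (hT : 0 < T) (R A : ℝ → ℝ) (R0 : ℝ)
    (hR : IntegrableOn R (Set.Ioo 0 T)) (hA : IntegrableOn A (Set.Ioo 0 T))
    (h : ∀ θ : ℝ → ℝ, ContDiff ℝ (⊤ : ℕ∞) θ → (∃ b < T, ∀ t, b ≤ t → θ t = 0) →
      (∫ t in Set.Ioo 0 T, (deriv θ t * R t - θ t * A t)) + θ 0 * R0 = 0) :
    ∀ᵐ t ∂(volume.restrict (Set.Ioo 0 T)), R t = R0 - ∫ s in (0:ℝ)..t, A s := by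
  have hAi := ioo_intervalIntegrable T hT A hA
  have hac := hAi.absolutelyContinuousOnInterval_intervalIntegral (c := 0) Set.left_mem_uIcc
  have hcont : ContinuousOn (fun t => ∫ s in (0:ℝ)..t, A s) (Set.Icc 0 T) := by
    have := hac.continuousOn; rwa [Set.uIcc_of_le hT.le] at this
  have hbi : IntegrableOn (fun t => ∫ s in (0:ℝ)..t, A s) (Set.Ioo 0 T) :=
    (hcont.integrableOn_Icc).mono_set Set.Ioo_subset_Icc_self
  have hci : IntegrableOn (fun _ : ℝ => R0) (Set.Ioo 0 T) := by simp [integrableOn_const_iff]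
  have key := dbr T (fun t => R t - R0 + ∫ s in (0:ℝ)..t, A s) ((hR.sub hci).add hbi) ?_
  · filter_upwards [key] with t ht
    linarith
  intro ψ hψ hψs
  obtain ⟨a, b, ha, hb, hab⟩ := hψs
  have hψc : Continuous ψ := hψ.continuous
  set θ : ℝ → ℝ := fun t => ∫ s in T..t, ψ s with hθ
  have hθd : ∀ t, HasDerivAt θ (ψ t) t := fun t =>
    intervalIntegral.integral_hasDerivAt_right (hψc.intervalIntegrable _ _)
      hψc.stronglyMeasurable.stronglyMeasurableAtFilter hψc.continuousAt
  have hθ' : deriv θ = ψ := funext fun t => (hθd t).deriv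
  have hθs : ContDiff ℝ (⊤ : ℕ∞) θ := by
    rw [contDiff_infty_iff_deriv, hθ']
    exact ⟨fun t => (hθd t).differentiableAt, hψ⟩
  have hθ0 : ∀ t, b + (T - b) / 2 ≤ t → θ t = 0 := by
    intro t ht
    refine intervalIntegral.integral_zero_ae (Filter.Eventually.of_forall fun s hs => ?_)
    apply hab
    rw [Set.mem_uIoc] at hs
    intro h'
    rcases hs with hs | hs <;> linarith [h'.2, hs.1]
  have h1 := h θ hθs ⟨b + (T - b) / 2, by linarith, hθ0⟩
  have h2 := (smooth_ac θ hθs 0 T).integral_mul_deriv_eq_deriv_mul hac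
  have h3 : ∫ t in (0:ℝ)..T, θ t * deriv (fun t => ∫ s in (0:ℝ)..t, A s) t
      = ∫ t in (0:ℝ)..T, θ t * A t := by
    refine intervalIntegral.integral_congr_ae ?_
    filter_upwards [hAi.ae_hasDerivAt_integral] with t ht ht2
    rw [(ht (Set.uIoc_subset_uIcc ht2) 0 Set.left_mem_uIcc).deriv]
  rw [h3, hθ0 T (by linarith), hθ'] at h2
  simp only [intervalIntegral.integral_same, mul_zero, zero_mul, sub_zero, zero_sub] at h2
  have h4 : θ 0 = - ∫ t in (0:ℝ)..T, ψ t := by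
    rw [hθ]; simp only; rw [intervalIntegral.integral_symm]
  have iψ : ∀ G : ℝ → ℝ, IntegrableOn G (Set.Ioo 0 T) →
      IntegrableOn (fun t => ψ t * G t) (Set.Ioo 0 T) := by
    intro G hG
    obtain ⟨C, hC⟩ := (isCompact_Icc (a := (0:ℝ)) (b := T)).exists_bound_of_continuousOn hψc.continuousOn
    refine Integrable.bdd_mul (c := C) hG hψc.aestronglyMeasurable ?_
    exact (ae_restrict_mem measurableSet_Ioo).mono fun t ht => hC t (Set.Ioo_subset_Icc_self ht)
  have iθ : IntegrableOn (fun t => θ t * A t) (Set.Ioo 0 T) := by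
    obtain ⟨C, hC⟩ := (isCompact_Icc (a := (0:ℝ)) (b := T)).exists_bound_of_continuousOn hθs.continuous.continuousOn
    refine Integrable.bdd_mul (c := C) hA hθs.continuous.aestronglyMeasurable ?_
    exact (ae_restrict_mem measurableSet_Ioo).mono fun t ht => hC t (Set.Ioo_subset_Icc_self ht)
  rw [hθ', integral_sub (iψ R hR) iθ] at h1
  have e1 : ∀ t, ψ t * (R t - R0 + ∫ s in (0:ℝ)..t, A s)
      = ψ t * R t - ψ t * R0 + ψ t * ∫ s in (0:ℝ)..t, A s := fun t => by ring
  simp_rw [e1]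
  rw [integral_add (f := fun t => ψ t * R t - ψ t * R0) ((iψ R hR).sub (iψ _ hci)) (iψ _ hbi), integral_sub (iψ R hR) (iψ _ hci),
    integral_mul_const]
  rw [ioo_interval T hT (fun t => θ t * A t), h2, h4] at h1
  rw [ioo_interval T hT ψ, ioo_interval T hT (fun t => ψ t * ∫ s in (0:ℝ)..t, A s)]
  linarith

lemma ac_comp (f : ℝ → ℝ) (a b : ℝ) (hf : AbsolutelyContinuousOnInterval f a b) (φ : ℝ → ℝ) 
    (s : Set ℝ) (K : NNReal) (hφ : LipschitzOnWith K φ s) (hfs : ∀ t ∈ Set.uIcc a b, f t ∈ s) :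
    AbsolutelyContinuousOnInterval (fun t => φ (f t)) a b := by
  rw [absolutelyContinuousOnInterval_iff] at hf ⊢
  intro ε hε
  obtain ⟨δ, hδ, h⟩ := hf (ε / (K + 1)) (by positivity)
  refine ⟨δ, hδ, fun E hE hE2 => ?_⟩
  have h1 := h E hE hE2
  calc _ ≤ ∑ i ∈ Finset.range E.1, K * dist (f (E.2 i).1) (f (E.2 i).2) := by
        refine Finset.sum_le_sum fun i hi => ?_
        have := hE.1 i (Finset.mem_range.1 hi |> fun h => by simpa using h)
        exact hφ.dist_le_mul _ (hfs _ this.1) _ (hfs _ this.2)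
    _ = K * ∑ i ∈ Finset.range E.1, dist (f (E.2 i).1) (f (E.2 i).2) := by rw [Finset.mul_sum]
    _ ≤ K * (ε / (K + 1)) := by gcongr
    _ < ε := by
        rw [mul_div_assoc', div_lt_iff₀ (by positivity)]; nlinarith [K.2]

lemma lip_of_deriv (φ φ' : ℝ → ℝ) (a b : ℝ) (h : ∀ x ∈ Set.Icc a b, HasDerivAt φ (φ' x) x)
    (hc : ContinuousOn φ' (Set.Icc a b)) : ∃ K : NNReal, LipschitzOnWith K φ (Set.Icc a b) := by
  obtain ⟨C, hC⟩ := (isCompact_Icc (a := a) (b := b)).exists_bound_of_continuousOn hc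
  refine ⟨Real.toNNReal C, (convex_Icc a b).lipschitzOnWith_of_nnnorm_hasDerivWithin_le (f' := φ')
      (fun x hx => (h x hx).hasDerivWithinAt) fun x hx => ?_⟩
  rw [← NNReal.coe_le_coe]
  exact (hC x hx).trans (Real.le_coe_toNNReal C)

set_option maxHeartbeats 400000 in
/-- chain rule in time for the averaged energy -/
lemma time_chain (T : ℝ) (hT : 0 < T) (c γ k : ℝ) (hc : 0 < c) 
    (r A : ℝ → ℝ) (m B : Fin d → ℝ → ℝ) (r0 : ℝ) (m0 : Fin d → ℝ)
    (hA : IntegrableOn A (Set.Ioo 0 T)) (hB : ∀ j, IntegrableOn (B j) (Set.Ioo 0 T))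
    (hr : ∀ᵐ t ∂(volume.restrict (Set.Ioo 0 T)), r t = r0 - ∫ s in (0:ℝ)..t, A s)
    (hm : ∀ j, ∀ᵐ t ∂(volume.restrict (Set.Ioo 0 T)), m j t = m0 j - ∫ s in (0:ℝ)..t, B j s)
    (hrc : ∀ᵐ t ∂(volume.restrict (Set.Ioo 0 T)), c ≤ r t)
    (χ : ℝ → ℝ) (hχ : ContDiff ℝ (⊤ : ℕ∞) χ) (hχs : TSupp T χ) :
    ∫ t in Set.Ioo 0 T, deriv χ t * (1 / 2 * ((∑ j, m j t ^ 2) * (r t)⁻¹) + k * r t ^ γ)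
      = ∫ t in Set.Ioo 0 T, χ t * ((k * γ * r t ^ (γ - 1)
          - 1 / 2 * ((∑ j, m j t ^ 2) * ((r t)^2)⁻¹)) * A t + ∑ j, m j t * (r t)⁻¹ * B j t) := by
  have hAi := ioo_intervalIntegrable T hT A hA
  have hBi := fun j => ioo_intervalIntegrable T hT (B j) (hB j)
  set r' : ℝ → ℝ := fun t => r0 - ∫ s in (0:ℝ)..t, A s with hr'
  set m' : Fin d → ℝ → ℝ := fun j t => m0 j - ∫ s in (0:ℝ)..t, B j s with hm'
  have const_ac : ∀ z : ℝ, AbsolutelyContinuousOnInterval (fun _ => z) 0 T := fun z =>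
    smooth_ac _ contDiff_const 0 T
  have rac : AbsolutelyContinuousOnInterval r' 0 T :=
    (const_ac r0).sub (hAi.absolutelyContinuousOnInterval_intervalIntegral Set.left_mem_uIcc)
  have mac : ∀ j, AbsolutelyContinuousOnInterval (m' j) 0 T := fun j =>
    (const_ac (m0 j)).sub ((hBi j).absolutelyContinuousOnInterval_intervalIntegral Set.left_mem_uIcc)
  have rcont : ContinuousOn r' (Set.Icc 0 T) := by
    have := rac.continuousOn; rwa [Set.uIcc_of_le hT.le] at this
  have hrc' : ∀ t ∈ Set.Icc 0 T, c ≤ r' t := by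
    have h1 : ∀ᵐ t ∂(volume.restrict (Set.Ioo 0 T)), max c (r' t) = r' t := by
      filter_upwards [hr, hrc] with t h1 h2
      rw [max_eq_right]; rw [hr']; simp only; rw [← h1]; exact h2
    have h2 : Set.EqOn (fun t => max c (r' t)) r' (Set.Icc 0 T) := by
      have h3 : (fun t => max c (r' t)) =ᵐ[volume.restrict (Set.Icc 0 T)] r' := by
        rw [← restrict_Ioo_eq_restrict_Icc]; exact h1
      exact Measure.eqOn_Icc_of_ae_eq volume hT.ne h3 (continuousOn_const.sup rcont) rcont
    intro t ht
    rw [← h2 ht]; exact le_max_left _ _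
  obtain ⟨b, hb⟩ := (isCompact_Icc (a := (0:ℝ)) (b := T)).exists_bound_of_continuousOn rcont
  have hmem : ∀ t ∈ Set.uIcc 0 T, r' t ∈ Set.Icc c b := by
    intro t ht
    rw [Set.uIcc_of_le hT.le] at ht
    exact ⟨hrc' t ht, (le_abs_self _).trans (hb t ht)⟩
  have hinv : AbsolutelyContinuousOnInterval (fun t => (r' t)⁻¹) 0 T := by
    obtain ⟨K, hK⟩ := lip_of_deriv (fun x => x⁻¹) (fun x => -(x^2)⁻¹) c b
      (fun x hx => hasDerivAt_inv (lt_of_lt_of_le hc hx.1).ne')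
      (ContinuousOn.neg (ContinuousOn.inv₀ (by fun_prop) fun x hx =>
        pow_ne_zero 2 (lt_of_lt_of_le hc hx.1).ne'))
    exact ac_comp r' 0 T rac (fun x => x⁻¹) _ K hK hmem
  have hpow : AbsolutelyContinuousOnInterval (fun t => (r' t) ^ γ) 0 T := by
    obtain ⟨K, hK⟩ := lip_of_deriv (fun x => x ^ γ) (fun x => γ * x ^ (γ - 1)) c b
      (fun x hx => Real.hasDerivAt_rpow_const (Or.inl (lt_of_lt_of_le hc hx.1).ne'))
      (ContinuousOn.mul continuousOn_const (ContinuousOn.rpow_const continuousOn_id fun x hx =>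
        Or.inl (lt_of_lt_of_le hc hx.1).ne'))
    exact ac_comp r' 0 T rac (fun x => x ^ γ) _ K hK hmem
  have hsum : AbsolutelyContinuousOnInterval (fun t => ∑ j, m' j t ^ 2) 0 T := by
    have : ∀ s : Finset (Fin d), AbsolutelyContinuousOnInterval (fun t => ∑ j ∈ s, m' j t ^ 2) 0 T := by
      intro s
      classical
      induction s using Finset.induction_on with
      | empty => simpa using const_ac 0
      | insert a s ha ih =>
        simp only [Finset.sum_insert ha, sq]
        simp only [sq] at ih
        exact AbsolutelyContinuousOnInterval.add (f := fun t => m' a t * m' a t) (g := fun t => ∑ j ∈ s, m' j t * m' j t) ((mac a).mul (mac a)) ih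
    exact this _
  have heta : AbsolutelyContinuousOnInterval
      (fun t => 1 / 2 * ((∑ j, m' j t ^ 2) * (r' t)⁻¹) + k * r' t ^ γ) 0 T :=
    ((hsum.mul hinv).const_mul (1/2)).add (hpow.const_mul k)
  have hχac := smooth_ac χ hχ 0 T
  obtain ⟨a1, b1, ha1, hb1, hab⟩ := hχs
  have hI := hχac.integral_mul_deriv_eq_deriv_mul heta
  rw [hab 0 (fun h => by linarith [h.1]), hab T (fun h => by linarith [h.2])] at hI
  simp only [zero_mul, sub_zero, zero_sub] at hI
  have e1 : ∫ t in Set.Ioo 0 T, deriv χ t * (1 / 2 * ((∑ j, m j t ^ 2) * (r t)⁻¹) + k * r t ^ γ)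
      = ∫ t in (0:ℝ)..T, deriv χ t * (1 / 2 * ((∑ j, m' j t ^ 2) * (r' t)⁻¹) + k * r' t ^ γ) := by
    rw [← ioo_interval T hT]
    refine integral_congr_ae ?_
    have hm2 := ae_all_iff.2 hm
    filter_upwards [hr, hm2] with t h1 h2
    rw [h1]
    simp only [h2]
    rfl
  rw [e1]
  have e2 : ∀ z w : ℝ, z = -w → w = -z := fun z w h => by linarith
  rw [e2 _ _ hI, ← intervalIntegral.integral_neg, ← ioo_interval T hT]
  refine integral_congr_ae ?_
  have hm2 := ae_all_iff.2 hm
  have hd1 := ae_restrict_of_ae (s := Set.Ioo 0 T) hAi.ae_hasDerivAt_integral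
  have hd2 := ae_restrict_of_ae (s := Set.Ioo 0 T) (ae_all_iff.2 fun j => (hBi j).ae_hasDerivAt_integral)
  filter_upwards [hr, hm2, hd1, hd2, ae_restrict_mem measurableSet_Ioo] with t h1 h2 h3 h4 ht
  have ht' : t ∈ Set.uIcc 0 T := by rw [Set.uIcc_of_le hT.le]; exact Set.Ioo_subset_Icc_self ht
  have dr : HasDerivAt r' (-A t) t := by
    have := (h3 ht' 0 Set.left_mem_uIcc).const_sub r0
    exact this
  have dm : ∀ j, HasDerivAt (m' j) (-B j t) t := fun j => by
    have := (h4 j ht' 0 Set.left_mem_uIcc).const_sub (m0 j)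
    exact this
  have hrt : r t = r' t := h1
  have hmt : ∀ j, m j t = m' j t := h2
  have hpos : 0 < r' t := lt_of_lt_of_le hc (hmem t ht').1
  have dsum : HasDerivAt (fun t => ∑ j, m' j t ^ 2) (∑ j, 2 * m' j t * (-B j t)) t := by
    refine HasDerivAt.fun_sum fun j _ => ?_
    simpa using (dm j).fun_pow 2
  have deta := ((dsum.mul (dr.fun_inv hpos.ne')).const_mul (1/2)).add
    ((dr.rpow_const (p := γ) (Or.inl hpos.ne')).const_mul k)
  simp only [hrt, hmt]
  have hde : deriv (fun t => 1 / 2 * ((∑ j, m' j t ^ 2) * (r' t)⁻¹) + k * r' t ^ γ) t = _ := deta.deriv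
  rw [hde]
  have e3 : ∑ j, 2 * m' j t * (-B j t) = -2 * ∑ j, m' j t * B j t := by
    rw [Finset.mul_sum]; exact Finset.sum_congr rfl fun j _ => by ring
  have e4 : ∑ j, m' j t * (r' t)⁻¹ * B j t = (r' t)⁻¹ * ∑ j, m' j t * B j t := by
    rw [Finset.mul_sum]; exact Finset.sum_congr rfl fun j _ => by ring
  rw [e3, e4]
  ring

lemma theta_deriv (k γ r' : ℝ) (i : Fin d) (r : ℝ → ℝ) (m q : Fin d → ℝ → ℝ) (m' q' : Fin d → ℝ) (s : ℝ)
    (hr0 : 0 < r s) (hr : HasDerivAt r r' s) (hm : ∀ j, HasDerivAt (m j) (m' j) s)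
    (hq : ∀ j, HasDerivAt (q j) (q' j) s) :
    HasDerivAt (fun s => (k * γ * r s ^ (γ - 1) - 1 / 2 * ((∑ j, m j s ^ 2) * (r s ^ 2)⁻¹)) * m i s
        + (∑ j, m j s * (r s)⁻¹ * q j s) - (k * (γ - 1)) * r s ^ γ * (m i s * (r s)⁻¹))
      ((k * γ * r s ^ (γ - 1) - 1 / 2 * ((∑ j, m j s ^ 2) * (r s ^ 2)⁻¹)) * m' i
        + (∑ j, m j s * (r s)⁻¹ * q' j)
        + ∑ j, ((m' j * r s - m j s * r') * (r s ^ 2)⁻¹)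
            * (q j s - m i s * m j s * (r s)⁻¹ - if i = j then (k * (γ - 1)) * r s ^ γ else 0)) s := by
  have dsum : HasDerivAt (fun t => ∑ j, m j t ^ 2) (∑ j, 2 * m j s * m' j) s := by
    refine HasDerivAt.fun_sum fun j _ => ?_
    simpa using (hm j).fun_pow 2
  have dinv := hr.fun_inv hr0.ne'
  have dinv2 : HasDerivAt (fun t => (r t ^ 2)⁻¹) (-(2 * r s * r') / (r s ^ 2) ^ 2) s := by
    have h := hr.fun_pow 2
    simp only [Nat.cast_ofNat, Nat.add_one_sub_one, pow_one] at h
    exact h.fun_inv (pow_ne_zero 2 hr0.ne')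
  have dp1 := hr.rpow_const (p := γ - 1) (Or.inl hr0.ne')
  have dp := hr.rpow_const (p := γ) (Or.inl hr0.ne')
  have d2 : HasDerivAt (fun s => ∑ j, m j s * (r s)⁻¹ * q j s)
      (∑ j, ((m' j * (r s)⁻¹ + m j s * (-r' / r s ^ 2)) * q j s + m j s * (r s)⁻¹ * q' j)) s :=
    HasDerivAt.fun_sum fun j _ => ((hm j).fun_mul dinv).fun_mul (hq j)
  have key := ((((dp1.const_mul (k * γ)).fun_sub ((dsum.fun_mul dinv2).const_mul (1/2))).fun_mul (hm i)).fun_add d2).fun_sub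
    ((dp.const_mul (k * (γ - 1))).fun_mul ((hm i).fun_mul dinv))
  convert! key using 1
  have e1 : r s ^ γ = r s ^ (γ - 1 - 1) * r s ^ 2 := by
    rw [← Real.rpow_natCast, ← Real.rpow_add hr0]; congr 1; push_cast; ring
  have e2 : r s ^ (γ - 1) = r s ^ (γ - 1 - 1) * r s := by
    rw [← Real.rpow_add_one hr0.ne']; congr 1; ring
  have hne := hr0.ne'
  have s1 : ∑ j, ((m' j * r s - m j s * r') * (r s ^ 2)⁻¹)
            * (q j s - m i s * m j s * (r s)⁻¹ - if i = j then (k * (γ - 1)) * r s ^ γ else 0)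
      = ∑ j, ((m' j * (r s)⁻¹ + m j s * (-r' / r s ^ 2)) * q j s)
        - m i s * ((r s)⁻¹ * (r s)⁻¹ * ∑ j, m j s * m' j - r' * (r s ^ 2)⁻¹ * (r s)⁻¹ * ∑ j, m j s ^ 2)
        - ((m' i * r s - m i s * r') * (r s ^ 2)⁻¹) * ((k * (γ - 1)) * r s ^ γ) := by
    simp only [mul_sub, Finset.sum_sub_distrib, mul_ite, mul_zero, Finset.sum_ite_eq, Finset.mem_univ,
      if_true]
    congr 1
    rw [Finset.mul_sum, Finset.mul_sum, Finset.mul_sum, Finset.mul_sum, ← Finset.sum_sub_distrib,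
      ← Finset.sum_sub_distrib, ← Finset.sum_sub_distrib]
    refine Finset.sum_congr rfl fun j _ => ?_
    field_simp
    ring
  have s2 : ∑ j, 2 * m j s * m' j = 2 * ∑ j, m j s * m' j := by
    rw [Finset.mul_sum]; exact Finset.sum_congr rfl fun j _ => by ring
  rw [s1, s2, Finset.sum_add_distrib]
  rw [e1, e2]
  generalize ∑ j, m j s * m' j = X1
  generalize ∑ j, m j s ^ 2 = X2
  generalize ∑ j, m j s * (r s)⁻¹ * q' j = X3
  generalize (∑ j, (m' j * (r s)⁻¹ + m j s * (-r' / r s ^ 2)) * q j s) = X4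
  generalize r s ^ (γ - 1 - 1) = X5
  field_simp
  ring

lemma per_cont_bdd (f : (Fin d → ℝ) → ℝ) (hf : Continuous f) (hp : SpacePeriodic f) :
    ∃ B, ∀ x, |f x| ≤ B := by
  obtain ⟨B, hB⟩ := (isCompact_Icc (a := (0 : Fin d → ℝ)) (b := 1)).exists_bound_of_continuousOn
    hf.continuousOn
  refine ⟨B, fun x => ?_⟩
  have h1 : f x = f (fun i => Int.fract (x i)) := by
    rw [← hp (fun i => Int.fract (x i)) (fun i => ⌊x i⌋)]
    congr 1; funext i; simp [Int.fract_add_floor]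
  rw [h1]
  exact hB _ ⟨fun i => Int.fract_nonneg _, fun i => (Int.fract_lt_one _).le⟩

/-- periodic continuous function with continuous partials along coordinate lines -/
structure PC1 (f : (Fin d → ℝ) → ℝ) (f' : Fin d → (Fin d → ℝ) → ℝ) : Prop where
  cont : Continuous f
  cont' : ∀ i, Continuous (f' i)
  per : SpacePeriodic f
  per' : ∀ i, SpacePeriodic (f' i)
  deriv : ∀ i x, HasDerivAt (fun s : ℝ => f (x + s • (Pi.single i 1 : Fin d → ℝ))) (f' i x) 0

lemma pci (f : (Fin d → ℝ) → ℝ) (hf : Continuous f) (hp : SpacePeriodic f) :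
    Integrable f (cubeVol d) := by
  obtain ⟨B, hB⟩ := per_cont_bdd f hf hp
  exact Integrable.of_bound hf.aestronglyMeasurable B (Filter.Eventually.of_forall hB)

lemma slice_ibp_abs (k γ : ℝ) (R : (Fin d → ℝ) → ℝ) (R' : Fin d → (Fin d → ℝ) → ℝ)
    (M : Fin d → (Fin d → ℝ) → ℝ) (M' : Fin d → Fin d → (Fin d → ℝ) → ℝ)
    (Q : Fin d → Fin d → (Fin d → ℝ) → ℝ) (Q' : Fin d → Fin d → Fin d → (Fin d → ℝ) → ℝ)
    (hR0 : ∀ x, 0 < R x)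
    (hR : PC1 R R') (hM : ∀ j, PC1 (M j) (M' j)) (hQ : ∀ i j, PC1 (Q i j) (Q' i j)) :
    ∫ x, ((k * γ * R x ^ (γ - 1) - 1 / 2 * ((∑ j, M j x ^ 2) * (R x ^ 2)⁻¹)) * (∑ i, M' i i x)
        + ∑ j, M j x * (R x)⁻¹ * ∑ i, Q' i j i x) ∂(cubeVol d)
      = - ∫ x, (∑ i, ∑ j, ((M' j i x * R x - M j x * R' i x) * (R x ^ 2)⁻¹)
            * (Q i j x - M i x * M j x * (R x)⁻¹ - if i = j then (k * (γ - 1)) * R x ^ γ else 0))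
          ∂(cubeVol d) := by
  have cR := hR.cont
  have cM := fun j => (hM j).cont
  have cQ := fun i j => (hQ i j).cont
  have cR' := hR.cont'
  have cM' := fun j => (hM j).cont'
  have cQ' := fun i j => (hQ i j).cont'
  have cinv : Continuous fun x => (R x)⁻¹ := cR.inv₀ fun x => (hR0 x).ne'
  have cinv2 : Continuous fun x => (R x ^ 2)⁻¹ := (cR.pow 2).inv₀ fun x => pow_ne_zero 2 (hR0 x).ne'
  have cpow : ∀ e : ℝ, Continuous fun x => R x ^ e := fun e =>
    cR.rpow_const fun x => Or.inl (hR0 x).ne'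
  have cite : ∀ i j : Fin d, Continuous fun x => if i = j then (k * (γ - 1)) * R x ^ γ else 0 := by
    intro i j
    split_ifs
    · exact continuous_const.mul (cpow γ)
    · exact continuous_const
  set Θ : Fin d → (Fin d → ℝ) → ℝ := fun i x =>
    (k * γ * R x ^ (γ - 1) - 1 / 2 * ((∑ j, M j x ^ 2) * (R x ^ 2)⁻¹)) * M i x
        + (∑ j, M j x * (R x)⁻¹ * Q i j x) - (k * (γ - 1)) * R x ^ γ * (M i x * (R x)⁻¹) with hΘ
  set Sg : Fin d → (Fin d → ℝ) → ℝ := fun i x =>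
    ∑ j, ((M' j i x * R x - M j x * R' i x) * (R x ^ 2)⁻¹)
            * (Q i j x - M i x * M j x * (R x)⁻¹ - if i = j then (k * (γ - 1)) * R x ^ γ else 0) with hSg
  set Θ' : Fin d → (Fin d → ℝ) → ℝ := fun i x =>
    (k * γ * R x ^ (γ - 1) - 1 / 2 * ((∑ j, M j x ^ 2) * (R x ^ 2)⁻¹)) * M' i i x
        + (∑ j, M j x * (R x)⁻¹ * Q' i j i x) + Sg i x with hΘ'
  have cSg : ∀ i, Continuous (Sg i) := by
    intro i
    refine continuous_finsetSum _ fun j _ => ?_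
    have := cite i j
    fun_prop
  have cΘ : ∀ i, Continuous (Θ i) := by
    intro i
    have := cpow (γ - 1)
    have := cpow γ
    fun_prop
  have cΘ' : ∀ i, Continuous (Θ' i) := by
    intro i
    have := cpow (γ - 1)
    have := cSg i
    fun_prop
  have pR := hR.per
  have pM := fun j => (hM j).per
  have pQ := fun i j => (hQ i j).per
  have pR' := hR.per'
  have pM' := fun j => (hM j).per'
  have pQ' := fun i j => (hQ i j).per'
  unfold SpacePeriodic at pR pM pQ pR' pM' pQ'
  have pSg : ∀ i, SpacePeriodic (Sg i) := by
    intro i x n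
    simp only [hSg, pR, pM, pQ, pR', pM']
  have pΘ : ∀ i, SpacePeriodic (Θ i) := by
    intro i x n
    simp only [hΘ, pR, pM, pQ]
  have pΘ' : ∀ i, SpacePeriodic (Θ' i) := by
    intro i x n
    have h := pSg i x n
    simp only [hΘ', pR, pM, pM', pQ', h]
  have hz : ∀ i, ∫ x, Θ' i x ∂(cubeVol d) = 0 := by
    intro i
    refine integral_dir_deriv_zero (Θ i) (Θ' i) (Pi.single i 1) (pΘ i) (cΘ i).measurable
      (per_cont_bdd _ (cΘ i) (pΘ i)) ?_ (cΘ' i).measurable (per_cont_bdd _ (cΘ' i) (pΘ' i))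
    intro x
    have h := theta_deriv k γ (R' i x) i (fun s => R (x + s • (Pi.single i 1 : Fin d → ℝ)))
      (fun j s => M j (x + s • (Pi.single i 1 : Fin d → ℝ)))
      (fun j s => Q i j (x + s • (Pi.single i 1 : Fin d → ℝ))) (fun j => M' j i x)
      (fun j => Q' i j i x) 0 (hR0 _) (hR.deriv i x) (fun j => (hM j).deriv i x)
      (fun j => (hQ i j).deriv i x)
    simp only [zero_smul, add_zero] at h
    exact h
  have hsum : ∫ x, ∑ i, Θ' i x ∂(cubeVol d) = 0 := by
    rw [integral_finsetSum _ fun i _ => pci _ (cΘ' i) (pΘ' i)]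
    simp [hz]
  have hpt : ∀ x, (k * γ * R x ^ (γ - 1) - 1 / 2 * ((∑ j, M j x ^ 2) * (R x ^ 2)⁻¹)) * (∑ i, M' i i x)
        + ∑ j, M j x * (R x)⁻¹ * ∑ i, Q' i j i x = (∑ i, Θ' i x) - ∑ i, Sg i x := by
    intro x
    simp only [hΘ', Finset.sum_add_distrib]
    rw [Finset.mul_sum, add_sub_cancel_right]
    congr 1
    rw [Finset.sum_comm]
    exact Finset.sum_congr rfl fun j _ => by rw [Finset.mul_sum]
  simp_rw [hpt]
  rw [integral_sub (integrable_finsetSum _ fun i _ => pci _ (cΘ' i) (pΘ' i))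
    (integrable_finsetSum _ fun i _ => pci _ (cSg i) (pSg i)), hsum, zero_sub]

/-- Convolution on the torus. -/
def mol (k : (Fin d → ℝ) → ℝ) (f : (Fin d → ℝ) → ℝ) (x : Fin d → ℝ) : ℝ :=
  ∫ y, k (x - y) * f y ∂cubeVol d

/-- Partial derivative of the kernel. -/
def dK (i : Fin d) (K : (Fin d → ℝ) → ℝ) (z : Fin d → ℝ) : ℝ := fderiv ℝ K z (Pi.single i 1)

lemma dK_cont (K : (Fin d → ℝ) → ℝ) (hK : ContDiff ℝ (⊤ : ℕ∞) K) (i : Fin d) :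
    Continuous (dK i K) := by
  have := hK.continuous_fderiv (by simp)
  unfold dK
  fun_prop

lemma dK_per (K : (Fin d → ℝ) → ℝ) (hK : SpacePeriodic K) (i : Fin d) :
    SpacePeriodic (dK i K) := by
  intro x n
  unfold dK
  have : (fun z => K (z + fun i => (n i : ℝ))) = K := by
    funext z; exact hK z n
  have h2 := fderiv_comp_add_right (𝕜 := ℝ) (f := K) (x := x) (fun i => (n i : ℝ))
  rw [this] at h2
  rw [h2]

lemma mol_integrable (k f : (Fin d → ℝ) → ℝ) (hk : Continuous k) (hp : SpacePeriodic k)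
    (hf : Integrable f (cubeVol d)) (x : Fin d → ℝ) :
    Integrable (fun y => k (x - y) * f y) (cubeVol d) := by
  obtain ⟨B, hB⟩ := per_cont_bdd k hk hp
  refine hf.bdd_mul (c := B) (by fun_prop) (Filter.Eventually.of_forall fun y => ?_)
  exact hB _

lemma mol_bound (k f : (Fin d → ℝ) → ℝ) (B : ℝ) (hB : ∀ x, |k x| ≤ B)
    (hf : Integrable f (cubeVol d)) (x : Fin d → ℝ) :
    |mol k f x| ≤ B * ∫ y, |f y| ∂cubeVol d := by
  unfold mol
  rw [← integral_const_mul, ← Real.norm_eq_abs]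
  refine norm_integral_le_of_norm_le (hf.abs.const_mul B) (Filter.Eventually.of_forall fun y => ?_)
  rw [Real.norm_eq_abs, abs_mul]
  exact mul_le_mul_of_nonneg_right (hB _) (abs_nonneg _)

lemma mol_cont (k f : (Fin d → ℝ) → ℝ) (hk : Continuous k) (hp : SpacePeriodic k)
    (hf : Integrable f (cubeVol d)) : Continuous (mol k f) := by
  obtain ⟨B, hB⟩ := per_cont_bdd k hk hp
  unfold mol
  refine continuous_of_dominated (bound := fun y => B * |f y|) (fun x => ?_) (fun x => ?_)
    (hf.abs.const_mul B) (Filter.Eventually.of_forall fun y => by fun_prop)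
  · exact (mol_integrable k f hk hp hf x).aestronglyMeasurable
  · refine Filter.Eventually.of_forall fun y => ?_
    rw [Real.norm_eq_abs, abs_mul]
    exact mul_le_mul_of_nonneg_right (hB _) (abs_nonneg _)

lemma mol_per (k f : (Fin d → ℝ) → ℝ) (hp : SpacePeriodic k) : SpacePeriodic (mol k f) := by
  intro x n
  unfold mol
  congr 1
  funext y
  rw [show x + (fun i => (n i : ℝ)) - y = (x - y) + fun i => (n i : ℝ) by abel, hp]

lemma dK_sum (K : (Fin d → ℝ) → ℝ) (z w : Fin d → ℝ) :
    fderiv ℝ K z w = ∑ i, w i * dK i K z := by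
  unfold dK
  conv_lhs => rw [show w = ∑ i, w i • (Pi.single i (1 : ℝ) : Fin d → ℝ) by
    funext j; simp [Finset.sum_apply, Pi.single_apply]]
  rw [map_sum]
  simp

lemma mol_deriv (K f : (Fin d → ℝ) → ℝ) (hK : ContDiff ℝ (⊤ : ℕ∞) K) (hp : SpacePeriodic K)
    (hf : Integrable f (cubeVol d)) (x w : Fin d → ℝ) (s₀ : ℝ) :
    HasDerivAt (fun s : ℝ => mol K f (x + s • w)) (∑ i, w i * mol (dK i K) f (x + s₀ • w)) s₀ := by
  have hc := hK.continuous
  choose B hB using fun i => per_cont_bdd (dK i K) (dK_cont K hK i) (dK_per K hp i)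
  have hIntz : ∀ z, Integrable (fun y => ∑ i, w i * (dK i K (z - y) * f y)) (cubeVol d) := fun z =>
    integrable_finsetSum _ fun i _ =>
      (mol_integrable _ f (dK_cont K hK i) (dK_per K hp i) hf z).const_mul _
  have key := hasDerivAt_integral_of_dominated_loc_of_deriv_le (μ := cubeVol d)
    (F := fun s y => K (x + s • w - y) * f y)
    (F' := fun s y => ∑ i, w i * (dK i K (x + s • w - y) * f y)) (x₀ := s₀)
    (s := Set.univ) (bound := fun y => (∑ i, |w i| * B i) * |f y|) Filter.univ_mem
    (Filter.Eventually.of_forall fun s => (mol_integrable K f hc hp hf _).aestronglyMeasurable)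
    (mol_integrable K f hc hp hf _)
    (hIntz _).aestronglyMeasurable
    (Filter.Eventually.of_forall fun y s _ => ?_) (hf.abs.const_mul _)
    (Filter.Eventually.of_forall fun y s _ => ?_)
  · refine key.2.congr_deriv ?_
    rw [integral_finsetSum _ fun i _ =>
      (mol_integrable _ f (dK_cont K hK i) (dK_per K hp i) hf _).const_mul _]
    refine Finset.sum_congr rfl fun i _ => ?_
    rw [integral_const_mul]; rfl
  · rw [Finset.sum_mul, Real.norm_eq_abs]
    refine (Finset.abs_sum_le_sum_abs _ _).trans (Finset.sum_le_sum fun i _ => ?_)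
    rw [abs_mul, abs_mul, mul_assoc]
    gcongr
    exact hB _ _
  · have h1 : HasDerivAt (fun s : ℝ => x + s • w - y) w s := by
      have := ((hasDerivAt_id s).smul_const w).const_add x |>.sub_const y
      simpa using this
    have h2 : HasFDerivAt K (fderiv ℝ K (x + s • w - y)) (x + s • w - y) :=
      (hK.differentiable (by simp) _).hasFDerivAt
    have h3 := (h2.comp_hasDerivAt s h1).mul_const (f y)
    refine h3.congr_deriv ?_
    rw [dK_sum, Finset.sum_mul]
    exact Finset.sum_congr rfl fun i _ => by ring

lemma mol_PC1 (K f : (Fin d → ℝ) → ℝ) (hK : ContDiff ℝ (⊤ : ℕ∞) K) (hp : SpacePeriodic K)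
    (hf : Integrable f (cubeVol d)) : PC1 (mol K f) (fun i => mol (dK i K) f) where
  cont := mol_cont K f hK.continuous hp hf
  cont' := fun i => mol_cont _ f (dK_cont K hK i) (dK_per K hp i) hf
  per := mol_per K f hp
  per' := fun i => mol_per _ f (dK_per K hp i)
  deriv := by
    intro i x
    refine (mol_deriv K f hK hp hf x (Pi.single i 1) 0).congr_deriv ?_
    simp [Pi.single_apply]

lemma mol_meas (k : (Fin d → ℝ) → ℝ) (hk : Continuous k) (f : ℝ → (Fin d → ℝ) → ℝ)
    (hf : Measurable (Function.uncurry f)) :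
    Measurable (fun z : ℝ × (Fin d → ℝ) => mol k (f z.1) z.2) := by
  unfold mol
  have : Measurable (fun z : (ℝ × (Fin d → ℝ)) × (Fin d → ℝ) => k (z.1.2 - z.2) * f z.1.1 z.2) := by
    have h1 : Measurable fun z : (ℝ × (Fin d → ℝ)) × (Fin d → ℝ) => f z.1.1 z.2 :=
      hf.comp (by fun_prop : Measurable fun z : (ℝ × (Fin d → ℝ)) × (Fin d → ℝ) => (z.1.1, z.2))
    exact ((hk.measurable).comp (by fun_prop)).mul h1
  exact (this.stronglyMeasurable.integral_prod_right' (ν := cubeVol d)).measurable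

lemma mol_congr (k f g : (Fin d → ℝ) → ℝ) (h : f =ᵐ[cubeVol d] g) : mol k f = mol k g := by
  funext x
  unfold mol
  exact integral_congr_ae (h.mono fun y hy => by simp only [hy])

lemma mol_add (k f g : (Fin d → ℝ) → ℝ) (hk : Continuous k) (hp : SpacePeriodic k)
    (hf : Integrable f (cubeVol d)) (hg : Integrable g (cubeVol d)) (x : Fin d → ℝ) :
    mol k (fun y => f y + g y) x = mol k f x + mol k g x := by
  unfold mol
  rw [← integral_add (mol_integrable k f hk hp hf x) (mol_integrable k g hk hp hg x)]
  exact integral_congr_ae (Filter.Eventually.of_forall fun y => by simp only [mul_add])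

lemma euNorm_sq (x : Fin d → ℝ) : euNorm x ^ 2 = ∑ i, x i ^ 2 := by
  unfold euNorm
  exact Real.sq_sqrt (Finset.sum_nonneg fun i _ => sq_nonneg _)

lemma abs_le_euNorm (x : Fin d → ℝ) (i : Fin d) : |x i| ≤ euNorm x := by
  refine abs_le_of_sq_le_sq ?_ (euNorm_nonneg x)
  rw [euNorm_sq]
  exact Finset.single_le_sum (f := fun i => x i ^ 2) (fun i _ => sq_nonneg _) (Finset.mem_univ i)

lemma euNorm_meas : Measurable (euNorm : (Fin d → ℝ) → ℝ) := by
  unfold euNorm; fun_prop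

lemma kappa_pos (γ : ℝ) (hγ : 1 < γ) : 0 < kappa γ := by
  unfold kappa
  have : 0 < γ - 1 := by linarith
  positivity

/-- A regular time slice. -/
structure Slice (γ c : ℝ) (r : (Fin d → ℝ) → ℝ) (u : (Fin d → ℝ) → Fin d → ℝ) : Prop where
  rm : Measurable r
  um : Measurable u
  rp : SpacePeriodic r
  up : SpacePeriodic u
  r0 : ∀ x, 0 ≤ r x
  rc : ∀ᵐ x ∂(cubeVol d), c ≤ r x
  ipi : Integrable (fun x => r x ^ γ) (cubeVol d)
  iki : Integrable (fun x => r x * euNorm (u x) ^ 2) (cubeVol d)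

/-- The momentum flux. -/
def FF (γ : ℝ) (r : (Fin d → ℝ) → ℝ) (u : (Fin d → ℝ) → Fin d → ℝ) (i j : Fin d)
    (y : Fin d → ℝ) : ℝ :=
  r y * u y i * u y j + if i = j then kappa γ * r y ^ γ else 0

section
variable {γ c : ℝ} {r : (Fin d → ℝ) → ℝ} {u : (Fin d → ℝ) → Fin d → ℝ}

lemma le_one_add_rpow (γ : ℝ) (hγ : 1 < γ) (s : ℝ) (hs : 0 ≤ s) : s ≤ 1 + s ^ γ := by
  rcases le_total s 1 with h | h
  · have : 0 ≤ s ^ γ := by positivity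
    linarith
  · have := Real.rpow_le_rpow_of_exponent_le h hγ.le
    rw [Real.rpow_one] at this
    linarith

lemma ruj_le (s : ℝ) (hs : 0 ≤ s) (w : Fin d → ℝ) (j : Fin d) :
    |s * w j| ≤ s + s * euNorm w ^ 2 := by
  rw [abs_mul, abs_of_nonneg hs, ← mul_one_add]
  refine mul_le_mul_of_nonneg_left ?_ hs
  have := abs_le_euNorm w j
  nlinarith [sq_nonneg (euNorm w - 1), euNorm_nonneg w]

lemma ruu_le (s : ℝ) (hs : 0 ≤ s) (w : Fin d → ℝ) (i j : Fin d) :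
    |s * w i * w j| ≤ s * euNorm w ^ 2 := by
  rw [abs_mul, abs_mul, abs_of_nonneg hs, mul_assoc]
  refine mul_le_mul_of_nonneg_left ?_ hs
  rw [sq]
  exact mul_le_mul (abs_le_euNorm w i) (abs_le_euNorm w j) (abs_nonneg _) (euNorm_nonneg w)

lemma Slice.ir (h : Slice γ c r u) (hγ : 1 < γ) : Integrable r (cubeVol d) := by
  refine ((integrable_const (1:ℝ)).add h.ipi).mono' h.rm.aestronglyMeasurable
    (Filter.Eventually.of_forall fun x => ?_)
  rw [Real.norm_eq_abs, abs_of_nonneg (h.r0 x)]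
  exact le_one_add_rpow γ hγ _ (h.r0 x)

lemma Slice.iru (h : Slice γ c r u) (hγ : 1 < γ) (j : Fin d) :
    Integrable (fun x => r x * u x j) (cubeVol d) := by
  refine ((h.ir hγ).add h.iki).mono' ?_ (Filter.Eventually.of_forall fun x => ?_)
  · have := h.rm; have := h.um
    exact Measurable.aestronglyMeasurable (by fun_prop)
  · exact ruj_le _ (h.r0 x) _ _

lemma Slice.iruu (h : Slice γ c r u) (i j : Fin d) :
    Integrable (fun x => r x * u x i * u x j) (cubeVol d) := by
  refine h.iki.mono' ?_ (Filter.Eventually.of_forall fun x => ?_)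
  · have := h.rm; have := h.um
    exact Measurable.aestronglyMeasurable (by fun_prop)
  · exact ruu_le _ (h.r0 x) _ _ _

lemma Slice.iF (h : Slice γ c r u) (i j : Fin d) :
    Integrable (FF γ r u i j) (cubeVol d) := by
  unfold FF
  refine (h.iruu i j).add ?_
  split_ifs
  · exact h.ipi.const_mul _
  · exact integrable_zero _ _ _

lemma Slice.bounds (h : Slice γ c r u) (hγ : 1 < γ) (C : ℝ) (h1 : ∫ x, r x ^ γ ∂cubeVol d ≤ C)
    (h2 : ∫ x, r x * euNorm (u x) ^ 2 ∂cubeVol d ≤ C) :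
    (∫ x, |r x| ∂cubeVol d ≤ 1 + C) ∧ (∀ j, ∫ x, |r x * u x j| ∂cubeVol d ≤ 1 + 2 * C) ∧
    (∀ i j, ∫ x, |FF γ r u i j x| ∂cubeVol d ≤ C + kappa γ * C) := by
  have hk := kappa_pos γ hγ
  have e1 : ∫ x, |r x| ∂cubeVol d ≤ 1 + C := by
    calc ∫ x, |r x| ∂cubeVol d ≤ ∫ x, (1 + r x ^ γ) ∂cubeVol d := by
          refine integral_mono (h.ir hγ).abs ((integrable_const (1:ℝ)).add h.ipi) fun x => ?_
          show |r x| ≤ 1 + r x ^ γ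
          rw [abs_of_nonneg (h.r0 x)]
          exact le_one_add_rpow γ hγ _ (h.r0 x)
      _ = 1 + ∫ x, r x ^ γ ∂cubeVol d := by
          rw [integral_add (integrable_const (1:ℝ)) h.ipi]; simp
      _ ≤ 1 + C := by linarith
  refine ⟨e1, fun j => ?_, fun i j => ?_⟩
  · calc ∫ x, |r x * u x j| ∂cubeVol d
        ≤ ∫ x, (|r x| + r x * euNorm (u x) ^ 2) ∂cubeVol d := by
          refine integral_mono (h.iru hγ j).abs ((h.ir hγ).abs.add h.iki) fun x => ?_
          show |r x * u x j| ≤ |r x| + r x * euNorm (u x) ^ 2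
          rw [abs_of_nonneg (h.r0 x)]
          exact ruj_le _ (h.r0 x) _ _
      _ = (∫ x, |r x| ∂cubeVol d) + ∫ x, r x * euNorm (u x) ^ 2 ∂cubeVol d :=
          integral_add (h.ir hγ).abs h.iki
      _ ≤ _ := by linarith
  · calc ∫ x, |FF γ r u i j x| ∂cubeVol d
        ≤ ∫ x, (r x * euNorm (u x) ^ 2 + kappa γ * r x ^ γ) ∂cubeVol d := by
          refine integral_mono (h.iF i j).abs (h.iki.add (h.ipi.const_mul _)) fun x => ?_
          show |FF γ r u i j x| ≤ r x * euNorm (u x) ^ 2 + kappa γ * r x ^ γ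
          unfold FF
          have h0 : 0 ≤ kappa γ * r x ^ γ := mul_nonneg hk.le (Real.rpow_nonneg (h.r0 x) _)
          refine (abs_add_le _ _).trans (add_le_add (ruu_le _ (h.r0 x) _ _ _) ?_)
          split_ifs
          · exact (abs_of_nonneg h0).le
          · simpa using h0
      _ = (∫ x, r x * euNorm (u x) ^ 2 ∂cubeVol d) + kappa γ * ∫ x, r x ^ γ ∂cubeVol d := by
          rw [integral_add h.iki (h.ipi.const_mul _), integral_const_mul]
      _ ≤ _ := by gcongr

lemma ker_int_one (K : (Fin d → ℝ) → ℝ) (L : ℝ) (hK : IsKer K L) (x : Fin d → ℝ) :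
    ∫ y, K (x - y) ∂cubeVol d = 1 := by
  rw [integral_eq_lintegral_of_nonneg_ae (Filter.Eventually.of_forall fun y => (hK.pos _).le)]
  · rw [ker_mass K L hK x]; simp
  · exact Continuous.aestronglyMeasurable (hK.smooth.continuous.comp (by fun_prop))

lemma mol_const (K : (Fin d → ℝ) → ℝ) (L : ℝ) (hK : IsKer K L) (x : Fin d → ℝ) (a : ℝ) :
    mol K (fun _ => a) x = a := by
  unfold mol; rw [integral_mul_const, ker_int_one K L hK, one_mul]

lemma Slice.R_ge (h : Slice γ c r u) (hγ : 1 < γ) (K : (Fin d → ℝ) → ℝ) (L : ℝ) (hK : IsKer K L)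
    (x : Fin d → ℝ) : c ≤ mol K r x := by
  rw [← mol_const K L hK x c]
  unfold mol
  refine integral_mono_ae (mol_integrable K _ hK.smooth.continuous hK.per (integrable_const c) x)
    (mol_integrable K r hK.smooth.continuous hK.per (h.ir hγ) x) ?_
  filter_upwards [h.rc] with y hy
  exact mul_le_mul_of_nonneg_left hy (hK.pos _).le
end

lemma slices_ae (T γ : ℝ) (ρ : ℝ → (Fin d → ℝ) → ℝ) (v : ℝ → (Fin d → ℝ) → Fin d → ℝ)
    (ρ₀ : (Fin d → ℝ) → ℝ) (v₀ : (Fin d → ℝ) → Fin d → ℝ)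
    (hsol : IsWeakSolution d T γ ρ v ρ₀ v₀) (c : ℝ)
    (hlow : ∀ᵐ z ∂(spaceTime d T), c ≤ ρ z.1 z.2) :
    ∃ C : ℝ, ∀ᵐ t ∂(volume.restrict (Set.Ioo 0 T)), Slice γ c (ρ t) (v t) ∧
      (∫ x, ρ t x ^ γ ∂cubeVol d ≤ C) ∧ ∫ x, ρ t x * euNorm (v t x) ^ 2 ∂cubeVol d ≤ C := by
  have hp := hsol.pressure_int
  have hk := hsol.kinetic_int
  unfold MemLpLq LpLqNorm timeLpOn at hp hk
  rw [if_pos rfl] at hp hk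
  set P := essSup (fun t => eLpNorm (fun x => ρ t x ^ γ) 1 (cubeVol d)) (volume.restrict (Set.Ioo 0 T))
  set Q := essSup (fun t => eLpNorm (fun x => ρ t x * euNorm (v t x) ^ 2) 1 (cubeVol d))
    (volume.restrict (Set.Ioo 0 T))
  refine ⟨P.toReal + Q.toReal, ?_⟩
  have rm : ∀ t, Measurable (ρ t) := fun t => hsol.rho_meas.comp measurable_prodMk_left
  have um : ∀ t, Measurable (v t) := fun t => hsol.v_meas.comp measurable_prodMk_left
  filter_upwards [ENNReal.ae_le_essSup (μ := volume.restrict (Set.Ioo 0 T))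
      (fun t => eLpNorm (fun x => ρ t x ^ γ) 1 (cubeVol d)),
    ENNReal.ae_le_essSup (μ := volume.restrict (Set.Ioo 0 T))
      (fun t => eLpNorm (fun x => ρ t x * euNorm (v t x) ^ 2) 1 (cubeVol d)),
    Measure.ae_ae_of_ae_prod hlow] with t h1 h2 h3
  have n1 : ∀ x, 0 ≤ ρ t x ^ γ := fun x => Real.rpow_nonneg (hsol.rho_nonneg t x) _
  have n2 : ∀ x, 0 ≤ ρ t x * euNorm (v t x) ^ 2 := fun x =>
    mul_nonneg (hsol.rho_nonneg t x) (sq_nonneg _)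
  have m1 : Measurable fun x => ρ t x ^ γ := (rm t).pow_const _
  have m2 : Measurable fun x => ρ t x * euNorm (v t x) ^ 2 :=
    (rm t).mul ((euNorm_meas.comp (um t)).pow_const 2)
  have key : ∀ (f : (Fin d → ℝ) → ℝ) (A : ℝ≥0∞), Measurable f → (∀ x, 0 ≤ f x) →
      eLpNorm f 1 (cubeVol d) ≤ A → A < ∞ → Integrable f (cubeVol d) ∧ ∫ x, f x ∂cubeVol d ≤ A.toReal := by
    intro f A hf h0 hA hA'
    have hi : Integrable f (cubeVol d) :=
      memLp_one_iff_integrable.1 ⟨hf.aestronglyMeasurable, hA.trans_lt hA'⟩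
    refine ⟨hi, ?_⟩
    rw [eLpNorm_one_eq_lintegral_enorm] at hA
    have := integral_norm_eq_lintegral_enorm hi.aestronglyMeasurable
    have e : ∫ x, f x ∂cubeVol d = ∫ x, ‖f x‖ ∂cubeVol d :=
      integral_congr_ae (Filter.Eventually.of_forall fun x => (Real.norm_of_nonneg (h0 x)).symm)
    rw [e, this]
    exact ENNReal.toReal_mono hA'.ne hA
  obtain ⟨i1, b1⟩ := key _ P m1 n1 h1 hp
  obtain ⟨i2, b2⟩ := key _ Q m2 n2 h2 hk
  refine ⟨⟨rm t, um t, hsol.rho_periodic t, hsol.v_periodic t, hsol.rho_nonneg t, h3, i1, i2⟩, ?_, ?_⟩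
  · exact b1.trans (le_add_of_nonneg_right ENNReal.toReal_nonneg)
  · exact b2.trans (le_add_of_nonneg_left ENNReal.toReal_nonneg)

lemma test_fun (T : ℝ) (K : (Fin d → ℝ) → ℝ) (hK : ContDiff ℝ (⊤ : ℕ∞) K) (hp : SpacePeriodic K)
    (x : Fin d → ℝ) (θ : ℝ → ℝ) (hθ : ContDiff ℝ (⊤ : ℕ∞) θ) :
    ContDiff ℝ (⊤ : ℕ∞) (Function.uncurry fun (t : ℝ) (y : Fin d → ℝ) => θ t * K (x - y)) ∧
    (∀ t, SpacePeriodic fun y => θ t * K (x - y)) ∧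
    (∀ t y, pderivT (fun t y => θ t * K (x - y)) t y = deriv θ t * K (x - y)) ∧
    (∀ i t y, pderivX i (fun t y => θ t * K (x - y)) t y = θ t * -(dK i K (x - y))) := by
  refine ⟨?_, ?_, ?_, ?_⟩
  · show ContDiff ℝ (⊤ : ℕ∞) fun z : ℝ × (Fin d → ℝ) => θ z.1 * K (x - z.2)
    exact (hθ.comp contDiff_fst).mul (hK.comp (contDiff_const.sub contDiff_snd))
  · intro t y n
    show θ t * K (x - (y + fun i => (n i : ℝ))) = θ t * K (x - y)
    have := hp (x - (y + fun i => (n i : ℝ))) n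
    rw [← this]
    congr 2; abel
  · intro t y
    unfold pderivT
    exact deriv_mul_const ((hθ.differentiable (by simp)) t) _
  · intro i t y
    unfold pderivX dK
    have h1 : HasFDerivAt (fun y : Fin d → ℝ => x - y) (-(ContinuousLinearMap.id ℝ (Fin d → ℝ))) y :=
      (hasFDerivAt_id y).const_sub x
    have h2 : HasFDerivAt K (fderiv ℝ K (x - y)) (x - y) :=
      (hK.differentiable (by simp) _).hasFDerivAt
    have h3 := (h2.comp y h1).const_mul (θ t)
    have h4 : fderiv ℝ (fun y => θ t * K (x - y)) y = _ := h3.fderiv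
    rw [h4]
    simp

lemma int_bdd (T : ℝ) (f : ℝ → ℝ) (hf : Measurable f) (B : ℝ)
    (h : ∀ᵐ t ∂(volume.restrict (Set.Ioo 0 T)), |f t| ≤ B) : IntegrableOn f (Set.Ioo 0 T) :=
  Integrable.of_bound hf.aestronglyMeasurable B h

section
variable (T : ℝ) (hT : 0 < T) (γ : ℝ) (hγ : 1 < γ)
    (ρ : ℝ → (Fin d → ℝ) → ℝ) (v : ℝ → (Fin d → ℝ) → Fin d → ℝ)
    (ρ₀ : (Fin d → ℝ) → ℝ) (v₀ : (Fin d → ℝ) → Fin d → ℝ)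
    (hsol : IsWeakSolution d T γ ρ v ρ₀ v₀)
    (c : ℝ) (hc : 0 < c)
    (hlow : ∀ᵐ z ∂(spaceTime d T), c ≤ ρ z.1 z.2)

/-- mollified mass flux divergence -/
def AA (K : (Fin d → ℝ) → ℝ) (t : ℝ) (x : Fin d → ℝ) : ℝ :=
  ∑ i, mol (dK i K) (fun y => ρ t y * v t y i) x

/-- mollified momentum flux divergence -/
def BB (K : (Fin d → ℝ) → ℝ) (j : Fin d) (t : ℝ) (x : Fin d → ℝ) : ℝ :=
  ∑ i, mol (dK i K) (FF γ (ρ t) (v t) i j) x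

include hsol in
lemma meas_all (k : (Fin d → ℝ) → ℝ) (hk : Continuous k) :
    Measurable (fun z : ℝ × (Fin d → ℝ) => mol k (ρ z.1) z.2) ∧
    (∀ j, Measurable (fun z : ℝ × (Fin d → ℝ) => mol k (fun y => ρ z.1 y * v z.1 y j) z.2)) ∧
    (∀ i j, Measurable (fun z : ℝ × (Fin d → ℝ) => mol k (FF γ (ρ z.1) (v z.1) i j) z.2)) := by
  have h1 := hsol.rho_meas
  have h2 := hsol.v_meas
  have h2' : ∀ j, Measurable fun z : ℝ × (Fin d → ℝ) => v z.1 z.2 j := fun j =>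
    (measurable_pi_apply j).comp h2
  have h1' : Measurable fun z : ℝ × (Fin d → ℝ) => ρ z.1 z.2 := h1
  refine ⟨mol_meas k hk ρ h1, fun j => ?_, fun i j => ?_⟩
  · exact mol_meas k hk (fun t y => ρ t y * v t y j) (h1'.mul (h2' j))
  · refine mol_meas k hk (fun t y => FF γ (ρ t) (v t) i j y) ?_
    show Measurable fun z : ℝ × (Fin d → ℝ) => FF γ (ρ z.1) (v z.1) i j z.2
    unfold FF
    refine ((h1'.mul (h2' i)).mul (h2' j)).add ?_
    split_ifs
    · exact (h1'.pow_const γ).const_mul _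
    · exact measurable_const

include hγ hsol hlow in
lemma bdd_all (K : (Fin d → ℝ) → ℝ) (L : ℝ) (hK : IsKer K L) :
    ∃ b : ℝ, ∀ᵐ t ∂(volume.restrict (Set.Ioo 0 T)), Slice γ c (ρ t) (v t) ∧ ∀ x,
      (c ≤ mol K (ρ t) x ∧ mol K (ρ t) x ≤ b) ∧ (∀ j, |mol K (fun y => ρ t y * v t y j) x| ≤ b) ∧
      |AA ρ v K t x| ≤ b ∧ (∀ j, |BB γ ρ v K j t x| ≤ b) := by
  obtain ⟨C, hC⟩ := slices_ae T γ ρ v ρ₀ v₀ hsol c hlow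
  obtain ⟨BK, hBK⟩ := per_cont_bdd K hK.smooth.continuous hK.per
  choose BD hBD using fun i => per_cont_bdd (dK i K) (dK_cont K hK.smooth i) (dK_per K hK.per i)
  have hBK0 : 0 ≤ BK := (abs_nonneg _).trans (hBK 0)
  have hBD0 : ∀ i, 0 ≤ BD i := fun i => (abs_nonneg _).trans (hBD i 0)
  have hk := kappa_pos γ hγ
  set B := BK + ∑ i, BD i with hB
  have hS0 : 0 ≤ ∑ i, BD i := Finset.sum_nonneg fun i _ => hBD0 i
  have hBB : 0 ≤ B := add_nonneg hBK0 hS0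
  set D := (2 + kappa γ) * (1 + |C|) with hD
  have hCa := le_abs_self C
  have hCn := abs_nonneg C
  have d1 : 1 + C ≤ D := by nlinarith
  have d2 : 1 + 2 * C ≤ D := by nlinarith
  have d3 : C + kappa γ * C ≤ D := by nlinarith
  have hDn : 0 ≤ D := by positivity
  refine ⟨B * D, ?_⟩
  filter_upwards [hC] with t ⟨hs, b1, b2⟩
  obtain ⟨e1, e2, e3⟩ := hs.bounds hγ C b1 b2
  refine ⟨hs, fun x => ⟨⟨hs.R_ge hγ K L hK x, ?_⟩, fun j => ?_, ?_, fun j => ?_⟩⟩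
  · refine (le_abs_self _).trans ((mol_bound K _ BK hBK (hs.ir hγ) x).trans ?_)
    exact mul_le_mul (by linarith) (e1.trans d1) (integral_nonneg fun _ => abs_nonneg _) hBB
  · refine (mol_bound K _ BK hBK (hs.iru hγ j) x).trans ?_
    exact mul_le_mul (by linarith) ((e2 j).trans d2) (integral_nonneg fun _ => abs_nonneg _) hBB
  · unfold AA
    calc _ ≤ ∑ i, |mol (dK i K) (fun y => ρ t y * v t y i) x| := Finset.abs_sum_le_sum_abs _ _
      _ ≤ ∑ i, BD i * D := Finset.sum_le_sum fun i _ =>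
          (mol_bound _ _ (BD i) (hBD i) (hs.iru hγ i) x).trans
            (mul_le_mul_of_nonneg_left ((e2 i).trans d2) (hBD0 i))
      _ ≤ B * D := by rw [← Finset.sum_mul]; exact mul_le_mul_of_nonneg_right (by linarith) hDn
  · unfold BB
    calc _ ≤ ∑ i, |mol (dK i K) (FF γ (ρ t) (v t) i j) x| := Finset.abs_sum_le_sum_abs _ _
      _ ≤ ∑ i, BD i * D := Finset.sum_le_sum fun i _ =>
          (mol_bound _ _ (BD i) (hBD i) (hs.iF i j) x).trans
            (mul_le_mul_of_nonneg_left ((e3 i j).trans d3) (hBD0 i))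
      _ ≤ B * D := by rw [← Finset.sum_mul]; exact mul_le_mul_of_nonneg_right (by linarith) hDn

include hT hγ hsol hlow in
lemma mass_ae (K : (Fin d → ℝ) → ℝ) (L : ℝ) (hK : IsKer K L) (x : Fin d → ℝ) :
    ∀ᵐ t ∂(volume.restrict (Set.Ioo 0 T)), mol K (ρ t) x
      = mol K ρ₀ x - ∫ s in (0:ℝ)..t, AA ρ v K s x := by
  obtain ⟨b, hb⟩ := bdd_all T γ hγ ρ v ρ₀ v₀ hsol c hlow K L hK
  have mk : Measurable fun t : ℝ => (t, x) := by fun_prop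
  have iR : IntegrableOn (fun t => mol K (ρ t) x) (Set.Ioo 0 T) := by
    refine int_bdd T _ ((meas_all T γ ρ v ρ₀ v₀ hsol K hK.smooth.continuous).1.comp mk)
      (|b| + |c|) ?_
    filter_upwards [hb] with t ht
    have := (ht.2 x).1
    rw [abs_le]; constructor <;> linarith [neg_abs_le c, le_abs_self c, abs_nonneg c, le_abs_self b, abs_nonneg b]
  have iA : IntegrableOn (fun t => AA ρ v K t x) (Set.Ioo 0 T) := by
    refine int_bdd T _ ?_ b (hb.mono fun t ht => (ht.2 x).2.2.1)
    unfold AA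
    exact Finset.measurable_sum _ fun i _ =>
      ((meas_all T γ ρ v ρ₀ v₀ hsol (dK i K) (dK_cont K hK.smooth i)).2.1 i).comp mk
  refine time_int T hT _ _ _ iR iA ?_
  rintro θ hθ ⟨bb, hbb, hθs⟩
  obtain ⟨f1, f2, f3, f4⟩ := test_fun T K hK.smooth hK.per x θ hθ
  have h := hsol.mass (fun t y => θ t * K (x - y)) ⟨f1, f2, bb, hbb, fun t y ht => by
    rw [hθs t ht, zero_mul]⟩
  refine Eq.trans ?_ h
  congr 1
  · refine integral_congr_ae ?_
    filter_upwards [hb] with t ht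
    have hs := ht.1
    simp only [f3, f4]
    have e1 := (mol_integrable K _ hK.smooth.continuous hK.per (hs.ir hγ) x).const_mul (deriv θ t)
    have e2 : ∀ i, Integrable (fun y => θ t * (dK i K (x - y) * (ρ t y * v t y i))) (cubeVol d) :=
      fun i => (mol_integrable _ _ (dK_cont K hK.smooth i) (dK_per K hK.per i) (hs.iru hγ i) x).const_mul _
    calc deriv θ t * mol K (ρ t) x - θ t * AA ρ v K t x
        = (∫ y, deriv θ t * (K (x - y) * ρ t y) ∂cubeVol d)
          - ∫ y, ∑ i, θ t * (dK i K (x - y) * (ρ t y * v t y i)) ∂cubeVol d := by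
          rw [integral_const_mul, integral_finsetSum _ fun i _ => e2 i]
          unfold AA mol
          rw [Finset.mul_sum]
          simp only [integral_const_mul]
      _ = ∫ y, (deriv θ t * (K (x - y) * ρ t y)
            - ∑ i, θ t * (dK i K (x - y) * (ρ t y * v t y i))) ∂cubeVol d := by
          rw [integral_sub e1 (integrable_finsetSum _ fun i _ => e2 i)]
      _ = _ := by
          refine integral_congr_ae (Filter.Eventually.of_forall fun y => ?_)
          simp only [Finset.mul_sum]
          rw [sub_eq_add_neg, ← Finset.sum_neg_distrib]
          congr 1
          · ring
          · exact Finset.sum_congr rfl fun i _ => by ring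
  · unfold mol
    rw [← integral_const_mul]
    refine integral_congr_ae (Filter.Eventually.of_forall fun y => ?_)
    show θ 0 * (K (x - y) * ρ₀ y) = ρ₀ y * (θ 0 * K (x - y))
    ring

include hT hγ hsol hlow in
lemma mom_ae (K : (Fin d → ℝ) → ℝ) (L : ℝ) (hK : IsKer K L) (x : Fin d → ℝ) (j : Fin d) :
    ∀ᵐ t ∂(volume.restrict (Set.Ioo 0 T)), mol K (fun y => ρ t y * v t y j) x
      = mol K (fun y => ρ₀ y * v₀ y j) x - ∫ s in (0:ℝ)..t, BB γ ρ v K j s x := by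
  obtain ⟨b, hb⟩ := bdd_all T γ hγ ρ v ρ₀ v₀ hsol c hlow K L hK
  have mk : Measurable fun t : ℝ => (t, x) := by fun_prop
  have iR : IntegrableOn (fun t => mol K (fun y => ρ t y * v t y j) x) (Set.Ioo 0 T) := 
    int_bdd T _ (((meas_all T γ ρ v ρ₀ v₀ hsol K hK.smooth.continuous).2.1 j).comp mk)
      b (hb.mono fun t ht => (ht.2 x).2.1 j)
  have iA : IntegrableOn (fun t => BB γ ρ v K j t x) (Set.Ioo 0 T) := by
    refine int_bdd T _ ?_ b (hb.mono fun t ht => (ht.2 x).2.2.2 j)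
    unfold BB
    exact Finset.measurable_sum _ fun i _ =>
      ((meas_all T γ ρ v ρ₀ v₀ hsol (dK i K) (dK_cont K hK.smooth i)).2.2 i j).comp mk
  refine time_int T hT _ _ _ iR iA ?_
  rintro θ hθ ⟨bb, hbb, hθs⟩
  obtain ⟨f1, f2, f3, f4⟩ := test_fun T K hK.smooth hK.per x θ hθ
  have z1 : ∀ t y, pderivT (fun (_ : ℝ) (_ : Fin d → ℝ) => (0:ℝ)) t y = 0 := by
    intro t y; simp [pderivT]
  have z2 : ∀ i t y, pderivX i (fun (_ : ℝ) (_ : Fin d → ℝ) => (0:ℝ)) t y = 0 := by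
    intro i t y; simp [pderivX]
  have hΦ : ∀ j', (fun s y => (if j' = j then θ s * K (x - y) else 0)) =
      if j' = j then (fun s y => θ s * K (x - y)) else fun _ _ => 0 := by
    intro j'; split_ifs <;> rfl
  have h := hsol.momentum (fun t y j' => if j' = j then θ t * K (x - y) else 0) (fun j' => by
    rw [hΦ]
    split_ifs
    · exact ⟨f1, f2, bb, hbb, fun t y ht => by rw [hθs t ht, zero_mul]⟩
    · exact ⟨contDiff_const, fun t y n => rfl, bb, hbb, fun t y ht => rfl⟩)
  have p1 : ∀ j' t y, pderivT (fun s y => (if j' = j then θ s * K (x - y) else 0)) t y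
      = if j' = j then deriv θ t * K (x - y) else 0 := by
    intro j' t y; rw [hΦ]; split_ifs
    · exact f3 t y
    · exact z1 t y
  have p2 : ∀ i j' t y, pderivX i (fun s y => (if j' = j then θ s * K (x - y) else 0)) t y
      = if j' = j then θ t * -(dK i K (x - y)) else 0 := by
    intro i j' t y; rw [hΦ]; split_ifs
    · exact f4 i t y
    · exact z2 i t y
  refine Eq.trans ?_ h
  congr 1
  · refine integral_congr_ae ?_
    filter_upwards [hb] with t ht
    have hs := ht.1
    simp only [p1, p2, mul_ite, mul_zero, Finset.sum_ite_eq', Finset.mem_univ, if_true]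
    have e1 := (mol_integrable K _ hK.smooth.continuous hK.per (hs.iru hγ j) x).const_mul (deriv θ t)
    have e2 : ∀ i, Integrable (fun y => θ t * (dK i K (x - y) * FF γ (ρ t) (v t) i j y)) (cubeVol d) :=
      fun i => (mol_integrable _ _ (dK_cont K hK.smooth i) (dK_per K hK.per i) (hs.iF i j) x).const_mul _
    calc deriv θ t * mol K (fun y => ρ t y * v t y j) x - θ t * BB γ ρ v K j t x
        = (∫ y, deriv θ t * (K (x - y) * (ρ t y * v t y j)) ∂cubeVol d)
          - ∫ y, ∑ i, θ t * (dK i K (x - y) * FF γ (ρ t) (v t) i j y) ∂cubeVol d := by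
          rw [integral_const_mul, integral_finsetSum _ fun i _ => e2 i]
          unfold BB mol
          rw [Finset.mul_sum]
          simp only [integral_const_mul]
      _ = ∫ y, (deriv θ t * (K (x - y) * (ρ t y * v t y j))
            - ∑ i, θ t * (dK i K (x - y) * FF γ (ρ t) (v t) i j y)) ∂cubeVol d := by
          rw [integral_sub e1 (integrable_finsetSum _ fun i _ => e2 i)]
      _ = _ := by
          refine integral_congr_ae (Filter.Eventually.of_forall fun y => ?_)
          simp only [FF]
          rw [sub_eq_add_neg, ← Finset.sum_neg_distrib]
          have : ∀ i, -(θ t * (dK i K (x - y) * (ρ t y * v t y i * v t y j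
              + if i = j then kappa γ * ρ t y ^ γ else 0)))
              = ρ t y * v t y i * v t y j * (θ t * -dK i K (x - y))
              + if i = j then kappa γ * ρ t y ^ γ * (θ t * -dK i K (x - y)) else 0 := by
            intro i; split_ifs <;> ring
          simp only [this, Finset.sum_add_distrib, Finset.sum_ite_eq', Finset.mem_univ, if_true]
          ring
  · unfold mol
    rw [← integral_const_mul]
    refine integral_congr_ae (Filter.Eventually.of_forall fun y => ?_)
    simp only [mul_ite, mul_zero, Finset.sum_ite_eq', Finset.mem_univ, if_true]
    ring

end

/-- mollified energy density -/
def Eden (k γ : ℝ) (K : (Fin d → ℝ) → ℝ) (r : (Fin d → ℝ) → ℝ) (u : (Fin d → ℝ) → Fin d → ℝ)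
    (x : Fin d → ℝ) : ℝ :=
  1 / 2 * ((∑ j, mol K (fun y => r y * u y j) x ^ 2) * (mol K r x)⁻¹) + k * mol K r x ^ γ

/-- commutator density -/
def Sden (k γ : ℝ) (K : (Fin d → ℝ) → ℝ) (r : (Fin d → ℝ) → ℝ) (u : (Fin d → ℝ) → Fin d → ℝ)
    (x : Fin d → ℝ) : ℝ :=
  ∑ i, ∑ j, ((mol (dK i K) (fun y => r y * u y j) x * mol K r x
      - mol K (fun y => r y * u y j) x * mol (dK i K) r x) * (mol K r x ^ 2)⁻¹)
    * (mol K (FF γ r u i j) x - mol K (fun y => r y * u y i) x * mol K (fun y => r y * u y j) x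
        * (mol K r x)⁻¹ - if i = j then (k * (γ - 1)) * mol K r x ^ γ else 0)

/-- The density before integrating by parts -/
def Nden (k γ : ℝ) (ρ : ℝ → (Fin d → ℝ) → ℝ) (v : ℝ → (Fin d → ℝ) → Fin d → ℝ)
    (K : (Fin d → ℝ) → ℝ) (t : ℝ) (x : Fin d → ℝ) : ℝ :=
  (k * γ * mol K (ρ t) x ^ (γ - 1)
    - 1 / 2 * ((∑ j, mol K (fun y => ρ t y * v t y j) x ^ 2) * ((mol K (ρ t) x)^2)⁻¹)) * AA ρ v K t x
    + ∑ j, mol K (fun y => ρ t y * v t y j) x * (mol K (ρ t) x)⁻¹ * BB γ ρ v K j t x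

lemma Nden_int (k γ c : ℝ) (hγ : 1 < γ) (hc : 0 < c) (ρ : ℝ → (Fin d → ℝ) → ℝ)
    (v : ℝ → (Fin d → ℝ) → Fin d → ℝ)
    (K : (Fin d → ℝ) → ℝ) (L : ℝ) (hK : IsKer K L) (t : ℝ) (hs : Slice γ c (ρ t) (v t)) :
    ∫ x, Nden k γ ρ v K t x ∂cubeVol d = - ∫ x, Sden k γ K (ρ t) (v t) x ∂cubeVol d := by
  exact slice_ibp_abs k γ (mol K (ρ t)) (fun i => mol (dK i K) (ρ t))
    (fun j => mol K fun y => ρ t y * v t y j) (fun j i => mol (dK i K) fun y => ρ t y * v t y j)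
    (fun i j => mol K (FF γ (ρ t) (v t) i j)) (fun i j l => mol (dK l K) (FF γ (ρ t) (v t) i j))
    (fun x => hc.trans_le (hs.R_ge hγ K L hK x)) (mol_PC1 K _ hK.smooth hK.per (hs.ir hγ))
    (fun j => mol_PC1 K _ hK.smooth hK.per (hs.iru hγ j))
    (fun i j => mol_PC1 K _ hK.smooth hK.per (hs.iF i j))

lemma comp_bdd (k γ c b : ℝ) (hc : 0 < c) :
    ∃ B, ∀ (R A : ℝ) (M N : Fin d → ℝ), c ≤ R → R ≤ b → |A| ≤ b → (∀ j, |M j| ≤ b) →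
      (∀ j, |N j| ≤ b) →
      |1 / 2 * ((∑ j, M j ^ 2) * R⁻¹) + k * R ^ γ| ≤ B ∧
      |(k * γ * R ^ (γ - 1) - 1 / 2 * ((∑ j, M j ^ 2) * (R ^ 2)⁻¹)) * A
        + ∑ j, M j * R⁻¹ * N j| ≤ B := by
  set s : Set ((ℝ × ℝ) × ((Fin d → ℝ) × (Fin d → ℝ))) :=
    (Set.Icc c b ×ˢ Set.Icc (-b) b) ×ˢ
      ((Set.univ.pi fun _ => Set.Icc (-b) b) ×ˢ (Set.univ.pi fun _ => Set.Icc (-b) b)) with hs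
  have hcomp : IsCompact s := by
    refine (isCompact_Icc.prod isCompact_Icc).prod (IsCompact.prod ?_ ?_) <;>
      exact isCompact_univ_pi fun _ => isCompact_Icc
  have hne : ∀ z ∈ s, z.1.1 ≠ 0 := fun z hz => (hc.trans_le hz.1.1.1).ne'
  have c1 : ContinuousOn (fun z : (ℝ × ℝ) × ((Fin d → ℝ) × (Fin d → ℝ)) => z.1.1⁻¹) s :=
    ContinuousOn.inv₀ (by fun_prop) hne
  have c2 : ContinuousOn (fun z : (ℝ × ℝ) × ((Fin d → ℝ) × (Fin d → ℝ)) => (z.1.1 ^ 2)⁻¹) s :=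
    ContinuousOn.inv₀ (by fun_prop) fun z hz => pow_ne_zero 2 (hne z hz)
  have c3 : ∀ e : ℝ, ContinuousOn (fun z : (ℝ × ℝ) × ((Fin d → ℝ) × (Fin d → ℝ)) => z.1.1 ^ e) s :=
    fun e => ContinuousOn.rpow_const (by fun_prop) fun z hz => Or.inl (hne z hz)
  have c4 := c3 γ
  have c5 := c3 (γ - 1)
  obtain ⟨B1, h1⟩ := hcomp.exists_bound_of_continuousOn (f := fun z =>
    1 / 2 * ((∑ j, z.2.1 j ^ 2) * z.1.1⁻¹) + k * z.1.1 ^ γ) (by fun_prop)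
  obtain ⟨B2, h2⟩ := hcomp.exists_bound_of_continuousOn (f := fun z =>
    (k * γ * z.1.1 ^ (γ - 1) - 1 / 2 * ((∑ j, z.2.1 j ^ 2) * (z.1.1 ^ 2)⁻¹)) * z.1.2
        + ∑ j, z.2.1 j * z.1.1⁻¹ * z.2.2 j) (by fun_prop)
  refine ⟨max B1 B2, fun R A M N hR hR' hA hM hN => ?_⟩
  have hz : ((R, A), (M, N)) ∈ s :=
    ⟨⟨⟨hR, hR'⟩, abs_le.1 hA⟩, ⟨fun j _ => abs_le.1 (hM j), fun j _ => abs_le.1 (hN j)⟩⟩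
  exact ⟨(h1 _ hz).trans (le_max_left _ _), (h2 _ hz).trans (le_max_right _ _)⟩

section
variable (T : ℝ) (hT : 0 < T) (γ : ℝ) (hγ : 1 < γ)
    (ρ : ℝ → (Fin d → ℝ) → ℝ) (v : ℝ → (Fin d → ℝ) → Fin d → ℝ)
    (ρ₀ : (Fin d → ℝ) → ℝ) (v₀ : (Fin d → ℝ) → Fin d → ℝ)
    (hsol : IsWeakSolution d T γ ρ v ρ₀ v₀)
    (c : ℝ) (hc : 0 < c)
    (hlow : ∀ᵐ z ∂(spaceTime d T), c ≤ ρ z.1 z.2)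

include hsol in
lemma Eden_meas (k : ℝ) (K : (Fin d → ℝ) → ℝ) (L : ℝ) (hK : IsKer K L) :
    Measurable fun z : ℝ × (Fin d → ℝ) => Eden k γ K (ρ z.1) (v z.1) z.2 := by
  obtain ⟨m1, m2, m3⟩ := meas_all T γ ρ v ρ₀ v₀ hsol K hK.smooth.continuous
  unfold Eden
  have : Measurable fun z : ℝ × (Fin d → ℝ) => ∑ j, mol K (fun y => ρ z.1 y * v z.1 y j) z.2 ^ 2 :=
    Finset.measurable_sum _ fun j _ => (m2 j).pow_const 2
  exact ((this.mul m1.inv).const_mul _).add ((m1.pow_const γ).const_mul _)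

include hsol in
lemma AB_meas (K : (Fin d → ℝ) → ℝ) (L : ℝ) (hK : IsKer K L) :
    Measurable (fun z : ℝ × (Fin d → ℝ) => AA ρ v K z.1 z.2) ∧
    ∀ j, Measurable (fun z : ℝ × (Fin d → ℝ) => BB γ ρ v K j z.1 z.2) := by
  have m := fun i => meas_all T γ ρ v ρ₀ v₀ hsol (dK i K) (dK_cont K hK.smooth i)
  refine ⟨?_, fun j => ?_⟩
  · unfold AA
    exact Finset.measurable_sum _ fun i _ => (m i).2.1 i
  · unfold BB
    exact Finset.measurable_sum _ fun i _ => (m i).2.2 i j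

include hsol in
lemma Nden_meas (k : ℝ) (K : (Fin d → ℝ) → ℝ) (L : ℝ) (hK : IsKer K L) :
    Measurable fun z : ℝ × (Fin d → ℝ) => Nden k γ ρ v K z.1 z.2 := by
  obtain ⟨m1, m2, m3⟩ := meas_all T γ ρ v ρ₀ v₀ hsol K hK.smooth.continuous
  obtain ⟨a1, a2⟩ := AB_meas T γ ρ v ρ₀ v₀ hsol K L hK
  unfold Nden
  have : Measurable fun z : ℝ × (Fin d → ℝ) => ∑ j, mol K (fun y => ρ z.1 y * v z.1 y j) z.2 ^ 2 :=
    Finset.measurable_sum _ fun j _ => (m2 j).pow_const 2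
  refine Measurable.add (Measurable.mul (Measurable.sub ((m1.pow_const _).const_mul _)
    ((this.mul (m1.pow_const 2).inv).const_mul _)) a1) ?_
  exact Finset.measurable_sum _ fun j _ => ((m2 j).mul m1.inv).mul (a2 j)

include hT hγ hsol hlow hc in
lemma identity (k : ℝ) (K : (Fin d → ℝ) → ℝ) (L : ℝ) (hK : IsKer K L)
    (χ : ℝ → ℝ) (hχ : ContDiff ℝ (⊤ : ℕ∞) χ) (hχs : TSupp T χ) :
    ∫ t in Set.Ioo 0 T, deriv χ t * ∫ x, Eden k γ K (ρ t) (v t) x ∂cubeVol d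
      = - ∫ t in Set.Ioo 0 T, χ t * ∫ x, Sden k γ K (ρ t) (v t) x ∂cubeVol d := by
  obtain ⟨b, hb⟩ := bdd_all T γ hγ ρ v ρ₀ v₀ hsol c hlow K L hK
  obtain ⟨B, hB⟩ := comp_bdd (d := d) k γ c b hc
  have hχ' : Continuous (deriv χ) := hχ.continuous_deriv (by simp)
  have bdd : ∀ f : ℝ → ℝ, Continuous f → ∃ D, ∀ t ∈ Set.Ioo 0 T, |f t| ≤ D := by
    intro f hf
    obtain ⟨D, hD⟩ := (isCompact_Icc (a := (0:ℝ)) (b := T)).exists_bound_of_continuousOn hf.continuousOn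
    exact ⟨D, fun t ht => hD t ⟨ht.1.le, ht.2.le⟩⟩
  have intg : ∀ (f : ℝ → ℝ) (g : ℝ → (Fin d → ℝ) → ℝ), Continuous f → 
      Measurable (fun z : ℝ × (Fin d → ℝ) => g z.1 z.2) →
      (∀ᵐ t ∂(volume.restrict (Set.Ioo 0 T)), ∀ x, |g t x| ≤ B) →
      Integrable (Function.uncurry fun t x => f t * g t x)
        ((volume.restrict (Set.Ioo 0 T)).prod (cubeVol d)) := by
    intro f g hf hg hgb
    obtain ⟨D, hD⟩ := bdd f hf
    refine Integrable.of_bound (Measurable.aestronglyMeasurable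
      ((hf.measurable.comp measurable_fst).mul hg)) (D * B) ?_
    have : ∀ᵐ t ∂(volume.restrict (Set.Ioo 0 T)), ∀ x, |f t * g t x| ≤ D * B := by
      filter_upwards [hgb, ae_restrict_mem measurableSet_Ioo] with t ht htm x
      rw [abs_mul]
      exact mul_le_mul (hD t htm) (ht x) (abs_nonneg _) ((abs_nonneg _).trans (hD t htm))
    have h2 := Measure.quasiMeasurePreserving_fst (μ := volume.restrict (Set.Ioo 0 T))
      (ν := cubeVol d) |>.ae this
    filter_upwards [h2] with z hz
    exact hz z.2
  have i1 := intg (deriv χ) (fun t x => Eden k γ K (ρ t) (v t) x) hχ'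
    (Eden_meas T γ ρ v ρ₀ v₀ hsol k K L hK) (hb.mono fun t ht x => by
      obtain ⟨⟨h1, h2⟩, h3, h4, h5⟩ := ht.2 x
      exact (hB _ _ _ _ h1 h2 h4 h3 h5).1)
  have i2 := intg χ (fun t x => Nden k γ ρ v K t x) hχ.continuous
    (Nden_meas T γ ρ v ρ₀ v₀ hsol k K L hK) (hb.mono fun t ht x => by
      obtain ⟨⟨h1, h2⟩, h3, h4, h5⟩ := ht.2 x
      exact (hB _ _ _ _ h1 h2 h4 h3 h5).2)
  have iA : ∀ x, IntegrableOn (fun t => AA ρ v K t x) (Set.Ioo 0 T) := fun x =>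
    int_bdd T _ ((AB_meas T γ ρ v ρ₀ v₀ hsol K L hK).1.comp
      (by fun_prop : Measurable fun t : ℝ => (t, x))) b (hb.mono fun t ht => (ht.2 x).2.2.1)
  have iB : ∀ x j, IntegrableOn (fun t => BB γ ρ v K j t x) (Set.Ioo 0 T) := fun x j =>
    int_bdd T _ (((AB_meas T γ ρ v ρ₀ v₀ hsol K L hK).2 j).comp
      (by fun_prop : Measurable fun t : ℝ => (t, x))) b (hb.mono fun t ht => (ht.2 x).2.2.2 j)
  calc ∫ t in Set.Ioo 0 T, deriv χ t * ∫ x, Eden k γ K (ρ t) (v t) x ∂cubeVol d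
      = ∫ t in Set.Ioo 0 T, ∫ x, deriv χ t * Eden k γ K (ρ t) (v t) x ∂cubeVol d := by
        simp only [integral_const_mul]
    _ = ∫ x, (∫ t in Set.Ioo 0 T, deriv χ t * Eden k γ K (ρ t) (v t) x) ∂cubeVol d :=
        integral_integral_swap i1
    _ = ∫ x, (∫ t in Set.Ioo 0 T, χ t * Nden k γ ρ v K t x) ∂cubeVol d := by
        congr 1
        funext x
        exact time_chain T hT c γ k hc (fun t => mol K (ρ t) x) (fun t => AA ρ v K t x)
          (fun j t => mol K (fun y => ρ t y * v t y j) x) (fun j t => BB γ ρ v K j t x)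
          (mol K ρ₀ x) (fun j => mol K (fun y => ρ₀ y * v₀ y j) x) (iA x) (iB x)
          (mass_ae T hT γ hγ ρ v ρ₀ v₀ hsol c hlow K L hK x)
          (fun j => mom_ae T hT γ hγ ρ v ρ₀ v₀ hsol c hlow K L hK x j)
          (hb.mono fun t ht => (ht.2 x).1.1) χ hχ hχs
    _ = ∫ t in Set.Ioo 0 T, ∫ x, χ t * Nden k γ ρ v K t x ∂cubeVol d :=
        (integral_integral_swap i2).symm
    _ = ∫ t in Set.Ioo 0 T, -(χ t * ∫ x, Sden k γ K (ρ t) (v t) x ∂cubeVol d) := by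
        refine integral_congr_ae ?_
        filter_upwards [hb] with t ht
        rw [integral_const_mul, Nden_int k γ c hγ hc ρ v K L hK t ht.1, mul_neg]
    _ = _ := integral_neg _

end

/-- Lower-integral `L^s` norm. -/
def nn {Ω : Type*} [MeasurableSpace Ω] (μ : Measure Ω) (s : ℝ) (f : Ω → ℝ≥0∞) : ℝ≥0∞ :=
  (∫⁻ x, f x ^ s ∂μ) ^ (1 / s)

section
variable {Ω : Type*} [MeasurableSpace Ω]

lemma hol3 (μ : Measure Ω) (f g h : Ω → ℝ≥0∞) (hf : AEMeasurable f μ) (hg : AEMeasurable g μ)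
    (hh : AEMeasurable h μ) (a b c s₁ s₂ s₃ : ℝ) (ha : 0 ≤ a) (hb : 0 ≤ b) (hc : 0 ≤ c)
    (h₁ : 0 < s₁) (h₂ : 0 < s₂) (h₃ : 0 < s₃) (hsum : a / s₁ + b / s₂ + c / s₃ ≤ 1) :
    ∫⁻ x, f x ^ a * g x ^ b * h x ^ c ∂μ
      ≤ nn μ s₁ f ^ a * nn μ s₂ g ^ b * nn μ s₃ h ^ c
        * (μ Set.univ) ^ (1 - (a / s₁ + b / s₂ + c / s₃)) := by
  have := ENNReal.lintegral_prod_norm_pow_le (μ := μ) (Finset.univ : Finset (Fin 4))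
    (f := ![fun x => f x ^ s₁, fun x => g x ^ s₂, fun x => h x ^ s₃, fun _ => 1])
    (p := ![a / s₁, b / s₂, c / s₃, 1 - (a / s₁ + b / s₂ + c / s₃)])
    (by intro i _; fin_cases i
        · exact hf.pow_const _
        · exact hg.pow_const _
        · exact hh.pow_const _
        · exact aemeasurable_const)
    (by simp [Fin.sum_univ_four])
    (by intro i _; fin_cases i
        · exact div_nonneg ha h₁.le
        · exact div_nonneg hb h₂.le
        · exact div_nonneg hc h₃.le
        · exact sub_nonneg.2 hsum)
  simp only [Fin.prod_univ_four, Matrix.cons_val_zero, Matrix.cons_val_one, Matrix.cons_val,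
    ENNReal.one_rpow, mul_one, lintegral_one] at this
  unfold nn
  simp only [← ENNReal.rpow_mul] at this ⊢
  rw [mul_div_cancel₀ _ h₁.ne', mul_div_cancel₀ _ h₂.ne', mul_div_cancel₀ _ h₃.ne'] at this
  rw [one_div_mul_eq_div, one_div_mul_eq_div, one_div_mul_eq_div]
  exact this

lemma hol3p (μ : Measure Ω) [IsProbabilityMeasure μ]
    (f g h : Ω → ℝ≥0∞) (hf : AEMeasurable f μ) (hg : AEMeasurable g μ)
    (hh : AEMeasurable h μ) (a b c s₁ s₂ s₃ : ℝ) (ha : 0 ≤ a) (hb : 0 ≤ b) (hc : 0 ≤ c)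
    (h₁ : 0 < s₁) (h₂ : 0 < s₂) (h₃ : 0 < s₃) (hsum : a / s₁ + b / s₂ + c / s₃ ≤ 1) :
    ∫⁻ x, f x ^ a * g x ^ b * h x ^ c ∂μ ≤ nn μ s₁ f ^ a * nn μ s₂ g ^ b * nn μ s₃ h ^ c := by
  have := hol3 μ f g h hf hg hh a b c s₁ s₂ s₃ ha hb hc h₁ h₂ h₃ hsum
  simpa using this

lemma hol2p (μ : Measure Ω) [IsProbabilityMeasure μ]
    (f g : Ω → ℝ≥0∞) (hf : AEMeasurable f μ) (hg : AEMeasurable g μ)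
    (a b s₁ s₂ : ℝ) (ha : 0 ≤ a) (hb : 0 ≤ b)
    (h₁ : 0 < s₁) (h₂ : 0 < s₂) (hsum : a / s₁ + b / s₂ ≤ 1) :
    ∫⁻ x, f x ^ a * g x ^ b ∂μ ≤ nn μ s₁ f ^ a * nn μ s₂ g ^ b := by
  have := hol3p μ f g g hf hg hg a b 0 s₁ s₂ 1 ha hb le_rfl h₁ h₂ one_pos (by simpa using hsum)
  simpa using this

lemma hol1p (μ : Measure Ω) [IsProbabilityMeasure μ] (f : Ω → ℝ≥0∞) (hf : AEMeasurable f μ)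
    (a s : ℝ) (ha : 0 ≤ a) (hs : 0 < s) (has : a ≤ s) :
    ∫⁻ x, f x ^ a ∂μ ≤ nn μ s f ^ a := by
  have := hol2p μ f f hf hf a 0 s 1 ha le_rfl hs one_pos
    (by simpa using (div_le_one hs).2 has)
  simpa using this

lemma nn_one (μ : Measure Ω) (f : Ω → ℝ≥0∞) : nn μ 1 f = ∫⁻ x, f x ∂μ := by
  simp [nn]

lemma nn_mono (μ : Measure Ω) (s : ℝ) (hs : 0 < s) (f g : Ω → ℝ≥0∞) (h : ∀ᵐ x ∂μ, f x ≤ g x) :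
    nn μ s f ≤ nn μ s g := by
  unfold nn
  refine ENNReal.rpow_le_rpow (lintegral_mono_ae (h.mono fun x hx => ?_)) (by positivity)
  exact ENNReal.rpow_le_rpow hx hs.le

lemma nn_pow (μ : Measure Ω) (s : ℝ) (hs : 0 < s) (f : Ω → ℝ≥0∞) :
    nn μ s f ^ s = ∫⁻ x, f x ^ s ∂μ := by
  unfold nn
  rw [← ENNReal.rpow_mul, one_div_mul_cancel hs.ne', ENNReal.rpow_one]

lemma nn_add (μ : Measure Ω) (s : ℝ) (hs : 1 ≤ s) (f g : Ω → ℝ≥0∞) (hf : AEMeasurable f μ)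
    (hg : AEMeasurable g μ) : nn μ s (fun x => f x + g x) ≤ nn μ s f + nn μ s g :=
  ENNReal.lintegral_Lp_add_le hf hg hs

lemma nn_const (μ : Measure Ω) [IsProbabilityMeasure μ] (s : ℝ) (hs : 0 < s) (a : ℝ≥0∞) :
    nn μ s (fun _ => a) = a := by
  unfold nn
  rw [lintegral_const, measure_univ, mul_one, ← ENNReal.rpow_mul, mul_one_div_cancel hs.ne',
    ENNReal.rpow_one]

lemma nn_exp (μ : Measure Ω) [IsProbabilityMeasure μ] (f : Ω → ℝ≥0∞) (hf : AEMeasurable f μ)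
    (a s : ℝ) (ha : 0 < a) (has : a ≤ s) : nn μ a f ≤ nn μ s f := by
  have h := ENNReal.rpow_le_rpow (hol1p μ f hf a s ha.le (ha.trans_le has) has)
    (by positivity : 0 ≤ 1 / a)
  rwa [← ENNReal.rpow_mul, mul_one_div_cancel ha.ne', ENNReal.rpow_one] at h

/-- scalar inequality -/
lemma rpow_diff (γ : ℝ) (hγ : 1 < γ) (a b : ℝ) (ha : 0 ≤ a) (hb : 0 ≤ b) :
    |a ^ γ - b ^ γ| ≤ γ * ((a ^ (γ - 1) + b ^ (γ - 1)) * |a - b|) := by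
  wlog hab : b ≤ a generalizing a b with H
  · have := H b a hb ha (le_of_not_ge hab)
    rwa [abs_sub_comm, abs_sub_comm a b, add_comm (a ^ (γ - 1))]
  have h1 : ∀ z ∈ Set.Icc b a, HasDerivWithinAt (fun x : ℝ => x ^ γ) (γ * z ^ (γ - 1)) (Set.Icc b a) z := by
    intro z hz
    exact (Real.hasDerivAt_rpow_const (Or.inr hγ.le)).hasDerivWithinAt
  have h2 := (convex_Icc b a).norm_image_sub_le_of_norm_hasDerivWithin_le h1 (C := γ * a ^ (γ - 1))
    (fun z hz => by
      have hz0 : 0 ≤ z := hb.trans hz.1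
      rw [Real.norm_of_nonneg (by positivity)]
      have := Real.rpow_le_rpow hz0 hz.2 (by linarith : 0 ≤ γ - 1)
      gcongr) (Set.left_mem_Icc.2 hab) (Set.right_mem_Icc.2 hab)
  rw [Real.norm_eq_abs, Real.norm_eq_abs] at h2
  refine h2.trans ?_
  have : 0 ≤ b ^ (γ - 1) := by positivity
  rw [mul_assoc]
  gcongr
  linarith

/-- Scalar data for the exponents. -/
structure Exps (γ q r m : ℝ) : Prop where
  g : 1 < γ
  q3 : 3 < q
  r1 : 1 ≤ r
  rq : 1 / r = 1 - 3 / q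
  m1 : 1 ≤ m
  mq : (γ - 1) / m ≤ 2 / q

section
variable {γ q r m : ℝ} (he : Exps γ q r m) (P : Measure Ω) [IsProbabilityMeasure P]
  (f : Ω → ℝ) (hf : Measurable f) (hf0 : ∀ x, 0 ≤ f x)
  (hfi : Integrable f P) (hfg : Integrable (fun x => f x ^ γ) P)

include he hf hf0 hfi hfg in
lemma gap1 : ENNReal.ofReal |(∫ x, f x ^ γ ∂P) - (∫ x, f x ∂P) ^ γ|
    ≤ ENNReal.ofReal γ * (2 * (nn P m (fun x => ENNReal.ofReal (f x)) ^ (γ - 1)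
      * nn P r (fun x => ENNReal.ofReal |f x - ∫ y, f y ∂P|))) := by
  obtain ⟨hg, hq, hr, hrq, hm, hmq⟩ := he
  set R := ∫ x, f x ∂P with hR
  have hR0 : 0 ≤ R := integral_nonneg hf0
  set F : Ω → ℝ≥0∞ := fun x => ENNReal.ofReal (f x) with hF
  set D : Ω → ℝ≥0∞ := fun x => ENNReal.ofReal |f x - R| with hD
  have hFm : Measurable F := hf.ennreal_ofReal
  have hDm : Measurable D := by
    have := (hf.sub_const R).abs; exact this.ennreal_ofReal
  have hRF : ENNReal.ofReal R = ∫⁻ x, F x ∂P :=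
    ofReal_integral_eq_lintegral_ofReal hfi (Filter.Eventually.of_forall hf0)
  have hRW : ENNReal.ofReal R ≤ nn P m F := by
    rw [hRF, ← nn_one P F]
    exact nn_exp P F hFm.aemeasurable 1 m one_pos hm
  have hq0 : 0 < q := by linarith
  have hr0 : 0 < r := by linarith
  have e1 : ∫⁻ x, F x ^ (γ - 1) * D x ∂P ≤ nn P m F ^ (γ - 1) * nn P r D := by
    have := hol2p P F D hFm.aemeasurable hDm.aemeasurable (γ - 1) 1 m r (by linarith) zero_le_one
      (by linarith) hr0 (by
        rw [hrq]
        have h3 : 2 / q ≤ 3 / q := by gcongr; norm_num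
        linarith)
    simpa using this
  have e2 : ∫⁻ x, D x ∂P ≤ nn P r D := by
    rw [← nn_one]; exact nn_exp P D hDm.aemeasurable 1 r one_pos hr
  have : (∫ x, f x ^ γ ∂P) - R ^ γ = ∫ x, (f x ^ γ - R ^ γ) ∂P := by
    rw [integral_sub hfg (integrable_const _)]; simp
  rw [this]
  calc ENNReal.ofReal |∫ x, (f x ^ γ - R ^ γ) ∂P|
      ≤ ∫⁻ x, ENNReal.ofReal |f x ^ γ - R ^ γ| ∂P := by
        have := enorm_integral_le_lintegral_enorm (μ := P) (fun x => f x ^ γ - R ^ γ)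
        simpa only [Real.enorm_eq_ofReal_abs] using this
    _ ≤ ∫⁻ x, ENNReal.ofReal γ * (F x ^ (γ - 1) * D x + ENNReal.ofReal R ^ (γ - 1) * D x) ∂P := by
        refine lintegral_mono fun x => ?_
        rw [← add_mul, hF, hD]
        simp only
        rw [ENNReal.ofReal_rpow_of_nonneg (hf0 x) (by linarith),
          ENNReal.ofReal_rpow_of_nonneg hR0 (by linarith),
          ← ENNReal.ofReal_add (Real.rpow_nonneg (hf0 x) _) (Real.rpow_nonneg hR0 _),
          ← ENNReal.ofReal_mul (add_nonneg (Real.rpow_nonneg (hf0 x) _) (Real.rpow_nonneg hR0 _)),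
          ← ENNReal.ofReal_mul (by linarith)]
        exact ENNReal.ofReal_le_ofReal (rpow_diff γ hg _ _ (hf0 x) hR0)
    _ = ENNReal.ofReal γ * (∫⁻ x, F x ^ (γ - 1) * D x ∂P + ENNReal.ofReal R ^ (γ - 1) * ∫⁻ x, D x ∂P) := by
        rw [lintegral_const_mul _ (by fun_prop), lintegral_add_left (by fun_prop),
          lintegral_const_mul _ hDm]
    _ ≤ ENNReal.ofReal γ * (nn P m F ^ (γ - 1) * nn P r D + nn P m F ^ (γ - 1) * nn P r D) := by
        have := ENNReal.rpow_le_rpow hRW (by linarith : 0 ≤ γ - 1)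
        gcongr
    _ = _ := by rw [← two_mul]

include he hf hf0 hfi hfg in
lemma gap2 : ENNReal.ofReal |(∫ x, f x ^ γ ∂P) - (∫ x, f x ∂P) ^ γ|
    ≤ nn P m (fun x => ENNReal.ofReal (f x)) ^ (γ - 1) * ENNReal.ofReal (∫ x, f x ∂P) ^ (1 / 3 : ℝ)
      * nn P r (fun x => ENNReal.ofReal (f x)) ^ (2 / 3 : ℝ) := by
  obtain ⟨hg, hq, hr, hrq, hm, hmq⟩ := he
  set R := ∫ x, f x ∂P with hR
  have hR0 : 0 ≤ R := integral_nonneg hf0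
  set F : Ω → ℝ≥0∞ := fun x => ENNReal.ofReal (f x) with hF
  have hFm : Measurable F := hf.ennreal_ofReal
  have hRF : ENNReal.ofReal R = ∫⁻ x, F x ∂P :=
    ofReal_integral_eq_lintegral_ofReal hfi (Filter.Eventually.of_forall hf0)
  have hq0 : 0 < q := by linarith
  have hr0 : 0 < r := by linarith
  have hI0 : 0 ≤ ∫ x, f x ^ γ ∂P := integral_nonneg fun x => Real.rpow_nonneg (hf0 x) _
  have hIF : ENNReal.ofReal (∫ x, f x ^ γ ∂P) = ∫⁻ x, F x ^ γ ∂P := by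
    rw [ofReal_integral_eq_lintegral_ofReal hfg
      (Filter.Eventually.of_forall fun x => Real.rpow_nonneg (hf0 x) _)]
    refine lintegral_congr fun x => ?_
    rw [hF]; simp only
    rw [ENNReal.ofReal_rpow_of_nonneg (hf0 x) (by linarith)]
  have hJ : R ^ γ ≤ ∫ x, f x ^ γ ∂P := by
    rw [← ENNReal.ofReal_le_ofReal_iff hI0, hIF, ← ENNReal.ofReal_rpow_of_nonneg hR0 (by linarith), hRF]
    have := nn_exp P F hFm.aemeasurable 1 γ one_pos hg.le
    rw [nn_one] at this
    rw [← nn_pow P γ (by linarith)]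
    exact ENNReal.rpow_le_rpow this (by linarith)
  have hR1 : 0 ≤ R ^ γ := Real.rpow_nonneg hR0 _
  calc ENNReal.ofReal |(∫ x, f x ^ γ ∂P) - R ^ γ| ≤ ENNReal.ofReal (∫ x, f x ^ γ ∂P) := by
        refine ENNReal.ofReal_le_ofReal ?_
        rw [abs_of_nonneg (by linarith)]; linarith
    _ = ∫⁻ x, F x ^ (γ - 1) * F x ^ (1 / 3 : ℝ) * F x ^ (2 / 3 : ℝ) ∂P := by
        rw [hIF]
        refine lintegral_congr fun x => ?_
        rw [← ENNReal.rpow_add_of_nonneg _ _ (by linarith) (by norm_num),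
          ← ENNReal.rpow_add_of_nonneg _ _ (by linarith) (by norm_num)]
        congr 1; ring
    _ ≤ nn P m F ^ (γ - 1) * nn P 1 F ^ (1 / 3 : ℝ) * nn P r F ^ (2 / 3 : ℝ) := by
        refine hol3p P F F F hFm.aemeasurable hFm.aemeasurable hFm.aemeasurable _ _ _ _ _ _
          (by linarith) (by norm_num) (by norm_num) (by linarith) one_pos hr0 ?_
        have : (2 / 3 : ℝ) / r = 2 / 3 - 2 / q := by
          rw [div_eq_mul_one_div, hrq]; ring
        rw [this]; linarith
    _ = _ := by rw [nn_one, hRF]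

include he hf hf0 hfi in
lemma Xbd (δ : Ω → ℝ≥0∞) (hδ : Measurable δ) :
    ∫⁻ x, ENNReal.ofReal (f x) * δ x ∂P ≤ ENNReal.ofReal (∫ x, f x ∂P) ^ (2 / 3 : ℝ)
      * nn P r (fun x => ENNReal.ofReal (f x)) ^ (1 / 3 : ℝ) * nn P q δ := by
  obtain ⟨hg, hq, hr, hrq, hm, hmq⟩ := he
  set F : Ω → ℝ≥0∞ := fun x => ENNReal.ofReal (f x) with hF
  have hFm : Measurable F := hf.ennreal_ofReal
  have hq0 : 0 < q := by linarith
  have hr0 : 0 < r := by linarith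
  have hRF : ENNReal.ofReal (∫ x, f x ∂P) = ∫⁻ x, F x ∂P :=
    ofReal_integral_eq_lintegral_ofReal hfi (Filter.Eventually.of_forall hf0)
  have := hol3p P F F δ hFm.aemeasurable hFm.aemeasurable hδ.aemeasurable (2 / 3) (1 / 3) 1 1 r q
    (by norm_num) (by norm_num) (by norm_num) one_pos hr0 hq0 (by
      rw [div_eq_mul_one_div (1 / 3) r, hrq]; apply le_of_eq; ring)
  rw [hRF, ← nn_one P F]
  simp only [ENNReal.rpow_one] at this
  refine le_trans (le_of_eq (lintegral_congr fun x => ?_)) this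
  rw [← ENNReal.rpow_add_of_nonneg _ _ (by norm_num) (by norm_num)]
  norm_num
  rfl

include he hf hf0 hfi hfg in
/-- the key commutator bound -/
lemma XG (δ : Ω → ℝ≥0∞) (hδ : Measurable δ) :
    (∫⁻ x, ENNReal.ofReal (f x) * δ x ∂P)
      * ENNReal.ofReal |(∫ x, f x ^ γ ∂P) - (∫ x, f x ∂P) ^ γ|
    ≤ ENNReal.ofReal (4 * γ) * ENNReal.ofReal (∫ x, f x ∂P)
      * (nn P m (fun x => ENNReal.ofReal (f x)) ^ (γ - 1)
        * nn P r (fun x => ENNReal.ofReal |f x - ∫ y, f y ∂P|) * nn P q δ) := by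
  have hX := Xbd he P f hf hf0 hfi δ hδ
  have hG1 := gap1 he P f hf hf0 hfi hfg
  have hG2 := gap2 he P f hf hf0 hfi hfg
  have hg := he.g
  set R := ENNReal.ofReal (∫ x, f x ∂P) with hR
  set D := nn P r (fun x => ENNReal.ofReal |f x - ∫ y, f y ∂P|) with hD
  set N := nn P r (fun x => ENNReal.ofReal (f x)) with hN
  set W := nn P m (fun x => ENNReal.ofReal (f x)) ^ (γ - 1)
  set V := nn P q δ
  set G := ENNReal.ofReal |(∫ x, f x ^ γ ∂P) - (∫ x, f x ∂P) ^ γ|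
  set Z := ∫⁻ x, ENNReal.ofReal (f x) * δ x ∂P
  have hND : N ≤ R + D := by
    have hm1 : Measurable fun x => ENNReal.ofReal |f x - ∫ y, f y ∂P| :=
      ((hf.sub_const _).abs).ennreal_ofReal
    have h1 := nn_add P r he.r1 (fun _ => R) (fun x => ENNReal.ofReal |f x - ∫ y, f y ∂P|)
      aemeasurable_const hm1.aemeasurable
    rw [nn_const P r (by linarith [he.r1])] at h1
    refine le_trans (nn_mono P r (by linarith [he.r1]) _ _ (Filter.Eventually.of_forall fun x => ?_)) h1
    rw [hR, ← ENNReal.ofReal_add (integral_nonneg hf0) (abs_nonneg _)]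
    refine ENNReal.ofReal_le_ofReal ?_
    linarith [le_abs_self (f x - ∫ y, f y ∂P)]
  have h23 : ∀ a : ℝ≥0∞, a ^ (2 / 3 : ℝ) * a ^ (1 / 3 : ℝ) = a := by
    intro a
    rw [← ENNReal.rpow_add_of_nonneg _ _ (by norm_num) (by norm_num)]; norm_num
  have h4 : ENNReal.ofReal (4 * γ) = 4 * ENNReal.ofReal γ := by
    rw [ENNReal.ofReal_mul (by norm_num)]; norm_num
  rcases le_total D R with h | h
  · have hN2 : N ≤ 2 * R := hND.trans (by rw [two_mul]; gcongr)
    have hZ : Z ≤ 2 * R * V := by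
      calc Z ≤ R ^ (2 / 3 : ℝ) * N ^ (1 / 3 : ℝ) * V := hX
        _ ≤ (2 * R) ^ (2 / 3 : ℝ) * (2 * R) ^ (1 / 3 : ℝ) * V := by
            gcongr
            exact le_mul_of_one_le_left (zero_le) (by norm_num)
        _ = _ := by rw [h23]
    calc Z * G ≤ (2 * R * V) * (ENNReal.ofReal γ * (2 * (W * D))) := by gcongr
      _ = _ := by rw [h4]; ring
  · have hN2 : N ≤ 2 * D := hND.trans (by rw [two_mul]; gcongr)
    calc Z * G ≤ (R ^ (2 / 3 : ℝ) * (2 * D) ^ (1 / 3 : ℝ) * V)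
          * (W * R ^ (1 / 3 : ℝ) * (2 * D) ^ (2 / 3 : ℝ)) := by
          refine mul_le_mul' (hX.trans ?_) (hG2.trans ?_) <;> gcongr
      _ = (R ^ (2 / 3 : ℝ) * R ^ (1 / 3 : ℝ)) * ((2 * D) ^ (2 / 3 : ℝ) * (2 * D) ^ (1 / 3 : ℝ))
          * (W * V) := by ring
      _ = 2 * (R * (W * D * V)) := by rw [h23, h23]; ring
      _ ≤ ENNReal.ofReal (4 * γ) * (R * (W * D * V)) := by
          gcongr
          rw [show (2 : ℝ≥0∞) = ENNReal.ofReal 2 by norm_num]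
          exact ENNReal.ofReal_le_ofReal (by linarith)
      _ = _ := by ring

/-- replacing the mean by an arbitrary constant -/
lemma D_change (r : ℝ) (hr : 1 ≤ r) (f : Ω → ℝ) (hf : Measurable f) (hfi : Integrable f P) (b : ℝ) :
    nn P r (fun x => ENNReal.ofReal |f x - ∫ y, f y ∂P|)
      ≤ 2 * nn P r (fun x => ENNReal.ofReal |f x - b|) := by
  have hm1 : Measurable fun x => ENNReal.ofReal |f x - b| :=
      ((hf.sub_const _).abs).ennreal_ofReal
  have hr0 : 0 < r := by linarith
  have h1 := nn_add P r hr (fun x => ENNReal.ofReal |f x - b|)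
    (fun _ => ENNReal.ofReal |b - ∫ y, f y ∂P|) hm1.aemeasurable aemeasurable_const
  rw [nn_const P r hr0] at h1
  have h2 : ENNReal.ofReal |b - ∫ y, f y ∂P| ≤ nn P r (fun x => ENNReal.ofReal |f x - b|) := by
    refine le_trans ?_ (nn_exp P _ hm1.aemeasurable 1 r one_pos hr)
    rw [nn_one, abs_sub_comm]
    have e : (∫ y, f y ∂P) - b = ∫ y, (f y - b) ∂P := by
      rw [integral_sub hfi (integrable_const _)]; simp
    rw [e]
    have := enorm_integral_le_lintegral_enorm (μ := P) (fun x => f x - b)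
    simpa only [Real.enorm_eq_ofReal_abs] using this
  calc _ ≤ nn P r (fun x => ENNReal.ofReal |f x - b| + ENNReal.ofReal |b - ∫ y, f y ∂P|) := by
        refine nn_mono P r hr0 _ _ (Filter.Eventually.of_forall fun x => ?_)
        rw [← ENNReal.ofReal_add (abs_nonneg _) (abs_nonneg _)]
        exact ENNReal.ofReal_le_ofReal (abs_sub_le _ _ _)
    _ ≤ _ := h1
    _ ≤ _ := by rw [two_mul]; gcongr

end

/-- X * Z2 ≤ Z3 in product form. -/
lemma cheb (P : Measure Ω) (f δ : Ω → ℝ) (hf0 : ∀ x, 0 ≤ f x) (hδ0 : ∀ x, 0 ≤ δ x)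
    (i0 : Integrable f P) (i1 : Integrable (fun x => f x * δ x) P)
    (i2 : Integrable (fun x => f x * δ x ^ 2) P) (i3 : Integrable (fun x => f x * δ x ^ 3) P)
    (hR : 0 < ∫ x, f x ∂P) :
    (∫ x, f x * δ x ∂P) * (∫ x, f x ∂P)⁻¹ * (∫ x, f x * δ x ^ 2 ∂P) ≤ ∫ x, f x * δ x ^ 3 ∂P ∧
    (∫ x, f x * δ x ∂P) ^ 2 * (∫ x, f x ∂P)⁻¹ ≤ ∫ x, f x * δ x ^ 2 ∂P := by
  set R := ∫ x, f x ∂P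
  set Z := ∫ x, f x * δ x ∂P with hZ
  set X := Z * R⁻¹ with hX
  have hX0 : 0 ≤ X := mul_nonneg (integral_nonneg fun x => mul_nonneg (hf0 x) (hδ0 x))
    (inv_nonneg.2 hR.le)
  have hXR : X * R = Z := by rw [hX]; field_simp
  constructor
  · have h : 0 ≤ ∫ x, (f x * δ x ^ 3 - X * (f x * δ x ^ 2) - X ^ 2 * (f x * δ x) + X ^ 3 * f x) ∂P := by
      refine integral_nonneg fun x => ?_
      show 0 ≤ f x * δ x ^ 3 - X * (f x * δ x ^ 2) - X ^ 2 * (f x * δ x) + X ^ 3 * f x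
      have e : f x * δ x ^ 3 - X * (f x * δ x ^ 2) - X ^ 2 * (f x * δ x) + X ^ 3 * f x
          = f x * ((δ x - X) ^ 2 * (δ x + X)) := by ring
      rw [e]
      exact mul_nonneg (hf0 x) (mul_nonneg (sq_nonneg _) (add_nonneg (hδ0 x) hX0))
    rw [integral_add (f := fun x => f x * δ x ^ 3 - X * (f x * δ x ^ 2) - X ^ 2 * (f x * δ x))
        ((i3.sub (i2.const_mul X)).sub (i1.const_mul _)) (i0.const_mul _),
      integral_sub (f := fun x => f x * δ x ^ 3 - X * (f x * δ x ^ 2)) (i3.sub (i2.const_mul X)) (i1.const_mul _),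
      integral_sub i3 (i2.const_mul X), integral_const_mul, integral_const_mul, integral_const_mul] at h
    have e2 : X ^ 3 * R = X ^ 2 * Z := by rw [← hXR]; ring
    change 0 ≤ (∫ x, f x * δ x ^ 3 ∂P) - X * (∫ x, f x * δ x ^ 2 ∂P) - X ^ 2 * Z + X ^ 3 * R at h
    linarith
  · have h : 0 ≤ ∫ x, (f x * δ x ^ 2 - 2 * X * (f x * δ x) + X ^ 2 * f x) ∂P := by
      refine integral_nonneg fun x => ?_
      show 0 ≤ f x * δ x ^ 2 - 2 * X * (f x * δ x) + X ^ 2 * f x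
      have e : f x * δ x ^ 2 - 2 * X * (f x * δ x) + X ^ 2 * f x = f x * (δ x - X) ^ 2 := by ring
      rw [e]
      exact mul_nonneg (hf0 x) (sq_nonneg _)
    rw [integral_add (f := fun x => f x * δ x ^ 2 - 2 * X * (f x * δ x))
        (i2.sub (i1.const_mul _)) (i0.const_mul _),
      integral_sub i2 (i1.const_mul _), integral_const_mul, integral_const_mul] at h
    change 0 ≤ (∫ x, f x * δ x ^ 2 ∂P) - 2 * X * Z + X ^ 2 * R at h
    have e2 : X ^ 2 * R = X * Z := by rw [← hXR]; ring
    have e3 : Z ^ 2 * R⁻¹ = X * Z := by rw [hX]; ring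
    rw [e3]; linarith

end

/-- The probability measure `K(x-y)dy`. -/
def PK (K : (Fin d → ℝ) → ℝ) (x : Fin d → ℝ) : Measure (Fin d → ℝ) :=
  (cubeVol d).withDensity fun y => ENNReal.ofReal (K (x - y))

section
variable {K : (Fin d → ℝ) → ℝ} {L : ℝ} (hK : IsKer K L) (x : Fin d → ℝ)

include hK in
lemma PK_meas : Measurable fun y => ENNReal.ofReal (K (x - y)) := by
  have := hK.smooth.continuous
  fun_prop

include hK in
lemma PK_prob : IsProbabilityMeasure (PK K x) := by
  constructor
  unfold PK
  rw [withDensity_apply _ MeasurableSet.univ, setLIntegral_univ]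
  exact ker_mass K L hK x

include hK in
lemma PK_lint (g : (Fin d → ℝ) → ℝ≥0∞) (hg : Measurable g) :
    ∫⁻ y, g y ∂PK K x = ∫⁻ y, ENNReal.ofReal (K (x - y)) * g y ∂cubeVol d := by
  unfold PK
  rw [lintegral_withDensity_eq_lintegral_mul _ (PK_meas hK x) hg]
  rfl

include hK in
lemma PK_int (g : (Fin d → ℝ) → ℝ) : ∫ y, g y ∂PK K x = mol K g x := by
  unfold PK mol
  rw [integral_withDensity_eq_integral_toReal_smul (PK_meas hK x)
    (Filter.Eventually.of_forall fun y => ENNReal.ofReal_lt_top)]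
  refine integral_congr_ae (Filter.Eventually.of_forall fun y => ?_)
  simp only [ENNReal.toReal_ofReal (hK.pos _).le, smul_eq_mul]

include hK in
lemma PK_integrable (g : (Fin d → ℝ) → ℝ) (hg : Integrable g (cubeVol d)) :
    Integrable g (PK K x) := by
  unfold PK
  rw [integrable_withDensity_iff_integrable_smul' (PK_meas hK x)
    (Filter.Eventually.of_forall fun y => ENNReal.ofReal_lt_top)]
  refine (mol_integrable K g hK.smooth.continuous hK.per hg x).congr
    (Filter.Eventually.of_forall fun y => ?_)
  simp only [ENNReal.toReal_ofReal (hK.pos _).le, smul_eq_mul]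

include hK in
lemma dmol_bound (g h : (Fin d → ℝ) → ℝ) (hgi : Integrable h (PK K x)) (hgh : ∀ y, |g y| ≤ h y)
    (i : Fin d) : |mol (dK i K) g x| ≤ L * ∫ y, h y ∂PK K x := by
  have hi : Integrable (fun y => K (x - y) * h y) (cubeVol d) := by
    unfold PK at hgi
    rw [integrable_withDensity_iff_integrable_smul' (PK_meas hK x)
      (Filter.Eventually.of_forall fun y => ENNReal.ofReal_lt_top)] at hgi
    refine hgi.congr (Filter.Eventually.of_forall fun y => ?_)
    simp only [ENNReal.toReal_ofReal (hK.pos _).le, smul_eq_mul]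
  rw [PK_int hK]
  unfold mol
  rw [← integral_const_mul, ← Real.norm_eq_abs]
  refine norm_integral_le_of_norm_le (hi.const_mul L) (Filter.Eventually.of_forall fun y => ?_)
  rw [Real.norm_eq_abs, abs_mul, ← mul_assoc]
  exact mul_le_mul (hK.deriv_le i _) (hgh y) (abs_nonneg _)
    (mul_nonneg hK.L_nonneg (hK.pos _).le)

variable {γ c : ℝ} {r : (Fin d → ℝ) → ℝ} {u : (Fin d → ℝ) → Fin d → ℝ}

include hK in
lemma Sden_pt (hγ : 1 < γ) (hc : 0 < c) (hs : Slice γ c r u) (k : ℝ) (hk : k * (γ - 1) = kappa γ)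
    (i3 : Integrable (fun y => r y * ‖u y - u x‖ ^ 3) (PK K x)) :
    |Sden k γ K r u x| ≤ (d : ℝ) ^ 2 * (2 * L * (2 * (∫ y, r y * ‖u y - u x‖ ^ 3 ∂PK K x)
      + kappa γ * ((∫ y, r y * ‖u y - u x‖ ∂PK K x) * (∫ y, r y ∂PK K x)⁻¹
        * |(∫ y, r y ^ γ ∂PK K x) - (∫ y, r y ∂PK K x) ^ γ|))) := by
  have hP := PK_prob hK x
  set P := PK K x with hPdef
  set δ : (Fin d → ℝ) → ℝ := fun y => ‖u y - u x‖ with hδ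
  have hδ0 : ∀ y, 0 ≤ δ y := fun y => norm_nonneg _
  have hrm := hs.rm
  have hum := hs.um
  have hδm : Measurable δ := (hum.sub_const _).norm
  have i0 : Integrable r P := PK_integrable hK x r (hs.ir hγ)
  have i1 : Integrable (fun y => r y * δ y) P := by
    refine (i0.add i3).mono' (Measurable.aestronglyMeasurable (by fun_prop))
      (Filter.Eventually.of_forall fun y => ?_)
    rw [Real.norm_of_nonneg (mul_nonneg (hs.r0 y) (hδ0 y))]
    show r y * δ y ≤ r y + r y * δ y ^ 3
    rw [← mul_one_add]
    refine mul_le_mul_of_nonneg_left ?_ (hs.r0 y)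
    nlinarith [hδ0 y, sq_nonneg (δ y - 1), sq_nonneg (δ y)]
  have i2 : Integrable (fun y => r y * δ y ^ 2) P := by
    refine (i0.add i3).mono' (Measurable.aestronglyMeasurable (by fun_prop))
      (Filter.Eventually.of_forall fun y => ?_)
    rw [Real.norm_of_nonneg (mul_nonneg (hs.r0 y) (sq_nonneg _))]
    show r y * δ y ^ 2 ≤ r y + r y * δ y ^ 3
    rw [← mul_one_add]
    refine mul_le_mul_of_nonneg_left ?_ (hs.r0 y)
    nlinarith [hδ0 y, sq_nonneg (δ y - 1), sq_nonneg (δ y)]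
  have iru := fun j => PK_integrable hK x _ (hs.iru hγ j)
  have iruu := fun i j => PK_integrable hK x _ (hs.iruu i j)
  have hR : 0 < ∫ y, r y ∂P := by
    rw [PK_int hK]; exact hc.trans_le (hs.R_ge hγ K L hK x)
  obtain ⟨c1, c2⟩ := cheb P r δ hs.r0 hδ0 i0 i1 i2 i3 hR
  set R := ∫ y, r y ∂P with hRdef
  set Z1 := ∫ y, r y * δ y ∂P
  set Z2 := ∫ y, r y * δ y ^ 2 ∂P
  set Z3 := ∫ y, r y * δ y ^ 3 ∂P
  set G := (∫ y, r y ^ γ ∂P) - R ^ γ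
  have hZ1 : 0 ≤ Z1 := integral_nonneg fun y => mul_nonneg (hs.r0 y) (hδ0 y)
  have hZ2 : 0 ≤ Z2 := integral_nonneg fun y => mul_nonneg (hs.r0 y) (sq_nonneg _)
  have hκ := kappa_pos γ hγ
  have hL := hK.L_nonneg
  have hX : 0 ≤ Z1 * R⁻¹ := mul_nonneg hZ1 (inv_nonneg.2 hR.le)
  have hw : ∀ y j, |u y j - u x j| ≤ δ y := fun y j => by
    have := norm_le_pi_norm (u y - u x) j
    simpa using this
  have term : ∀ i j, |((mol (dK i K) (fun y => r y * u y j) x * mol K r x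
      - mol K (fun y => r y * u y j) x * mol (dK i K) r x) * (mol K r x ^ 2)⁻¹)
    * (mol K (FF γ r u i j) x - mol K (fun y => r y * u y i) x * mol K (fun y => r y * u y j) x
        * (mol K r x)⁻¹ - if i = j then (k * (γ - 1)) * mol K r x ^ γ else 0)|
      ≤ 2 * L * (2 * Z3 + kappa γ * (Z1 * R⁻¹ * |G|)) := by
    intro i j
    have iw : ∀ j, Integrable (fun y => r y * (u y j - u x j)) P := fun j => by
      have := (iru j).sub (i0.const_mul (u x j))
      refine this.congr (Filter.Eventually.of_forall fun y => ?_)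
      simp only [Pi.sub_apply]; ring
    have iww : Integrable (fun y => r y * (u y i - u x i) * (u y j - u x j)) P := by
      refine i2.mono' (Measurable.aestronglyMeasurable (by fun_prop))
        (Filter.Eventually.of_forall fun y => ?_)
      rw [Real.norm_eq_abs, abs_mul, abs_mul, abs_of_nonneg (hs.r0 y), mul_assoc, sq]
      exact mul_le_mul_of_nonneg_left (mul_le_mul (hw y i) (hw y j) (abs_nonneg _) (hδ0 y)) (hs.r0 y)
    set mm : Fin d → ℝ := fun j => ∫ y, r y * (u y j - u x j) ∂P with hmm
    have hM : ∀ j, mol K (fun y => r y * u y j) x = mm j + u x j * R := by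
      intro j
      rw [← PK_int hK, ← hPdef, hmm, hRdef]
      simp only
      rw [← integral_const_mul, ← integral_add (iw j) (i0.const_mul _)]
      exact integral_congr_ae (Filter.Eventually.of_forall fun y => by simp only; ring)
    have hmmb : ∀ j, |mm j| ≤ Z1 := by
      intro j
      rw [← Real.norm_eq_abs]
      refine norm_integral_le_of_norm_le i1 (Filter.Eventually.of_forall fun y => ?_)
      rw [Real.norm_eq_abs, abs_mul, abs_of_nonneg (hs.r0 y)]
      exact mul_le_mul_of_nonneg_left (hw y j) (hs.r0 y)
    set ww := ∫ y, r y * (u y i - u x i) * (u y j - u x j) ∂P with hww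
    have hwwb : |ww| ≤ Z2 := by
      rw [← Real.norm_eq_abs]
      refine norm_integral_le_of_norm_le i2 (Filter.Eventually.of_forall fun y => ?_)
      rw [Real.norm_eq_abs, abs_mul, abs_mul, abs_of_nonneg (hs.r0 y), mul_assoc, sq]
      exact mul_le_mul_of_nonneg_left (mul_le_mul (hw y i) (hw y j) (abs_nonneg _) (hδ0 y)) (hs.r0 y)
    have hRm : mol K r x = R := (PK_int hK x r).symm
    have hFF : mol K (FF γ r u i j) x = (ww + u x i * mm j + u x j * mm i + u x i * u x j * R)
        + if i = j then kappa γ * ∫ y, r y ^ γ ∂P else 0 := by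
      rw [← PK_int hK, ← hPdef]
      have e1 : ∫ y, FF γ r u i j y ∂P = (∫ y, r y * u y i * u y j ∂P)
          + ∫ y, (if i = j then kappa γ * r y ^ γ else 0) ∂P := by
        unfold FF
        refine integral_add (iruu i j) ?_
        split_ifs
        · exact (PK_integrable hK x _ hs.ipi).const_mul _
        · exact integrable_zero _ _ _
      rw [e1]
      congr 1
      · rw [hww, hmm, hRdef]
        simp only
        have j1 := (iw j).const_mul (u x i)
        have j2 := (iw i).const_mul (u x j)
        have j3 := i0.const_mul (u x i * u x j)
        have a1 := integral_add iww j1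
        have a2 := integral_add (iww.add j1) j2
        have a3 := integral_add ((iww.add j1).add j2) j3
        simp only [Pi.add_apply] at a1 a2 a3
        rw [integral_const_mul] at a1 a2 a3
        rw [← a1, ← a2, ← a3]
        refine integral_congr_ae (Filter.Eventually.of_forall fun y => ?_)
        simp only [Pi.add_apply]; ring
      · split_ifs
        · rw [integral_const_mul]
        · simp
    have hdM : mol (dK i K) (fun y => r y * u y j) x
        = mol (dK i K) (fun y => r y * (u y j - u x j)) x + u x j * mol (dK i K) r x := by
      have hc1 := dK_cont K hK.smooth i
      have hp1 := dK_per K hK.per i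
      have iw' : Integrable (fun y => r y * (u y j - u x j)) (cubeVol d) := by
        refine ((hs.iru hγ j).sub ((hs.ir hγ).const_mul (u x j))).congr
          (Filter.Eventually.of_forall fun y => ?_)
        simp only [Pi.sub_apply]; ring
      unfold mol
      rw [← integral_const_mul, ← integral_add (mol_integrable _ _ hc1 hp1 iw' x)
        ((mol_integrable _ _ hc1 hp1 (hs.ir hγ) x).const_mul _)]
      exact integral_congr_ae (Filter.Eventually.of_forall fun y => by simp only; ring)
    have b1 := dmol_bound hK x (fun y => r y * (u y j - u x j)) (fun y => r y * δ y) i1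
      (fun y => by
        rw [abs_mul, abs_of_nonneg (hs.r0 y)]
        exact mul_le_mul_of_nonneg_left (hw y j) (hs.r0 y)) i
    have b2 := dmol_bound hK x r r i0 (fun y => (abs_of_nonneg (hs.r0 y)).le) i
    set S1 := mol (dK i K) (fun y => r y * (u y j - u x j)) x
    set S0 := mol (dK i K) r x
    have eA : (mol (dK i K) (fun y => r y * u y j) x * mol K r x
      - mol K (fun y => r y * u y j) x * S0) * (mol K r x ^ 2)⁻¹
        = (S1 * R - mm j * S0) * (R ^ 2)⁻¹ := by
      rw [hdM, hM, hRm]; ring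
    have bA : |(S1 * R - mm j * S0) * (R ^ 2)⁻¹| ≤ 2 * L * (Z1 * R⁻¹) := by
      rw [abs_mul, abs_of_nonneg (by positivity : 0 ≤ (R ^ 2)⁻¹)]
      have : |S1 * R - mm j * S0| ≤ 2 * L * Z1 * R := by
        refine (abs_sub _ _).trans ?_
        rw [abs_mul, abs_mul, abs_of_pos hR]
        have h1 : |S1| * R ≤ L * Z1 * R := mul_le_mul_of_nonneg_right b1 hR.le
        have h2 : |mm j| * |S0| ≤ Z1 * (L * R) := mul_le_mul (hmmb j) b2 (abs_nonneg _) hZ1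
        linarith
      calc _ ≤ 2 * L * Z1 * R * (R ^ 2)⁻¹ := by gcongr
        _ = _ := by field_simp
    have eC : mol K (FF γ r u i j) x - mol K (fun y => r y * u y i) x * mol K (fun y => r y * u y j) x
        * (mol K r x)⁻¹ - (if i = j then (k * (γ - 1)) * mol K r x ^ γ else 0)
        = ww - mm i * mm j * R⁻¹ + if i = j then kappa γ * G else 0 := by
      rw [hFF, hM, hM, hRm, hk]
      split_ifs
      · simp only [G]; field_simp; ring
      · field_simp; ring
    have bC : |ww - mm i * mm j * R⁻¹ + if i = j then kappa γ * G else 0| ≤ 2 * Z2 + kappa γ * |G| := by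
      have h1 : |mm i * mm j * R⁻¹| ≤ Z2 := by
        rw [abs_mul, abs_mul, abs_of_nonneg (inv_nonneg.2 hR.le)]
        refine le_trans ?_ c2
        rw [sq]
        exact mul_le_mul_of_nonneg_right (mul_le_mul (hmmb i) (hmmb j) (abs_nonneg _) hZ1)
          (inv_nonneg.2 hR.le)
      have h2 : |if i = j then kappa γ * G else 0| ≤ kappa γ * |G| := by
        split_ifs
        · rw [abs_mul, abs_of_pos hκ]
        · simp only [abs_zero]; positivity
      refine (abs_add_le _ _).trans (add_le_add ((abs_sub _ _).trans ?_) h2)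
      linarith
    rw [eA, eC, abs_mul]
    calc _ ≤ 2 * L * (Z1 * R⁻¹) * (2 * Z2 + kappa γ * |G|) :=
          mul_le_mul bA bC (abs_nonneg _) (by positivity)
      _ = 2 * L * (2 * (Z1 * R⁻¹ * Z2) + kappa γ * (Z1 * R⁻¹ * |G|)) := by ring
      _ ≤ _ := by gcongr
  unfold Sden
  calc _ ≤ ∑ i : Fin d, ∑ j : Fin d, 2 * L * (2 * Z3 + kappa γ * (Z1 * R⁻¹ * |G|)) := by
        refine (Finset.abs_sum_le_sum_abs _ _).trans (Finset.sum_le_sum fun i _ => ?_)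
        refine (Finset.abs_sum_le_sum_abs _ _).trans (Finset.sum_le_sum fun j _ => ?_)
        exact term i j
    _ = _ := by simp; ring

end

/-- The probability measure `K(x-y)dxdy`. -/
def QK (K : (Fin d → ℝ) → ℝ) : Measure ((Fin d → ℝ) × (Fin d → ℝ)) :=
  ((cubeVol d).prod (cubeVol d)).withDensity fun z => ENNReal.ofReal (K (z.1 - z.2))

section
variable {K : (Fin d → ℝ) → ℝ} {L : ℝ} (hK : IsKer K L)

include hK in
lemma QK_lint (F : (Fin d → ℝ) × (Fin d → ℝ) → ℝ≥0∞) (hF : Measurable F) :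
    ∫⁻ z, F z ∂QK K = ∫⁻ x, ∫⁻ y, F (x, y) ∂PK K x ∂cubeVol d := by
  have hKm : Measurable fun z : (Fin d → ℝ) × (Fin d → ℝ) => ENNReal.ofReal (K (z.1 - z.2)) := by
    have := hK.smooth.continuous
    fun_prop
  unfold QK
  rw [lintegral_withDensity_eq_lintegral_mul _ hKm hF, lintegral_prod _ (hKm.mul hF).aemeasurable]
  refine lintegral_congr fun x => ?_
  rw [PK_lint hK x (fun y => F (x, y)) (hF.comp measurable_prodMk_left)]
  rfl

include hK in
lemma QK_meas (F : (Fin d → ℝ) × (Fin d → ℝ) → ℝ≥0∞) (hF : Measurable F) :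
    Measurable fun x => ∫⁻ y, F (x, y) ∂PK K x := by
  have hKm : Measurable fun z : (Fin d → ℝ) × (Fin d → ℝ) => ENNReal.ofReal (K (z.1 - z.2)) := by
    have := hK.smooth.continuous
    fun_prop
  have : (fun x => ∫⁻ y, F (x, y) ∂PK K x)
      = fun x => ∫⁻ y, ENNReal.ofReal (K (x - y)) * F (x, y) ∂cubeVol d := by
    funext x
    rw [PK_lint hK x (fun y => F (x, y)) (hF.comp measurable_prodMk_left)]
  rw [this]
  exact (hKm.mul hF).lintegral_prod_right'

include hK in
lemma QK_prob : IsProbabilityMeasure (QK K) := by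
  constructor
  have := QK_lint hK (fun _ => 1) measurable_const
  rw [lintegral_one] at this
  rw [this]
  have h : ∀ x, ∫⁻ y, (1 : ℝ≥0∞) ∂PK K x = 1 := fun x => by
    have := PK_prob hK x
    simp
  simp [h]

include hK in
lemma QK_snd (f : (Fin d → ℝ) → ℝ≥0∞) (hf : Measurable f) :
    ∫⁻ z, f z.2 ∂QK K = ∫⁻ y, f y ∂cubeVol d := by
  have hKm : Measurable fun z : (Fin d → ℝ) × (Fin d → ℝ) => ENNReal.ofReal (K (z.1 - z.2)) := by
    have := hK.smooth.continuous
    fun_prop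
  unfold QK
  have hF : Measurable fun z : (Fin d → ℝ) × (Fin d → ℝ) => f z.2 := hf.comp measurable_snd
  rw [lintegral_withDensity_eq_lintegral_mul _ hKm hF,
    lintegral_prod_symm _ (hKm.mul hF).aemeasurable]
  refine lintegral_congr fun y => ?_
  simp only [Pi.mul_apply]
  rw [lintegral_mul_const _ (by have := hK.smooth.continuous; fun_prop), ker_mass' K L hK y, one_mul]

include hK in
lemma nn_QK_snd (s : ℝ) (f : (Fin d → ℝ) → ℝ≥0∞) (hf : Measurable f) :
    nn (QK K) s (fun z => f z.2) = nn (cubeVol d) s f := by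
  unfold nn
  rw [QK_snd hK (fun y => f y ^ s) (hf.pow_const s)]

include hK in
lemma nn_QK_iter (s : ℝ) (hs : 0 < s) (F : (Fin d → ℝ) × (Fin d → ℝ) → ℝ≥0∞) (hF : Measurable F) :
    nn (cubeVol d) s (fun x => nn (PK K x) s fun y => F (x, y)) = nn (QK K) s F := by
  unfold nn
  rw [QK_lint hK _ (hF.pow_const s)]
  congr 1
  refine lintegral_congr fun x => ?_
  rw [← ENNReal.rpow_mul, one_div, inv_mul_cancel₀ hs.ne', ENNReal.rpow_one]

include hK in
lemma nn_PK_meas (s : ℝ) (F : (Fin d → ℝ) × (Fin d → ℝ) → ℝ≥0∞) (hF : Measurable F) :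
    Measurable fun x => nn (PK K x) s fun y => F (x, y) := by
  unfold nn
  exact (QK_meas hK _ (hF.pow_const s)).pow_const _

include hK in
lemma int_mol (f : (Fin d → ℝ) → ℝ) (hf : Integrable f (cubeVol d)) (hfm : Measurable f) :
    ∫ x, mol K f x ∂cubeVol d = ∫ y, f y ∂cubeVol d := by
  unfold mol
  have hKc := hK.smooth.continuous
  obtain ⟨B, hB⟩ := hK.bdd
  have hi : Integrable (Function.uncurry fun x y => K (x - y) * f y)
      ((cubeVol d).prod (cubeVol d)) := by
    have : Integrable (fun z : (Fin d → ℝ) × (Fin d → ℝ) => B * f z.2)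
        ((cubeVol d).prod (cubeVol d)) := (hf.comp_snd _).const_mul B
    refine this.mono (Measurable.aestronglyMeasurable (by
      unfold Function.uncurry; fun_prop)) (Filter.Eventually.of_forall fun z => ?_)
    simp only [Function.uncurry, norm_mul, Real.norm_eq_abs, abs_of_pos (hK.pos _)]
    exact mul_le_mul_of_nonneg_right ((hB _).trans (le_abs_self _)) (abs_nonneg _)
  rw [integral_integral_swap hi]
  refine integral_congr_ae (Filter.Eventually.of_forall fun y => ?_)
  simp only
  rw [integral_mul_const]
  have : ∫ x, K (x - y) ∂cubeVol d = 1 := by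
    rw [← ker_int_one K L hK y]
    refine integral_congr_ae (Filter.Eventually.of_forall fun x => ?_)
    simp only
    rw [← hK.even (y - x), neg_sub]
  rw [this, one_mul]

variable {γ c q s m : ℝ} {r : (Fin d → ℝ) → ℝ} {u : (Fin d → ℝ) → Fin d → ℝ}

/-- velocity increment -/
def dU (u : (Fin d → ℝ) → Fin d → ℝ) (z : (Fin d → ℝ) × (Fin d → ℝ)) : ℝ≥0∞ :=
  ENNReal.ofReal ‖u z.2 - u z.1‖

/-- density increment -/
def dR (r : (Fin d → ℝ) → ℝ) (z : (Fin d → ℝ) × (Fin d → ℝ)) : ℝ≥0∞ :=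
  ENNReal.ofReal |r z.2 - r z.1|

lemma dU_meas (hu : Measurable u) : Measurable (dU u) := by
  unfold dU; fun_prop

lemma dR_meas (hr : Measurable r) : Measurable (dR r) := by
  unfold dR
  have : Measurable fun z : (Fin d → ℝ) × (Fin d → ℝ) => |r z.2 - r z.1| := by fun_prop
  fun_prop

include hK in
lemma rdelta (he : Exps γ q s m) (hr : Measurable r) (hu : Measurable u) (n : ℕ) (hn : n ≤ 3) :
    ∫⁻ z, ENNReal.ofReal (r z.2) * dU u z ^ n ∂QK K
      ≤ nn (cubeVol d) s (fun y => ENNReal.ofReal (r y)) * nn (QK K) q (dU u) ^ n := by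
  have := QK_prob hK
  have hm : Measurable fun z : (Fin d → ℝ) × (Fin d → ℝ) => ENNReal.ofReal (r z.2) := by fun_prop
  have h := hol2p (QK K) (fun z => ENNReal.ofReal (r z.2)) (dU u) hm.aemeasurable
    (dU_meas hu).aemeasurable 1 n s q zero_le_one (by positivity) (by linarith [he.r1])
    (by linarith [he.q3]) (by
      rw [he.rq]
      have : (n : ℝ) / q ≤ 3 / q := by
        have := he.q3
        gcongr
        exact_mod_cast hn
      linarith)
  simp only [ENNReal.rpow_one, ENNReal.rpow_natCast] at h
  rwa [nn_QK_snd hK s (fun y => ENNReal.ofReal (r y)) (by fun_prop)] at h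

lemma lint_eq (P : Measure (Fin d → ℝ)) (hs : Slice γ c r u) (x : Fin d → ℝ) (n : ℕ)
    (h : ∫⁻ y, ENNReal.ofReal (r y) * dU u (x, y) ^ n ∂P ≠ ∞) :
    Integrable (fun y => r y * ‖u y - u x‖ ^ n) P ∧
    ENNReal.ofReal (∫ y, r y * ‖u y - u x‖ ^ n ∂P)
      = ∫⁻ y, ENNReal.ofReal (r y) * dU u (x, y) ^ n ∂P := by
  have hrm := hs.rm
  have hum := hs.um
  have e : ∀ y, ENNReal.ofReal (r y) * dU u (x, y) ^ n = ENNReal.ofReal (r y * ‖u y - u x‖ ^ n) := by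
    intro y
    rw [ENNReal.ofReal_mul (hs.r0 y), ENNReal.ofReal_pow (norm_nonneg _)]
    rfl
  have nn0 : ∀ y, 0 ≤ r y * ‖u y - u x‖ ^ n := fun y => mul_nonneg (hs.r0 y) (by positivity)
  simp only [e] at h ⊢
  have hm : AEStronglyMeasurable (fun y => r y * ‖u y - u x‖ ^ n) P :=
    Measurable.aestronglyMeasurable (by fun_prop)
  have hi : Integrable (fun y => r y * ‖u y - u x‖ ^ n) P :=
    (lintegral_ofReal_ne_top_iff_integrable hm (Filter.Eventually.of_forall nn0)).1 h
  exact ⟨hi, ofReal_integral_eq_lintegral_ofReal hi (Filter.Eventually.of_forall nn0)⟩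

include hK in
lemma rdelta_ae (he : Exps γ q s m) (hs : Slice γ c r u) (n : ℕ) (hn : n ≤ 3)
    (hN : nn (cubeVol d) s (fun y => ENNReal.ofReal (r y)) ≠ ∞) (hV : nn (QK K) q (dU u) ≠ ∞) :
    ∀ᵐ x ∂cubeVol d, ∫⁻ y, ENNReal.ofReal (r y) * dU u (x, y) ^ n ∂PK K x ≠ ∞ := by
  have hrm := hs.rm
  have hm : Measurable fun z => ENNReal.ofReal (r z.2) * dU u z ^ n :=
    Measurable.mul (by fun_prop) ((dU_meas hs.um).pow_const n)
  have h := rdelta hK he hs.rm hs.um n hn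
  rw [QK_lint hK _ hm] at h
  have h2 := h.trans_lt (ENNReal.mul_lt_top hN.lt_top (ENNReal.pow_lt_top hV.lt_top))
  filter_upwards [ae_lt_top (QK_meas hK _ hm) h2.ne] with x hx using hx.ne

include hK in
/-- Slice estimate of the commutator -/
lemma slice1 (he : Exps γ q s m) (hc : 0 < c) (hs : Slice γ c r u) (k : ℝ)
    (hk : k * (γ - 1) = kappa γ)
    (hN : nn (cubeVol d) s (fun y => ENNReal.ofReal (r y)) ≠ ∞) (hV : nn (QK K) q (dU u) ≠ ∞) :
    ENNReal.ofReal |∫ x, Sden k γ K r u x ∂cubeVol d| ≤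
      ENNReal.ofReal ((d:ℝ)^2 * (2 * L)) * (2 * (nn (cubeVol d) s (fun y => ENNReal.ofReal (r y))
          * nn (QK K) q (dU u) ^ 3)
        + ENNReal.ofReal (kappa γ) * (ENNReal.ofReal (4 * γ) * (2 *
          (nn (cubeVol d) m (fun y => ENNReal.ofReal (r y)) ^ (γ - 1)
            * nn (QK K) s (dR r) * nn (QK K) q (dU u))))) := by
  have hrm := hs.rm
  have hum := hs.um
  have hκ := kappa_pos γ he.g
  have hg := he.g
  have hq := he.q3
  have hs1 := he.r1
  have hm1 := he.m1
  have hUm := dU_meas hs.um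
  have hRm := dR_meas hs.rm
  set W : (Fin d → ℝ) → ℝ≥0∞ := fun x => nn (PK K x) m fun y => ENNReal.ofReal (r y) with hW
  set D : (Fin d → ℝ) → ℝ≥0∞ := fun x => nn (PK K x) s fun y => dR r (x, y) with hD
  set V : (Fin d → ℝ) → ℝ≥0∞ := fun x => nn (PK K x) q fun y => dU u (x, y) with hVd
  have hrm2 : Measurable fun z : (Fin d → ℝ) × (Fin d → ℝ) => ENNReal.ofReal (r z.2) := by fun_prop
  have hWm : Measurable W := nn_PK_meas hK m (fun z => ENNReal.ofReal (r z.2)) hrm2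
  have hDm : Measurable D := nn_PK_meas hK s (dR r) hRm
  have hVm : Measurable V := nn_PK_meas hK q (dU u) hUm
  have hzm : Measurable fun z => ENNReal.ofReal (r z.2) * dU u z ^ 3 :=
    hrm2.mul (hUm.pow_const 3)
  have pt : ∀ᵐ x ∂cubeVol d, ENNReal.ofReal |Sden k γ K r u x| ≤
      ENNReal.ofReal ((d:ℝ)^2 * (2 * L)) * (2 * (∫⁻ y, ENNReal.ofReal (r y) * dU u (x, y) ^ 3 ∂PK K x)
        + ENNReal.ofReal (kappa γ) * (ENNReal.ofReal (4 * γ) * (2 *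
          (W x ^ (γ - 1) * D x ^ (1:ℝ) * V x ^ (1:ℝ))))) := by
    filter_upwards [rdelta_ae hK he hs 3 le_rfl hN hV, rdelta_ae hK he hs 1 (by norm_num) hN hV]
      with x h3 h1
    have hP := PK_prob hK x
    obtain ⟨i3, e3⟩ := lint_eq (PK K x) hs x 3 h3
    obtain ⟨i1, e1⟩ := lint_eq (PK K x) hs x 1 h1
    simp only [pow_one] at i1 e1
    have i0 : Integrable r (PK K x) := PK_integrable hK x r (hs.ir he.g)
    have ig : Integrable (fun y => r y ^ γ) (PK K x) := PK_integrable hK x _ hs.ipi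
    have hR : 0 < ∫ y, r y ∂PK K x := by
      rw [PK_int hK]; exact hc.trans_le (hs.R_ge he.g K L hK x)
    have hS := Sden_pt hK x he.g hc hs k hk i3
    have hXG := XG he (PK K x) r hrm hs.r0 i0 ig (fun y => dU u (x, y))
      (hUm.comp measurable_prodMk_left)
    have hDc := D_change (PK K x) s hs1 r hrm i0 (r x)
    rw [← e1] at hXG
    set Z3 := ∫ y, r y * ‖u y - u x‖ ^ 3 ∂PK K x
    set Z1 := ∫ y, r y * ‖u y - u x‖ ∂PK K x
    set R := ∫ y, r y ∂PK K x
    set G := (∫ y, r y ^ γ ∂PK K x) - R ^ γ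
    have hZ1 : 0 ≤ Z1 := integral_nonneg fun y => mul_nonneg (hs.r0 y) (norm_nonneg _)
    have hZ3 : 0 ≤ Z3 := integral_nonneg fun y => mul_nonneg (hs.r0 y) (by positivity)
    have hL := hK.L_nonneg
    have hfin : ENNReal.ofReal (Z1 * R⁻¹ * |G|) ≤ ENNReal.ofReal (4 * γ) * (2 *
          (W x ^ (γ - 1) * D x ^ (1:ℝ) * V x ^ (1:ℝ))) := by
      rw [ENNReal.rpow_one, ENNReal.rpow_one]
      calc ENNReal.ofReal (Z1 * R⁻¹ * |G|)
          = (ENNReal.ofReal R)⁻¹ * (ENNReal.ofReal Z1 * ENNReal.ofReal |G|) := by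
            rw [← ENNReal.ofReal_inv_of_pos hR, ← ENNReal.ofReal_mul hZ1,
              ← ENNReal.ofReal_mul (inv_nonneg.2 hR.le)]
            congr 1; ring
        _ ≤ (ENNReal.ofReal R)⁻¹ * (ENNReal.ofReal (4 * γ) * ENNReal.ofReal R
            * (W x ^ (γ - 1) * (2 * D x) * V x)) := by
            refine mul_le_mul_right (hXG.trans ?_) _
            gcongr
            exact hDc
        _ = ((ENNReal.ofReal R)⁻¹ * ENNReal.ofReal R) * (ENNReal.ofReal (4 * γ) * (2 *
          (W x ^ (γ - 1) * D x * V x))) := by ring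
        _ = _ := by
          rw [ENNReal.inv_mul_cancel (by simpa using hR) ENNReal.ofReal_ne_top, one_mul]
    calc ENNReal.ofReal |Sden k γ K r u x|
        ≤ ENNReal.ofReal ((d:ℝ)^2 * (2 * L) * (2 * Z3 + kappa γ * (Z1 * R⁻¹ * |G|))) := by
          refine ENNReal.ofReal_le_ofReal (hS.trans (le_of_eq (by ring)))
      _ = ENNReal.ofReal ((d:ℝ)^2 * (2 * L)) * (2 * ENNReal.ofReal Z3
          + ENNReal.ofReal (kappa γ) * ENNReal.ofReal (Z1 * R⁻¹ * |G|)) := by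
          have : 0 ≤ Z1 * R⁻¹ * |G| := by positivity
          rw [ENNReal.ofReal_mul (by positivity), ENNReal.ofReal_add (by positivity) (by positivity),
            ENNReal.ofReal_mul (by norm_num : (0:ℝ) ≤ 2), ENNReal.ofReal_mul hκ.le]
          norm_num
      _ ≤ _ := by
          rw [e3]; gcongr
  calc ENNReal.ofReal |∫ x, Sden k γ K r u x ∂cubeVol d|
      ≤ ∫⁻ x, ENNReal.ofReal |Sden k γ K r u x| ∂cubeVol d := by
        have := enorm_integral_le_lintegral_enorm (μ := cubeVol d) (fun x => Sden k γ K r u x)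
        simpa only [Real.enorm_eq_ofReal_abs] using this
    _ ≤ _ := lintegral_mono_ae pt
    _ = ENNReal.ofReal ((d:ℝ)^2 * (2 * L)) * (2 * (∫⁻ x, ∫⁻ y, ENNReal.ofReal (r y) * dU u (x, y) ^ 3 ∂PK K x ∂cubeVol d)
        + ENNReal.ofReal (kappa γ) * (ENNReal.ofReal (4 * γ) * (2 *
          ∫⁻ x, (W x ^ (γ - 1) * D x ^ (1:ℝ) * V x ^ (1:ℝ)) ∂cubeVol d))) := by
        have hzm' := QK_meas hK _ hzm
        have hp : Measurable fun x => W x ^ (γ - 1) * D x ^ (1:ℝ) * V x ^ (1:ℝ) := by fun_prop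
        rw [lintegral_const_mul' _ _ ENNReal.ofReal_ne_top,
          lintegral_add_left (hzm'.const_mul 2), lintegral_const_mul' _ _ (by norm_num),
          lintegral_const_mul' _ _ ENNReal.ofReal_ne_top, lintegral_const_mul' _ _ ENNReal.ofReal_ne_top,
          lintegral_const_mul' _ _ (by norm_num)]
    _ ≤ _ := by
        have h1 := rdelta hK he hs.rm hs.um 3 le_rfl
        rw [QK_lint hK _ hzm] at h1
        have h2 := hol3p (cubeVol d) W D V hWm.aemeasurable hDm.aemeasurable hVm.aemeasurable
          (γ - 1) 1 1 m s q (by linarith) zero_le_one zero_le_one (by linarith) (by linarith)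
          (by linarith) (by
            have := he.mq
            have e := he.rq
            have : (3:ℝ) / q = 2 / q + 1 / q := by ring
            linarith)
        rw [hW, nn_QK_iter hK m (by linarith) (fun z => ENNReal.ofReal (r z.2)) hrm2,
          nn_QK_snd hK m (fun y => ENNReal.ofReal (r y)) (by fun_prop),
          hD, nn_QK_iter hK s (by linarith) _ hRm, hVd, nn_QK_iter hK q (by linarith) _ hUm] at h2
        simp only [ENNReal.rpow_one] at h2
        simp only [ENNReal.rpow_one, hW, hD, hVd]
        gcongr
end

section
variable {K : (Fin d → ℝ) → ℝ} {L : ℝ} (hK : IsKer K L)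
variable {γ c q s m : ℝ} {r : (Fin d → ℝ) → ℝ} {u : (Fin d → ℝ) → Fin d → ℝ}

include hK in
lemma Eden_pt (x : Fin d → ℝ) (hγ : 1 < γ) (hc : 0 < c) (hs : Slice γ c r u) (k : ℝ) (hk : 0 ≤ k)
    (i2 : Integrable (fun y => r y * ‖u y - u x‖ ^ 2) (PK K x)) :
    |Eden k γ K r u x - (1 / 2 * (∑ j, mol K (fun y => r y * u y j * u y j) x)
        + k * mol K (fun y => r y ^ γ) x)|
      ≤ d * (∫ y, r y * ‖u y - u x‖ ^ 2 ∂PK K x)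
        + k * |(∫ y, r y ^ γ ∂PK K x) - (∫ y, r y ∂PK K x) ^ γ| := by
  have hP := PK_prob hK x
  set P := PK K x with hPdef
  set δ : (Fin d → ℝ) → ℝ := fun y => ‖u y - u x‖ with hδ
  have hδ0 : ∀ y, 0 ≤ δ y := fun y => norm_nonneg _
  have hrm := hs.rm
  have hum := hs.um
  have hδm : Measurable δ := (hum.sub_const _).norm
  have i0 : Integrable r P := PK_integrable hK x r (hs.ir hγ)
  have iru := fun j => PK_integrable hK x _ (hs.iru hγ j)
  have iruu := fun i j => PK_integrable hK x _ (hs.iruu i j)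
  have hR : 0 < ∫ y, r y ∂P := by
    rw [PK_int hK]; exact hc.trans_le (hs.R_ge hγ K L hK x)
  have hRm : mol K r x = ∫ y, r y ∂P := (PK_int hK x r).symm
  have hGm : mol K (fun y => r y ^ γ) x = ∫ y, r y ^ γ ∂P := (PK_int hK x _).symm
  set R := ∫ y, r y ∂P with hRdef
  set Z2 := ∫ y, r y * δ y ^ 2 ∂P
  set G := (∫ y, r y ^ γ ∂P) - R ^ γ with hG
  have hw : ∀ y j, |u y j - u x j| ≤ δ y := fun y j => by
    have := norm_le_pi_norm (u y - u x) j
    simpa using this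
  have term : ∀ j, |mol K (fun y => r y * u y j) x ^ 2 * R⁻¹ - mol K (fun y => r y * u y j * u y j) x|
      ≤ Z2 := by
    intro j
    have ea : ∀ a : ℝ, ∫ y, r y * (u y j - a) ^ 2 ∂P = mol K (fun y => r y * u y j * u y j) x
        - 2 * a * mol K (fun y => r y * u y j) x + a ^ 2 * R := by
      intro a
      rw [← PK_int hK, ← PK_int hK, ← hPdef, hRdef, ← integral_const_mul, ← integral_const_mul,
        ← integral_sub (iruu j j) ((iru j).const_mul _)]
      have := integral_add ((iruu j j).sub ((iru j).const_mul (2 * a))) (i0.const_mul (a ^ 2))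
      simp only [Pi.sub_apply] at this
      rw [← this]
      exact integral_congr_ae (Filter.Eventually.of_forall fun y => by simp only; ring)
    set M := mol K (fun y => r y * u y j) x
    set A := mol K (fun y => r y * u y j * u y j) x
    have h0 : 0 ≤ ∫ y, r y * (u y j - M * R⁻¹) ^ 2 ∂P :=
      integral_nonneg fun y => mul_nonneg (hs.r0 y) (sq_nonneg _)
    have h1 : ∫ y, r y * (u y j - u x j) ^ 2 ∂P ≤ Z2 := by
      refine integral_mono_of_nonneg (Filter.Eventually.of_forall fun y =>
        mul_nonneg (hs.r0 y) (sq_nonneg _)) i2 (Filter.Eventually.of_forall fun y => ?_)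
      refine mul_le_mul_of_nonneg_left ?_ (hs.r0 y)
      rw [← sq_abs]
      exact pow_le_pow_left₀ (abs_nonneg _) (hw y j) 2
    rw [ea] at h0 h1
    have e2 : A - 2 * (M * R⁻¹) * M + (M * R⁻¹) ^ 2 * R = A - M ^ 2 * R⁻¹ := by
      field_simp; ring
    rw [e2] at h0
    have h3 : A - M ^ 2 * R⁻¹ ≤ A - 2 * u x j * M + u x j ^ 2 * R := by
      have : 0 ≤ (u x j * R - M) ^ 2 * R⁻¹ := by positivity
      have e : (u x j * R - M) ^ 2 * R⁻¹ = u x j ^ 2 * R - 2 * u x j * M + M ^ 2 * R⁻¹ := by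
        field_simp; ring
      linarith
    rw [abs_sub_comm, abs_of_nonneg h0]
    linarith
  unfold Eden
  rw [hRm, hGm]
  have e : 1 / 2 * ((∑ j, mol K (fun y => r y * u y j) x ^ 2) * R⁻¹) + k * R ^ γ
      - (1 / 2 * (∑ j, mol K (fun y => r y * u y j * u y j) x) + k * ∫ y, r y ^ γ ∂P)
      = 1 / 2 * (∑ j, (mol K (fun y => r y * u y j) x ^ 2 * R⁻¹
          - mol K (fun y => r y * u y j * u y j) x)) - k * G := by
    rw [Finset.sum_sub_distrib, Finset.sum_mul, hG]; ring
  rw [e]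
  refine (abs_sub _ _).trans ?_
  rw [abs_mul, abs_mul, abs_of_nonneg hk]
  have hsum : |∑ j, (mol K (fun y => r y * u y j) x ^ 2 * R⁻¹
          - mol K (fun y => r y * u y j * u y j) x)| ≤ d * Z2 := by
    refine (Finset.abs_sum_le_sum_abs _ _).trans ((Finset.sum_le_sum fun j _ => term j).trans ?_)
    simp
  have h12 : |(1 / 2 : ℝ)| = 1 / 2 := by norm_num
  rw [h12]
  have : 0 ≤ |∑ j, (mol K (fun y => r y * u y j) x ^ 2 * R⁻¹
          - mol K (fun y => r y * u y j * u y j) x)| := abs_nonneg _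
  linarith

include hK in
lemma Eden_int (hγ : 1 < γ) (hc : 0 < c) (hs : Slice γ c r u) (k : ℝ) :
    Integrable (Eden k γ K r u) (cubeVol d) := by
  have hKc := hK.smooth.continuous
  have c0 : Continuous (mol K r) := mol_cont K r hKc hK.per (hs.ir hγ)
  have cj : ∀ j, Continuous (mol K fun y => r y * u y j) := fun j =>
    mol_cont K _ hKc hK.per (hs.iru hγ j)
  have hne : ∀ x, mol K r x ≠ 0 := fun x => (hc.trans_le (hs.R_ge hγ K L hK x)).ne'
  refine pci _ ?_ ?_
  · unfold Eden
    refine Continuous.add (continuous_const.mul ((continuous_finsetSum _ fun j _ => (cj j).pow 2).mul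
      (c0.inv₀ hne))) (continuous_const.mul (c0.rpow_const fun x => Or.inl (hne x)))
  · intro x n
    unfold Eden
    simp only [mol_per K _ hK.per x n]

include hK in
/-- Slice estimate of the energy error -/
lemma slice2 (he : Exps γ q s m) (hc : 0 < c) (hs : Slice γ c r u) (k : ℝ) (hk : 0 ≤ k)
    (hN : nn (cubeVol d) s (fun y => ENNReal.ofReal (r y)) ≠ ∞) (hV : nn (QK K) q (dU u) ≠ ∞) :
    ENNReal.ofReal |(∫ x, Eden k γ K r u x ∂cubeVol d)
        - ∫ x, ((1 / 2 : ℝ) * r x * euNorm (u x) ^ 2 + k * r x ^ γ) ∂cubeVol d| ≤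
      ENNReal.ofReal d * (nn (cubeVol d) s (fun y => ENNReal.ofReal (r y))
          * nn (QK K) q (dU u) ^ 2)
        + ENNReal.ofReal k * (ENNReal.ofReal γ * (4 *
          (nn (cubeVol d) m (fun y => ENNReal.ofReal (r y)) ^ (γ - 1)
            * nn (QK K) s (dR r)))) := by
  have hrm := hs.rm
  have hum := hs.um
  have hg := he.g
  have hq := he.q3
  have hs1 := he.r1
  have hm1 := he.m1
  have hUm := dU_meas hs.um
  have hRm := dR_meas hs.rm
  have hKc := hK.smooth.continuous
  set W : (Fin d → ℝ) → ℝ≥0∞ := fun x => nn (PK K x) m fun y => ENNReal.ofReal (r y) with hW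
  set D : (Fin d → ℝ) → ℝ≥0∞ := fun x => nn (PK K x) s fun y => dR r (x, y) with hD
  have hrm2 : Measurable fun z : (Fin d → ℝ) × (Fin d → ℝ) => ENNReal.ofReal (r z.2) := by fun_prop
  have hWm : Measurable W := nn_PK_meas hK m (fun z => ENNReal.ofReal (r z.2)) hrm2
  have hDm : Measurable D := nn_PK_meas hK s (dR r) hRm
  have hzm : Measurable fun z => ENNReal.ofReal (r z.2) * dU u z ^ 2 :=
    hrm2.mul (hUm.pow_const 2)
  set H : (Fin d → ℝ) → ℝ := fun x => 1 / 2 * (∑ j, mol K (fun y => r y * u y j * u y j) x)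
        + k * mol K (fun y => r y ^ γ) x with hH
  have im : ∀ f : (Fin d → ℝ) → ℝ, Integrable f (cubeVol d) → Integrable (mol K f) (cubeVol d) :=
    fun f hf => pci _ (mol_cont K f hKc hK.per hf) (mol_per K f hK.per)
  have iH : Integrable H (cubeVol d) :=
    ((integrable_finsetSum _ fun j _ => im _ (hs.iruu j j)).const_mul _).add ((im _ hs.ipi).const_mul _)
  have eH : ∫ x, ((1 / 2 : ℝ) * r x * euNorm (u x) ^ 2 + k * r x ^ γ) ∂cubeVol d
      = ∫ x, H x ∂cubeVol d := by
    rw [hH, integral_add ((integrable_finsetSum _ fun j _ => im _ (hs.iruu j j)).const_mul _)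
      ((im _ hs.ipi).const_mul _), integral_const_mul, integral_const_mul,
      integral_finsetSum _ fun j _ => im _ (hs.iruu j j), int_mol hK _ hs.ipi (by fun_prop)]
    have : ∀ j, ∫ x, mol K (fun y => r y * u y j * u y j) x ∂cubeVol d
        = ∫ x, r x * u x j * u x j ∂cubeVol d := fun j => int_mol hK _ (hs.iruu j j) (by fun_prop)
    simp only [this]
    rw [← integral_finsetSum _ fun j _ => hs.iruu j j, ← integral_const_mul, ← integral_const_mul,
      ← integral_add ((integrable_finsetSum _ fun j _ => hs.iruu j j).const_mul _)
        (hs.ipi.const_mul _)]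
    refine integral_congr_ae (Filter.Eventually.of_forall fun x => ?_)
    simp only
    rw [euNorm_sq, mul_assoc, Finset.mul_sum]
    congr 2
    exact Finset.sum_congr rfl fun j _ => by ring
  rw [eH, ← integral_sub (Eden_int hK he.g hc hs k) iH]
  have pt : ∀ᵐ x ∂cubeVol d, ENNReal.ofReal |Eden k γ K r u x - H x| ≤
      ENNReal.ofReal d * (∫⁻ y, ENNReal.ofReal (r y) * dU u (x, y) ^ 2 ∂PK K x)
        + ENNReal.ofReal k * (ENNReal.ofReal γ * (4 * (W x ^ (γ - 1) * D x ^ (1:ℝ)))) := by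
    filter_upwards [rdelta_ae hK he hs 2 (by norm_num) hN hV] with x h2
    have hP := PK_prob hK x
    obtain ⟨i2, e2⟩ := lint_eq (PK K x) hs x 2 h2
    have i0 : Integrable r (PK K x) := PK_integrable hK x r (hs.ir he.g)
    have ig : Integrable (fun y => r y ^ γ) (PK K x) := PK_integrable hK x _ hs.ipi
    have hS := Eden_pt hK x he.g hc hs k hk i2
    have hG := gap1 he (PK K x) r hrm hs.r0 i0 ig
    have hDc := D_change (PK K x) s hs1 r hrm i0 (r x)
    set Z2 := ∫ y, r y * ‖u y - u x‖ ^ 2 ∂PK K x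
    have hZ2 : 0 ≤ Z2 := integral_nonneg fun y => mul_nonneg (hs.r0 y) (by positivity)
    set G := (∫ y, r y ^ γ ∂PK K x) - (∫ y, r y ∂PK K x) ^ γ
    refine (ENNReal.ofReal_le_ofReal hS).trans ?_
    rw [ENNReal.ofReal_add (by positivity) (by positivity), ENNReal.ofReal_mul (by positivity),
      ENNReal.ofReal_mul hk, e2]
    refine add_le_add le_rfl (mul_le_mul_right (hG.trans ?_) _)
    rw [ENNReal.rpow_one]
    calc _ ≤ ENNReal.ofReal γ * (2 * (W x ^ (γ - 1) * (2 * D x))) := by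
          gcongr; exact hDc
      _ = ENNReal.ofReal γ * ((2 * 2) * (W x ^ (γ - 1) * D x)) := by ring
      _ = _ := by norm_num
  calc ENNReal.ofReal |∫ x, (Eden k γ K r u x - H x) ∂cubeVol d|
      ≤ ∫⁻ x, ENNReal.ofReal |Eden k γ K r u x - H x| ∂cubeVol d := by
        have := enorm_integral_le_lintegral_enorm (μ := cubeVol d) (fun x => Eden k γ K r u x - H x)
        simpa only [Real.enorm_eq_ofReal_abs] using this
    _ ≤ _ := lintegral_mono_ae pt
    _ = ENNReal.ofReal d * (∫⁻ x, ∫⁻ y, ENNReal.ofReal (r y) * dU u (x, y) ^ 2 ∂PK K x ∂cubeVol d)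
        + ENNReal.ofReal k * (ENNReal.ofReal γ * (4 *
          ∫⁻ x, (W x ^ (γ - 1) * D x ^ (1:ℝ)) ∂cubeVol d)) := by
        have hzm' := QK_meas hK _ hzm
        rw [lintegral_add_left (hzm'.const_mul _),
          lintegral_const_mul' _ _ ENNReal.ofReal_ne_top, lintegral_const_mul' _ _ ENNReal.ofReal_ne_top,
          lintegral_const_mul' _ _ ENNReal.ofReal_ne_top, lintegral_const_mul' _ _ (by norm_num)]
    _ ≤ _ := by
        have h1 := rdelta hK he hs.rm hs.um 2 (by norm_num)
        rw [QK_lint hK _ hzm] at h1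
        have h2 := hol2p (cubeVol d) W D hWm.aemeasurable hDm.aemeasurable
          (γ - 1) 1 m s (by linarith) zero_le_one (by linarith) (by linarith) (by
            have := he.mq
            have e := he.rq
            have : (3:ℝ) / q = 2 / q + 1 / q := by ring
            have : 0 < 1 / q := by positivity
            linarith)
        rw [hW, nn_QK_iter hK m (by linarith) (fun z => ENNReal.ofReal (r z.2)) hrm2,
          nn_QK_snd hK m (fun y => ENNReal.ofReal (r y)) (by fun_prop),
          hD, nn_QK_iter hK s (by linarith) _ hRm] at h2
        simp only [ENNReal.rpow_one] at h2
        simp only [ENNReal.rpow_one, hW, hD]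
        gcongr
end

lemma lat_per {E : Type*} [NormedAddCommGroup E] (w : (Fin d → ℝ) → E) (hw : SpacePeriodic w)
    (x h : Fin d → ℝ) : w (x + lat h) = w (x + h) := by
  rw [← hw (x + lat h) fun i => round (h i)]
  congr 1
  funext i
  simp only [lat, Pi.add_apply]; ring

lemma mom_bound {K : (Fin d → ℝ) → ℝ} {L : ℝ} (hK : IsKer K L) {E : Type*} [NormedAddCommGroup E]
    (w : (Fin d → ℝ) → E) (hw : SpacePeriodic w)
    (hm : Measurable fun z : (Fin d → ℝ) × (Fin d → ℝ) => ENNReal.ofReal ‖w z.2 - w z.1‖)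
    (s β : ℝ) (hs : 0 < s) (A Mom : ℝ≥0∞) (hA : ∀ h, nn (cubeVol d) s
      (fun x => ENNReal.ofReal ‖w (x + lat h) - w x‖) ≤ A * ENNReal.ofReal (euNorm (lat h) ^ β))
    (hM : ∫⁻ h, ENNReal.ofReal (K h) * ENNReal.ofReal (euNorm (lat h) ^ (β * s)) ∂(cubeVol d) ≤ Mom) :
    nn (QK K) s (fun z => ENNReal.ofReal ‖w z.2 - w z.1‖) ≤ A * Mom ^ (1 / s) := by
  have hKc := hK.smooth.continuous
  have key : ∫⁻ z, ENNReal.ofReal ‖w z.2 - w z.1‖ ^ s ∂QK K ≤ A ^ s * Mom := by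
    rw [QK_lint hK _ (hm.pow_const s)]
    have e1 : ∀ x, ∫⁻ y, ENNReal.ofReal ‖w y - w x‖ ^ s ∂PK K x
        = ∫⁻ h, ENNReal.ofReal (K h) * ENNReal.ofReal ‖w (x + h) - w x‖ ^ s ∂cubeVol d := by
      intro x
      rw [PK_lint hK x (fun y => ENNReal.ofReal ‖w y - w x‖ ^ s)
        ((hm.pow_const s).comp measurable_prodMk_left)]
      exact ker_change K L hK (fun y => ENNReal.ofReal ‖w y - w x‖ ^ s)
        (fun y n => by rw [hw]) x
    simp only [e1]
    have hm2 : Measurable fun z : (Fin d → ℝ) × (Fin d → ℝ) =>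
        ENNReal.ofReal (K z.2) * ENNReal.ofReal ‖w (z.1 + z.2) - w z.1‖ ^ s := by
      refine Measurable.mul (by fun_prop) (Measurable.pow_const ?_ s)
      exact hm.comp (measurable_fst.prodMk (measurable_fst.add measurable_snd))
    rw [lintegral_lintegral_swap hm2.aemeasurable]
    calc _ ≤ ∫⁻ h, A ^ s * (ENNReal.ofReal (K h) * ENNReal.ofReal (euNorm (lat h) ^ (β * s))) ∂cubeVol d := by
          refine lintegral_mono fun h => ?_
          rw [lintegral_const_mul' _ _ ENNReal.ofReal_ne_top]
          have h1 := ENNReal.rpow_le_rpow (hA h) hs.le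
          rw [nn_pow _ s hs, ENNReal.mul_rpow_of_nonneg _ _ hs.le,
            ENNReal.ofReal_rpow_of_nonneg (Real.rpow_nonneg (euNorm_nonneg _) _) hs.le,
            ← Real.rpow_mul (euNorm_nonneg _)] at h1
          simp only [lat_per w hw] at h1
          calc _ ≤ ENNReal.ofReal (K h) * (A ^ s * ENNReal.ofReal (euNorm (lat h) ^ (β * s))) := by
                gcongr
            _ = _ := by ring
      _ ≤ _ := by
          rw [lintegral_const_mul'' _ ?_]
          · gcongr
          · have : Measurable fun h : Fin d → ℝ => lat h := by
              unfold lat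
              refine measurable_pi_lambda _ fun i => ?_
              have hr : Measurable fun t : ℝ => ((round t : ℤ) : ℝ) := by
                simp only [round_eq]
                fun_prop
              exact (measurable_pi_apply i).sub (hr.comp (measurable_pi_apply i))
            have h2 : Measurable fun h : Fin d → ℝ => euNorm (lat h) ^ (β * s) :=
              (euNorm_meas.comp this).pow_const _
            exact (Measurable.mul (by fun_prop) h2.ennreal_ofReal).aemeasurable
  unfold nn
  calc _ ≤ (A ^ s * Mom) ^ (1 / s) := ENNReal.rpow_le_rpow key (by positivity)
    _ = _ := by
      rw [ENNReal.mul_rpow_of_nonneg _ _ (by positivity), ← ENNReal.rpow_mul, mul_one_div_cancel hs.ne',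
        ENNReal.rpow_one]

lemma nn_eq_eLpNorm {Ω E : Type*} [MeasurableSpace Ω] [NormedAddCommGroup E] (μ : Measure Ω) (s : ℝ)
    (hs : 0 < s) (f : Ω → E) :
    nn μ s (fun x => ENNReal.ofReal ‖f x‖) = eLpNorm f (ENNReal.ofReal s) μ := by
  rw [eLpNorm_eq_lintegral_rpow_enorm_toReal (by simpa using hs) ENNReal.ofReal_ne_top,
    ENNReal.toReal_ofReal hs.le]
  simp only [nn, ofReal_norm]

lemma euNorm_pos (y : Fin d → ℝ) (hy : y ≠ 0) : 0 < euNorm y := by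
  obtain ⟨i, hi⟩ := Function.ne_iff.1 hy
  exact (abs_pos.2 hi).trans_le (abs_le_euNorm y i)

lemma euNorm_neg (y : Fin d → ℝ) : euNorm (-y) = euNorm y := by simp [euNorm]

lemma V_bound {K : (Fin d → ℝ) → ℝ} {L : ℝ} (hK : IsKer K L)
    (u : (Fin d → ℝ) → Fin d → ℝ) (hu : SpacePeriodic u) (hum : Measurable u)
    (q α : ℝ) (hq : 0 < q) (Mom : ℝ≥0∞)
    (hM : ∫⁻ h, ENNReal.ofReal (K h) * ENNReal.ofReal (euNorm (lat h) ^ (α * q)) ∂(cubeVol d) ≤ Mom) :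
    nn (QK K) q (dU u) ≤ besovNorm α (ENNReal.ofReal q) u * Mom ^ (1 / q) := by
  refine mom_bound hK u hu (dU_meas hum) q α hq _ Mom (fun h => ?_) hM
  rw [nn_eq_eLpNorm _ q hq]
  by_cases h0 : lat h = 0
  · simp [h0]
  have hne : -lat h ≠ 0 := neg_ne_zero.2 h0
  have h1 : eLpNorm (fun x => u (x - (-lat h)) - u x) (ENNReal.ofReal q) (cubeVol d)
      / ENNReal.ofReal (euNorm (-lat h) ^ α) ≤ besovNorm α (ENNReal.ofReal q) u :=
    le_trans (le_iSup₂ (f := fun (y : Fin d → ℝ) (_ : y ≠ 0) =>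
      eLpNorm (fun x => u (x - y) - u x) (ENNReal.ofReal q) (cubeVol d)
        / ENNReal.ofReal (euNorm y ^ α)) (-lat h) hne) le_add_self
  rw [ENNReal.div_le_iff (by simpa using Real.rpow_pos_of_pos (euNorm_pos _ hne) α)
    ENNReal.ofReal_ne_top, euNorm_neg] at h1
  simpa using h1

lemma lemmaW (T : ℝ) (F J : ℝ → ℝ) (hF : IntegrableOn F (Set.Ioo 0 T))
    (hJ : AEStronglyMeasurable J (volume.restrict (Set.Ioo 0 T)) → IntegrableOn J (Set.Ioo 0 T))
    (h : ∀ θ : ℝ → ℝ, ContDiff ℝ (⊤ : ℕ∞) θ → TSupp T θ →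
      ∫ t in Set.Ioo 0 T, θ t * F t = ∫ t in Set.Ioo 0 T, θ t * J t) :
    ∀ᵐ t ∂(volume.restrict (Set.Ioo 0 T)), |F t| ≤ |J t| := by
  have hbd : ∀ θ : ℝ → ℝ, Continuous θ → ∀ f : ℝ → ℝ, IntegrableOn f (Set.Ioo 0 T) →
      IntegrableOn (fun t => θ t * f t) (Set.Ioo 0 T) := by
    intro θ hθ f hf
    obtain ⟨D, hD⟩ := (isCompact_Icc (a := (0:ℝ)) (b := T)).exists_bound_of_continuousOn
      hθ.continuousOn
    refine Integrable.bdd_mul (c := D) hf hθ.aestronglyMeasurable ?_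
    rw [ae_restrict_iff' measurableSet_Ioo]
    exact Filter.Eventually.of_forall fun t ht => hD t ⟨ht.1.le, ht.2.le⟩
  by_cases hJm : AEStronglyMeasurable J (volume.restrict (Set.Ioo 0 T))
  · have hJi := hJ hJm
    have := dbr T (fun t => F t - J t) (hF.sub hJi) (fun θ hθ hs => by
      have e : ∀ t, θ t * (F t - J t) = θ t * F t - θ t * J t := fun t => by ring
      simp only [e]
      rw [integral_sub (hbd θ hθ.continuous F hF) (hbd θ hθ.continuous J hJi), h θ hθ hs, sub_self])
    filter_upwards [this] with t ht
    rw [sub_eq_zero.1 ht]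
  · have hex : ∃ θ : ℝ → ℝ, ContDiff ℝ (⊤ : ℕ∞) θ ∧ TSupp T θ ∧
        ¬ AEStronglyMeasurable (fun t => θ t * J t) (volume.restrict (Set.Ioo 0 T)) := by
      by_contra! hcon
      apply hJm
      have hU : Set.Ioo 0 T = ⋃ n : ℕ, Set.Ioo (1 / ((n:ℝ) + 1)) (T - 1 / ((n:ℝ) + 1)) := by
        ext t
        simp only [Set.mem_Ioo, Set.mem_iUnion]
        constructor
        · rintro ⟨h0, h1⟩
          obtain ⟨n, hn⟩ := exists_nat_one_div_lt (lt_min h0 (sub_pos.2 h1))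
          exact ⟨n, hn.trans_le (min_le_left _ _), by linarith [min_le_right t (T - t)]⟩
        · rintro ⟨n, h0, h1⟩
          have : 0 < 1 / ((n:ℝ) + 1) := by positivity
          exact ⟨by linarith, by linarith⟩
      rw [hU, aestronglyMeasurable_iUnion_iff]
      intro n
      obtain ⟨θ, hsup, hθ, hθ0⟩ := (isOpen_Ioo (a := 1 / ((n:ℝ) + 1))
        (b := T - 1 / ((n:ℝ) + 1))).exists_contDiff_support_eq (n := (⊤ : ℕ∞))
      have hz : ∀ t, t ∉ Set.Ioo (1 / ((n:ℝ) + 1)) (T - 1 / ((n:ℝ) + 1)) → θ t = 0 := by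
        intro t ht
        rw [← hsup] at ht
        simpa using ht
      have hpos : 0 < 1 / ((n:ℝ) + 1) := by positivity
      have h1 := hcon θ hθ ⟨1 / ((n:ℝ) + 1), T - 1 / ((n:ℝ) + 1), hpos,
        by linarith, fun t ht => hz t fun h' => ht ⟨h'.1.le, h'.2.le⟩⟩
      have h2 : AEStronglyMeasurable (fun t => θ t * J t)
          (volume.restrict (Set.Ioo (1 / ((n:ℝ) + 1)) (T - 1 / ((n:ℝ) + 1)))) := by
        refine h1.mono_measure (Measure.restrict_mono ?_ le_rfl)
        intro t ht
        exact ⟨by linarith [ht.1], by linarith [ht.2]⟩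
      have h3 : AEStronglyMeasurable (fun t => (θ t)⁻¹ * (θ t * J t))
          (volume.restrict (Set.Ioo (1 / ((n:ℝ) + 1)) (T - 1 / ((n:ℝ) + 1)))) :=
        (hθ.continuous.measurable.inv.aestronglyMeasurable).mul h2
      refine h3.congr ?_
      rw [Filter.EventuallyEq, ae_restrict_iff' measurableSet_Ioo]
      refine Filter.Eventually.of_forall fun t ht => ?_
      have : θ t ≠ 0 := by
        rw [← hsup] at ht
        exact ht
      field_simp
    obtain ⟨θ₀, hθ₀, hs₀, hn₀⟩ := hex
    have junk : ∀ θ : ℝ → ℝ, ContDiff ℝ (⊤ : ℕ∞) θ → TSupp T θ →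
        ¬ AEStronglyMeasurable (fun t => θ t * J t) (volume.restrict (Set.Ioo 0 T)) →
        ∫ t in Set.Ioo 0 T, θ t * F t = 0 := by
      intro θ hθ hs hn
      rw [h θ hθ hs]
      exact integral_undef fun hi => hn hi.aestronglyMeasurable
    have hF0 := dbr T F hF (fun ζ hζ hζs => by
      have hsup : ∀ e : ℝ, TSupp T (fun t => θ₀ t + e * ζ t) := by
        intro e
        obtain ⟨a, b, ha, hb, h1⟩ := hs₀
        obtain ⟨a', b', ha', hb', h2⟩ := hζs
        refine ⟨min a a', max b b', lt_min ha ha', max_lt hb hb', fun t ht => ?_⟩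
        show θ₀ t + e * ζ t = 0
        rw [h1 t, h2 t]
        · ring
        · exact fun h' => ht ⟨(min_le_right _ _).trans h'.1, h'.2.trans (le_max_right _ _)⟩
        · exact fun h' => ht ⟨(min_le_left _ _).trans h'.1, h'.2.trans (le_max_left _ _)⟩
      have hsm : ∀ e : ℝ, ContDiff ℝ (⊤ : ℕ∞) (fun t => θ₀ t + e * ζ t) := fun e =>
        hθ₀.add (contDiff_const.mul hζ)
      have hi0 := hbd θ₀ hθ₀.continuous F hF
      have hi1 := hbd ζ hζ.continuous F hF
      have hz := junk θ₀ hθ₀ hs₀ hn₀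
      have fin : ∀ e : ℝ, e ≠ 0 → ¬ AEStronglyMeasurable (fun t => (θ₀ t + e * ζ t) * J t)
          (volume.restrict (Set.Ioo 0 T)) → ∫ t in Set.Ioo 0 T, ζ t * F t = 0 := by
        intro e he hn
        have h1 := junk _ (hsm e) (hsup e) hn
        have e1 : ∀ t, (θ₀ t + e * ζ t) * F t = θ₀ t * F t + e * (ζ t * F t) := fun t => by ring
        simp only [e1] at h1
        rw [integral_add hi0 (hi1.const_mul e), hz, integral_const_mul, zero_add] at h1
        exact (mul_eq_zero.1 h1).resolve_left he
      by_cases hA : AEStronglyMeasurable (fun t => (θ₀ t + 1 * ζ t) * J t)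
          (volume.restrict (Set.Ioo 0 T))
      · by_cases hB : AEStronglyMeasurable (fun t => (θ₀ t + (-1) * ζ t) * J t)
            (volume.restrict (Set.Ioo 0 T))
        · exfalso
          apply hn₀
          refine ((hA.add hB).const_mul (1/2)).congr (Filter.Eventually.of_forall fun t => ?_)
          simp only [Pi.add_apply]; ring
        · exact fin (-1) (by norm_num) hB
      · exact fin 1 (by norm_num) hA)
    filter_upwards [hF0] with t ht
    rw [ht, abs_zero]
    exact abs_nonneg _

open Classical in
/-- Replace a non-integrable function by zero. -/
def tame (f : (Fin d → ℝ) → ℝ) : (Fin d → ℝ) → ℝ := if Integrable f (cubeVol d) then f else 0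

lemma tame_int (f : (Fin d → ℝ) → ℝ) : Integrable (tame f) (cubeVol d) := by
  unfold tame
  split_ifs with h
  · exact h
  · exact integrable_zero _ _ _

lemma tame_abs (f : (Fin d → ℝ) → ℝ) (x : Fin d → ℝ) : |tame f x| ≤ |f x| := by
  unfold tame
  split_ifs with h
  · exact le_rfl
  · simp

lemma tame_L1 (f : (Fin d → ℝ) → ℝ) (s : ℝ) (hs : 1 ≤ s) :
    ENNReal.ofReal (∫ y, |tame f y| ∂cubeVol d) ≤ eLpNorm f (ENNReal.ofReal s) (cubeVol d) := by
  have h1 : ENNReal.ofReal (∫ y, |tame f y| ∂cubeVol d) = eLpNorm (tame f) 1 (cubeVol d) := by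
    rw [ofReal_integral_eq_lintegral_ofReal (tame_int f).abs
      (Filter.Eventually.of_forall fun y => abs_nonneg _), eLpNorm_one_eq_lintegral_enorm]
    simp only [Real.enorm_eq_ofReal_abs]
  rw [h1]
  calc _ ≤ eLpNorm (tame f) (ENNReal.ofReal s) (cubeVol d) := by
        refine eLpNorm_le_eLpNorm_of_exponent_le ?_ (tame_int f).aestronglyMeasurable
        rw [← ENNReal.ofReal_one]
        exact ENNReal.ofReal_le_ofReal hs
    _ ≤ _ := eLpNorm_mono fun x => by simpa using tame_abs f x

lemma mol_tame {K : (Fin d → ℝ) → ℝ} {L : ℝ} (hK : IsKer K L) (f : (Fin d → ℝ) → ℝ)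
    (x : Fin d → ℝ) : mol K f x = mol K (tame f) x := by
  unfold tame
  split_ifs with h
  · rfl
  · have : ¬ Integrable (fun y => K (x - y) * f y) (cubeVol d) := by
      intro hi
      apply h
      have hc := hK.smooth.continuous
      have hci : Continuous fun z => (K z)⁻¹ := hc.inv₀ fun z => (hK.pos z).ne'
      obtain ⟨B, hB⟩ := per_cont_bdd (fun z => (K z)⁻¹) hci
        (fun z n => by show (K _)⁻¹ = _; rw [hK.per])
      have := hi.bdd_mul (c := B) (f := fun y => (K (x - y))⁻¹)
        ((hci.comp (continuous_const.sub continuous_id)).aestronglyMeasurable)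
        (Filter.Eventually.of_forall fun y => hB _)
      refine this.congr (Filter.Eventually.of_forall fun y => ?_)
      have := (hK.pos (x - y)).ne'
      field_simp
    unfold mol
    rw [integral_undef this]
    simp

section
variable (T : ℝ) (γ : ℝ) (hγ : 1 < γ)
    (ρ : ℝ → (Fin d → ℝ) → ℝ) (v : ℝ → (Fin d → ℝ) → Fin d → ℝ)
    (ρ₀ : (Fin d → ℝ) → ℝ) (v₀ : (Fin d → ℝ) → Fin d → ℝ)
    (hsol : IsWeakSolution d T γ ρ v ρ₀ v₀)
    (c : ℝ) (hlow : ∀ᵐ z ∂(spaceTime d T), c ≤ ρ z.1 z.2)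

include hγ hsol hlow in
lemma grad_ae (G : ℝ → (Fin d → ℝ) → Fin d → ℝ)
    (hG : ∀ i, HasWeakDerivX T i ρ fun t x => G t x i) (a s : ℝ) (ha : 1 ≤ a) (hs : 1 ≤ s)
    (hGm : MemLpLq T (ENNReal.ofReal a) (ENNReal.ofReal s) G)
    (K : (Fin d → ℝ) → ℝ) (L : ℝ) (hK : IsKer K L) :
    ∀ᵐ t ∂(volume.restrict (Set.Ioo 0 T)), ∀ x i,
      |mol (dK i K) (ρ t) x| ≤ |mol K (tame fun y => G t y i) x| := by
  obtain ⟨C, hC⟩ := slices_ae T γ ρ v ρ₀ v₀ hsol c hlow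
  obtain ⟨BK, hBK⟩ := per_cont_bdd K hK.smooth.continuous hK.per
  choose BD hBD using fun i => per_cont_bdd (dK i K) (dK_cont K hK.smooth i) (dK_per K hK.per i)
  have hBK0 : 0 ≤ BK := (abs_nonneg _).trans (hBK 0)
  have hBD0 : ∀ i, 0 ≤ BD i := fun i => (abs_nonneg _).trans (hBD i 0)
  have ha0 : 0 < a := by linarith
  have hfin : ∫⁻ t in Set.Ioo 0 T, eLpNorm (G t) (ENNReal.ofReal s) (cubeVol d) ^ a < ∞ := by
    unfold MemLpLq LpLqNorm timeLpOn at hGm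
    rw [if_neg ENNReal.ofReal_ne_top, ENNReal.toReal_ofReal ha0.le] at hGm
    exact (ENNReal.rpow_lt_top_iff_of_pos (by positivity)).1 hGm
  have pt : ∀ x i, ∀ᵐ t ∂(volume.restrict (Set.Ioo 0 T)),
      |mol (dK i K) (ρ t) x| ≤ |mol K (fun y => G t y i) x| := by
    intro x i
    refine lemmaW T _ _ ?_ ?_ ?_
    · have mk : Measurable fun t : ℝ => (t, x) := by fun_prop
      refine int_bdd T _ ((meas_all T γ ρ v ρ₀ v₀ hsol (dK i K) (dK_cont K hK.smooth i)).1.comp mk)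
        (BD i * (1 + C)) ?_
      filter_upwards [hC] with t ht
      refine (mol_bound _ _ (BD i) (hBD i) (ht.1.ir hγ) x).trans ?_
      exact mul_le_mul_of_nonneg_left (ht.1.bounds hγ C ht.2.1 ht.2.2).1 (hBD0 i)
    · intro hm
      refine ⟨hm, ?_⟩
      show ∫⁻ t in Set.Ioo 0 T, ‖mol K (fun y => G t y i) x‖ₑ < ∞
      calc _ ≤ ∫⁻ t in Set.Ioo 0 T, ENNReal.ofReal BK *
            (1 + eLpNorm (G t) (ENNReal.ofReal s) (cubeVol d) ^ a) := by
            refine lintegral_mono fun t => ?_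
            have h1 := mol_bound K (tame fun y => G t y i) BK hBK (tame_int _) x
            rw [← mol_tame hK] at h1
            rw [Real.enorm_eq_ofReal_abs]
            refine (ENNReal.ofReal_le_ofReal h1).trans ?_
            rw [ENNReal.ofReal_mul hBK0]
            gcongr
            refine (tame_L1 _ s hs).trans ?_
            have h2 : eLpNorm (fun y => G t y i) (ENNReal.ofReal s) (cubeVol d)
                ≤ eLpNorm (G t) (ENNReal.ofReal s) (cubeVol d) :=
              eLpNorm_mono fun y => norm_le_pi_norm (G t y) i
            refine h2.trans ?_
            rcases le_total (eLpNorm (G t) (ENNReal.ofReal s) (cubeVol d)) 1 with h | h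
            · exact h.trans le_self_add
            · refine le_trans ?_ le_add_self
              conv_lhs => rw [← ENNReal.rpow_one (eLpNorm (G t) (ENNReal.ofReal s) (cubeVol d))]
              exact ENNReal.rpow_le_rpow_of_exponent_le h ha
        _ < ∞ := by
            rw [lintegral_const_mul' _ _ ENNReal.ofReal_ne_top,
              lintegral_add_left measurable_const]
            refine ENNReal.mul_lt_top ENNReal.ofReal_lt_top (ENNReal.add_lt_top.2 ⟨?_, hfin⟩)
            simp
    · intro θ hθ hθs
      obtain ⟨t1, t2, t3, t4⟩ := test_fun T K hK.smooth hK.per x θ hθ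
      have h := hG i _ ⟨t1, t2, by
        obtain ⟨a, b, h1, h2, h3⟩ := hθs
        exact ⟨a, b, h1, h2, fun t y ht => by simp [h3 t ht]⟩⟩
      simp only [t4] at h
      have e1 : ∀ t, ∫ y in unitCube d, ρ t y * (θ t * -dK i K (x - y))
          = -(θ t * mol (dK i K) (ρ t) x) := by
        intro t
        unfold mol
        rw [← integral_const_mul, ← integral_neg]
        exact integral_congr_ae (Filter.Eventually.of_forall fun y => by ring)
      have e2 : ∀ t, ∫ y in unitCube d, G t y i * (θ t * K (x - y))
          = θ t * mol K (fun y => G t y i) x := by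
        intro t
        unfold mol
        rw [← integral_const_mul]
        exact integral_congr_ae (Filter.Eventually.of_forall fun y => by ring)
      simp only [e1, e2, integral_neg] at h
      exact neg_injective h
  have hden := TopologicalSpace.exists_countable_dense (Fin d → ℝ)
  obtain ⟨D, hDc, hDd⟩ := hden
  have hall : ∀ᵐ t ∂(volume.restrict (Set.Ioo 0 T)), ∀ x ∈ D, ∀ i,
      |mol (dK i K) (ρ t) x| ≤ |mol K (fun y => G t y i) x| := by
    rw [ae_ball_iff hDc]
    intro x _
    rw [ae_all_iff]
    exact fun i => pt x i
  filter_upwards [hall, hC] with t ht hS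
  intro x i
  have hcl : IsClosed {x | |mol (dK i K) (ρ t) x| ≤ |mol K (tame fun y => G t y i) x|} :=
    isClosed_le (mol_cont _ _ (dK_cont K hK.smooth i) (dK_per K hK.per i) (hS.1.ir hγ)).abs
      (mol_cont _ _ hK.smooth.continuous hK.per (tame_int _)).abs
  have hsub : D ⊆ {x | |mol (dK i K) (ρ t) x| ≤ |mol K (tame fun y => G t y i) x|} := by
    intro z hz
    have := ht z hz i
    rw [mol_tame hK] at this
    exact this
  have := hcl.closure_subset_iff.2 hsub
  rw [hDd.closure_eq] at this
  exact this (Set.mem_univ x)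

end

lemma tr1 (f D H : (Fin d → ℝ) → ℝ) (h : Fin d → ℝ)
    (hd : ∀ x (s : ℝ), HasDerivAt (fun s : ℝ => f (x + s • h)) (D (x + s • h)) s)
    (hDc : Continuous D) (hHc : Continuous H) (hHp : SpacePeriodic H)
    (e : ℝ) (hDH : ∀ z, |D z| ≤ e * H z) (he : 0 ≤ e) (r : ℝ) (hr : 1 ≤ r) :
    nn (cubeVol d) r (fun x => ENNReal.ofReal |f (x + h) - f x|)
      ≤ ENNReal.ofReal e * nn (cubeVol d) r (fun x => ENNReal.ofReal (H x)) := by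
  have hr0 : 0 < r := by linarith
  have hP : IsProbabilityMeasure (volume.restrict (Set.Ioc (0:ℝ) 1)) := ⟨by simp⟩
  have hHm := hHc.measurable
  have p1 : ∀ x, ENNReal.ofReal |f (x + h) - f x|
      ≤ ENNReal.ofReal e * ∫⁻ s in Set.Ioc (0:ℝ) 1, ENNReal.ofReal (H (x + s • h)) := by
    intro x
    have hcD : Continuous fun s : ℝ => D (x + s • h) := by fun_prop
    have h1 := intervalIntegral.integral_eq_sub_of_hasDerivAt (a := 0) (b := 1)
      (fun s _ => hd x s) (hcD.intervalIntegrable _ _)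
    simp only [one_smul, zero_smul, add_zero] at h1
    rw [← h1, intervalIntegral.integral_of_le zero_le_one, ← Real.enorm_eq_ofReal_abs]
    refine (enorm_integral_le_lintegral_enorm _).trans ?_
    rw [← lintegral_const_mul' _ _ ENNReal.ofReal_ne_top]
    refine lintegral_mono fun s => ?_
    rw [Real.enorm_eq_ofReal_abs, ← ENNReal.ofReal_mul he]
    exact ENNReal.ofReal_le_ofReal (hDH _)
  have p2 : ∫⁻ x, ENNReal.ofReal |f (x + h) - f x| ^ r ∂cubeVol d
      ≤ ENNReal.ofReal e ^ r * ∫⁻ x, ENNReal.ofReal (H x) ^ r ∂cubeVol d := by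
    have hm2 : Measurable fun z : (Fin d → ℝ) × ℝ =>
        ENNReal.ofReal (H (z.1 + z.2 • h)) ^ r := by
      refine Measurable.pow_const (Measurable.ennreal_ofReal ?_) r
      exact hHm.comp (by fun_prop)
    calc _ ≤ ∫⁻ x, ENNReal.ofReal e ^ r *
          (∫⁻ s in Set.Ioc (0:ℝ) 1, ENNReal.ofReal (H (x + s • h)) ^ r) ∂cubeVol d := by
          refine lintegral_mono fun x => ?_
          refine (ENNReal.rpow_le_rpow (p1 x) hr0.le).trans ?_
          rw [ENNReal.mul_rpow_of_nonneg _ _ hr0.le]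
          gcongr
          have hm3 : Measurable fun s : ℝ => ENNReal.ofReal (H (x + s • h)) :=
            (hHm.comp (by fun_prop)).ennreal_ofReal
          have := hol1p (volume.restrict (Set.Ioc (0:ℝ) 1))
            (fun s : ℝ => ENNReal.ofReal (H (x + s • h))) hm3.aemeasurable 1 r zero_le_one hr0 hr
          simp only [ENNReal.rpow_one] at this
          refine (ENNReal.rpow_le_rpow this hr0.le).trans ?_
          rw [nn_pow _ r hr0]
      _ = ENNReal.ofReal e ^ r * ∫⁻ s in Set.Ioc (0:ℝ) 1,
            ∫⁻ x, ENNReal.ofReal (H (x + s • h)) ^ r ∂cubeVol d := by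
          rw [lintegral_const_mul' _ _ (ENNReal.rpow_ne_top_of_nonneg hr0.le ENNReal.ofReal_ne_top),
            lintegral_lintegral_swap hm2.aemeasurable]
      _ = _ := by
          congr 1
          have : ∀ s : ℝ, ∫⁻ x, ENNReal.ofReal (H (x + s • h)) ^ r ∂cubeVol d
              = ∫⁻ x, ENNReal.ofReal (H x) ^ r ∂cubeVol d := fun s =>
            lintegral_cube_shift (fun x => ENNReal.ofReal (H x) ^ r)
              (fun x n => by rw [hHp]) (s • h)
          simp only [this]
          simp
  unfold nn
  refine (ENNReal.rpow_le_rpow p2 (by positivity)).trans ?_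
  rw [ENNReal.mul_rpow_of_nonneg _ _ (by positivity), ← ENNReal.rpow_mul,
    mul_one_div_cancel hr0.ne', ENNReal.rpow_one]

lemma mol_abs {K : (Fin d → ℝ) → ℝ} {L : ℝ} (hK : IsKer K L) (f g : (Fin d → ℝ) → ℝ)
    (hg : Integrable g (cubeVol d)) (hfg : ∀ y, |f y| ≤ g y) (x : Fin d → ℝ) :
    |mol K f x| ≤ mol K g x := by
  unfold mol
  rw [← Real.norm_eq_abs]
  refine norm_integral_le_of_norm_le (mol_integrable K g hK.smooth.continuous hK.per hg x)
    (Filter.Eventually.of_forall fun y => ?_)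
  rw [Real.norm_eq_abs, abs_mul, abs_of_pos (hK.pos _)]
  exact mul_le_mul_of_nonneg_left (hfg y) (hK.pos _).le

lemma mol_nn {K : (Fin d → ℝ) → ℝ} {L : ℝ} (hK : IsKer K L) (g : (Fin d → ℝ) → ℝ)
    (hg : Integrable g (cubeVol d)) (r : ℝ) (hr : 1 ≤ r) :
    nn (cubeVol d) r (fun x => ENNReal.ofReal |mol K g x|)
      ≤ nn (cubeVol d) r (fun x => ENNReal.ofReal |g x|) := by
  have hr0 : 0 < r := by linarith
  obtain ⟨g', hg'm, hgg⟩ := hg.aestronglyMeasurable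
  have hg'i : Integrable g' (cubeVol d) := hg.congr hgg
  rw [mol_congr K g g' hgg]
  have hm : Measurable fun y => ENNReal.ofReal |g' y| := by
    have := hg'm.measurable
    fun_prop
  calc _ ≤ nn (cubeVol d) r (fun x => nn (PK K x) r fun y => ENNReal.ofReal |g' y|) := by
        refine nn_mono _ r hr0 _ _ (Filter.Eventually.of_forall fun x => ?_)
        have := PK_prob hK x
        rw [← PK_int hK, ← Real.enorm_eq_ofReal_abs]
        refine (enorm_integral_le_lintegral_enorm _).trans ?_
        simp only [Real.enorm_eq_ofReal_abs]
        rw [← nn_one]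
        exact nn_exp _ _ hm.aemeasurable 1 r one_pos hr
    _ = nn (QK K) r (fun z => ENNReal.ofReal |g' z.2|) :=
        nn_QK_iter hK r hr0 (fun z => ENNReal.ofReal |g' z.2|) (hm.comp measurable_snd)
    _ = nn (cubeVol d) r fun y => ENNReal.ofReal |g' y| := nn_QK_snd hK r _ hm
    _ ≤ _ := nn_mono _ r hr0 _ _ (hgg.mono fun y hy => by rw [hy])

lemma tr2 {K : (Fin d → ℝ) → ℝ} {L : ℝ} (hK : IsKer K L) (f : (Fin d → ℝ) → ℝ)
    (hf : Integrable f (cubeVol d)) (g : (Fin d → ℝ) → Fin d → ℝ)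
    (hg : ∀ x i, |mol (dK i K) f x| ≤ |mol K (tame fun y => g y i) x|)
    (r : ℝ) (hr : 1 ≤ r) (h : Fin d → ℝ) :
    nn (cubeVol d) r (fun x => ENNReal.ofReal |mol K f (x + h) - mol K f x|)
      ≤ ENNReal.ofReal (euNorm h) * (d * eLpNorm g (ENNReal.ofReal r) (cubeVol d)) := by
  have hr0 : 0 < r := by linarith
  set Γ : (Fin d → ℝ) → ℝ := fun y => ∑ i, |tame (fun y => g y i) y| with hΓ
  have hΓi : Integrable Γ (cubeVol d) := integrable_finsetSum _ fun i _ => (tame_int _).abs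
  have hle : ∀ i y, |tame (fun y => g y i) y| ≤ Γ y := fun i y =>
    Finset.single_le_sum (f := fun i => |tame (fun y => g y i) y|) (fun i _ => abs_nonneg _)
      (Finset.mem_univ i)
  have hΓ0 : ∀ y, 0 ≤ Γ y := fun y => Finset.sum_nonneg fun i _ => abs_nonneg _
  have hmi : ∀ i x, Integrable (fun y => K (x - y) * |tame (fun y => g y i) y|) (cubeVol d) :=
    fun i x => mol_integrable K _ hK.smooth.continuous hK.per (tame_int _).abs x
  have hsum : ∀ x, mol K Γ x = ∑ i, mol K (fun y => |tame (fun y => g y i) y|) x := by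
    intro x
    unfold mol
    rw [← integral_finsetSum _ fun i _ => hmi i x]
    refine integral_congr_ae (Filter.Eventually.of_forall fun y => ?_)
    simp only [hΓ, Finset.mul_sum]
  have h1 := tr1 (mol K f) (fun z => ∑ i, h i * mol (dK i K) f z) (mol K Γ) h
    (fun x s => mol_deriv K f hK.smooth hK.per hf x h s)
    (continuous_finsetSum _ fun i _ => continuous_const.mul
      (mol_cont _ f (dK_cont K hK.smooth i) (dK_per K hK.per i) hf))
    (mol_cont _ _ hK.smooth.continuous hK.per hΓi) (mol_per _ _ hK.per) (euNorm h)
    (fun z => by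
      rw [hsum, Finset.mul_sum]
      refine (Finset.abs_sum_le_sum_abs _ _).trans (Finset.sum_le_sum fun i _ => ?_)
      rw [abs_mul]
      refine mul_le_mul (abs_le_euNorm h i) ?_ (abs_nonneg _) (euNorm_nonneg h)
      exact (hg z i).trans (mol_abs hK _ _ (tame_int _).abs (fun y => le_rfl) z))
    (euNorm_nonneg h) r hr
  refine h1.trans ?_
  gcongr
  calc _ ≤ nn (cubeVol d) r (fun x => ENNReal.ofReal |mol K Γ x|) :=
        nn_mono _ r hr0 _ _ (Filter.Eventually.of_forall fun x =>
          ENNReal.ofReal_le_ofReal (le_abs_self _))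
    _ ≤ nn (cubeVol d) r (fun x => ENNReal.ofReal |Γ x|) := mol_nn hK Γ hΓi r hr
    _ ≤ nn (cubeVol d) r (fun x => ENNReal.ofReal ‖(d:ℝ) • g x‖) := by
        refine nn_mono _ r hr0 _ _ (Filter.Eventually.of_forall fun x => ?_)
        refine ENNReal.ofReal_le_ofReal ?_
        rw [abs_of_nonneg (hΓ0 x), norm_smul, Real.norm_natCast]
        calc Γ x ≤ ∑ _i : Fin d, ‖g x‖ := Finset.sum_le_sum fun i _ =>
              (tame_abs _ _).trans (norm_le_pi_norm (g x) i)
          _ = _ := by simp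
    _ = _ := by
        rw [nn_eq_eLpNorm _ r hr0 (fun x => (d:ℝ) • g x)]
        have := eLpNorm_const_smul (d:ℝ) g (ENNReal.ofReal r) (cubeVol d)
        rw [show (fun x => (d:ℝ) • g x) = (d:ℝ) • g from rfl, this]
        congr 1
        rw [Real.enorm_eq_ofReal_abs, abs_of_nonneg (by positivity), ENNReal.ofReal_natCast]

lemma cube_open_ae : ∀ᵐ x ∂(cubeVol d), ∀ i, 0 < x i ∧ x i < 1 := by
  have h := Measure.univ_pi_Ioo_ae_eq_Icc (μ := fun _ : Fin d => (volume : Measure ℝ))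
    (f := fun _ => (0:ℝ)) (g := fun _ => 1)
  rw [← volume_pi] at h
  unfold cubeVol
  rw [ae_restrict_iff' measurableSet_unitCube]
  filter_upwards [h] with x hx hxc
  have h2 : x ∈ Set.Icc (fun _ : Fin d => (0:ℝ)) (fun _ => 1) := by
    refine ⟨fun i => ?_, fun i => ?_⟩
    · exact (hxc i (Set.mem_univ i)).1
    · exact (hxc i (Set.mem_univ i)).2.le
  have h3 : x ∈ Set.univ.pi fun _ : Fin d => Set.Ioo (0:ℝ) 1 := by
    have := hx.mpr h2
    exact this
  exact fun i => h3 i (Set.mem_univ i)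

lemma lat_near (x : Fin d → ℝ) (hx : ∀ i, 0 < x i ∧ x i < 1) (g : (Fin d → ℝ) → ℝ)
    (hg : Continuous g) (τ : ℝ) (hτ : 0 < τ) :
    ∃ δ > 0, ∀ y ∈ unitCube d, euNorm (lat (y - x)) < δ → |g y - g x| ≤ τ := by
  obtain ⟨δ₁, hδ₁, h1⟩ := Metric.continuous_iff.1 hg x τ hτ
  obtain ⟨m, hm, hmx⟩ : ∃ m > 0, ∀ i, m ≤ x i ∧ m ≤ 1 - x i := by
    rcases isEmpty_or_nonempty (Fin d) with he | he
    · exact ⟨1, one_pos, fun i => he.elim i⟩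
    · obtain ⟨i₀, hi₀⟩ := Finite.exists_min fun i => min (x i) (1 - x i)
      refine ⟨min (x i₀) (1 - x i₀), lt_min (hx i₀).1 (by linarith [(hx i₀).2]), fun i => ?_⟩
      exact ⟨(hi₀ i).trans (min_le_left _ _), (hi₀ i).trans (min_le_right _ _)⟩
  refine ⟨min δ₁ m, lt_min hδ₁ hm, fun y hy hl => ?_⟩
  have hi : ∀ i, |lat (y - x) i| < min δ₁ m := fun i => (abs_le_euNorm _ i).trans_lt hl
  have hr : ∀ i, round ((y - x) i) = 0 := by
    intro i
    have hyi := hy i (Set.mem_univ i)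
    have h2 := abs_lt.1 ((hi i).trans_le (min_le_right _ _))
    simp only [lat, Pi.sub_apply] at h2 ⊢
    have h3 := hmx i
    have h4 : (round (y i - x i) : ℝ) < 1 := by linarith [hyi.2]
    have h5 : (-1 : ℝ) < (round (y i - x i) : ℝ) := by linarith [hyi.1]
    have h6 : round (y i - x i) < 1 := by exact_mod_cast h4
    have h7 : -1 < round (y i - x i) := by exact_mod_cast h5
    omega
  have hd : dist y x < δ₁ := by
    rw [dist_pi_lt_iff hδ₁]
    intro i
    have h2 := (hi i).trans_le (min_le_left _ _)
    simp only [lat] at h2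
    rw [hr i] at h2
    simpa [Real.dist_eq] using h2
  have := h1 y hd
  rw [Real.dist_eq] at this
  exact this.le

lemma conv_pt (x : Fin d → ℝ) (hx : ∀ i, 0 < x i ∧ x i < 1) (g : (Fin d → ℝ) → ℝ)
    (hg : Continuous g) (B : ℝ) (hB : ∀ y, |g y| ≤ B)
    (K : ℕ → (Fin d → ℝ) → ℝ) (L : ℕ → ℝ) (hK : ∀ n, IsKer (K n) (L n))
    (M : ℕ → ℝ≥0∞) (hM : ∀ n, ∫⁻ h, ENNReal.ofReal (K n h) * ENNReal.ofReal (euNorm (lat h) ^ 2)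
      ∂(cubeVol d) ≤ M n) (hM0 : Filter.Tendsto M Filter.atTop (nhds 0)) :
    Filter.Tendsto (fun n => ENNReal.ofReal |mol (K n) g x - g x|) Filter.atTop (nhds 0) := by
  have hB0 : 0 ≤ B := (abs_nonneg _).trans (hB x)
  have hgi : Integrable g (cubeVol d) :=
    Integrable.of_bound hg.aestronglyMeasurable B (Filter.Eventually.of_forall hB)
  have key : ∀ τ : ℝ, 0 < τ → ∃ A : ℝ, ∀ n, ENNReal.ofReal |mol (K n) g x - g x|
      ≤ ENNReal.ofReal τ + ENNReal.ofReal A * M n := by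
    intro τ hτ
    obtain ⟨δ, hδ, hn⟩ := lat_near x hx g hg τ hτ
    refine ⟨2 * B / δ ^ 2, fun n => ?_⟩
    have hP := PK_prob (hK n) x
    have e1 : mol (K n) g x - g x = ∫ y, (g y - g x) ∂PK (K n) x := by
      rw [integral_sub (PK_integrable (hK n) x g hgi) (integrable_const _), PK_int (hK n)]
      simp
    rw [e1, ← Real.enorm_eq_ofReal_abs]
    refine (enorm_integral_le_lintegral_enorm _).trans ?_
    rw [PK_lint (hK n) x (fun y => ‖g y - g x‖ₑ) (by fun_prop)]
    have hKm := PK_meas (hK n) x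
    have hlat : (∫⁻ y, ENNReal.ofReal (K n (x - y)) *
        ENNReal.ofReal (euNorm (lat (y - x)) ^ 2) ∂cubeVol d) ≤ M n := by
      rw [ker_change (K n) (L n) (hK n) (fun y => ENNReal.ofReal (euNorm (lat (y - x)) ^ 2))
        (fun y m => by
          congr 3
          funext i
          simp only [lat, Pi.sub_apply, Pi.add_apply]
          rw [show y i + (m i : ℝ) - x i = y i - x i + (m i : ℝ) by ring, round_add_intCast]
          push_cast; ring) x]
      simpa using hM n
    calc _ ≤ ∫⁻ y, (ENNReal.ofReal τ * ENNReal.ofReal (K n (x - y)) + ENNReal.ofReal (2 * B / δ ^ 2) *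
          (ENNReal.ofReal (K n (x - y)) * ENNReal.ofReal (euNorm (lat (y - x)) ^ 2))) ∂cubeVol d := by
          unfold cubeVol
          refine setLIntegral_mono' measurableSet_unitCube fun y hy => ?_
          have hb : ENNReal.ofReal |g y - g x| ≤ ENNReal.ofReal τ + ENNReal.ofReal (2 * B / δ ^ 2) *
              ENNReal.ofReal (euNorm (lat (y - x)) ^ 2) := by
            rw [← ENNReal.ofReal_mul (by positivity), ← ENNReal.ofReal_add hτ.le (by positivity)]
            refine ENNReal.ofReal_le_ofReal ?_
            by_cases hl : euNorm (lat (y - x)) < δ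
            · have := hn y hy hl
              have h0 : 0 ≤ 2 * B / δ ^ 2 * euNorm (lat (y - x)) ^ 2 := by positivity
              linarith
            · have h1 : |g y - g x| ≤ 2 * B := by
                refine (abs_sub _ _).trans ?_
                linarith [hB y, hB x]
              have h2 : δ ^ 2 ≤ euNorm (lat (y - x)) ^ 2 :=
                pow_le_pow_left₀ hδ.le (not_lt.1 hl) 2
              have h3 : 2 * B ≤ 2 * B / δ ^ 2 * euNorm (lat (y - x)) ^ 2 := by
                rw [div_mul_eq_mul_div, le_div_iff₀ (by positivity)]
                gcongr
              linarith
          rw [Real.enorm_eq_ofReal_abs]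
          calc _ ≤ ENNReal.ofReal (K n (x - y)) * (ENNReal.ofReal τ + ENNReal.ofReal (2 * B / δ ^ 2) *
              ENNReal.ofReal (euNorm (lat (y - x)) ^ 2)) := by gcongr
            _ = _ := by ring
      _ ≤ _ := by
          rw [lintegral_add_left (hKm.const_mul _), lintegral_const_mul' _ _ ENNReal.ofReal_ne_top,
            lintegral_const_mul' _ _ ENNReal.ofReal_ne_top, ker_mass (K n) (L n) (hK n) x, mul_one]
          gcongr
  rw [ENNReal.tendsto_nhds_zero]
  intro e he
  obtain ⟨τ, hτ0, hτ⟩ : ∃ τ : ℝ, 0 < τ ∧ ENNReal.ofReal τ ≤ e / 2 := by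
    rcases eq_or_ne e ∞ with rfl | hne
    · exact ⟨1, one_pos, by simp [ENNReal.top_div]⟩
    · refine ⟨(e / 2).toReal, ENNReal.toReal_pos (by simpa using he.ne') ?_, ENNReal.ofReal_toReal_le⟩
      exact (ENNReal.div_lt_top hne (by simp)).ne
  obtain ⟨A, hA⟩ := key τ hτ0
  have h2 : Filter.Tendsto (fun n => ENNReal.ofReal A * M n) Filter.atTop (nhds 0) := by
    have := ENNReal.Tendsto.const_mul hM0 (a := ENNReal.ofReal A) (Or.inr ENNReal.ofReal_ne_top)
    simpa using this
  have he2 : 0 < e / 2 := ENNReal.div_pos he.ne' (by simp)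
  filter_upwards [(ENNReal.tendsto_nhds_zero.1 h2) (e / 2) he2] with n hn
  calc _ ≤ _ := hA n
    _ ≤ e / 2 + e / 2 := add_le_add hτ hn
    _ = e := ENNReal.add_halves e

lemma mol_sub (k f g : (Fin d → ℝ) → ℝ) (hk : Continuous k) (hp : SpacePeriodic k)
    (hf : Integrable f (cubeVol d)) (hg : Integrable g (cubeVol d)) (x : Fin d → ℝ) :
    mol k (fun y => f y - g y) x = mol k f x - mol k g x := by
  unfold mol
  rw [← integral_sub (mol_integrable k f hk hp hf x) (mol_integrable k g hk hp hg x)]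
  exact integral_congr_ae (Filter.Eventually.of_forall fun y => by simp only [mul_sub])

section
variable (K : ℕ → (Fin d → ℝ) → ℝ) (L : ℕ → ℝ) (hK : ∀ n, IsKer (K n) (L n))
    (M : ℕ → ℝ≥0∞) (hM : ∀ n, ∫⁻ h, ENNReal.ofReal (K n h) * ENNReal.ofReal (euNorm (lat h) ^ 2)
      ∂(cubeVol d) ≤ M n) (hM0 : Filter.Tendsto M Filter.atTop (nhds 0))

include hK hM hM0 in
lemma conv_L1c (g : (Fin d → ℝ) → ℝ) (hg : Continuous g) (B : ℝ) (hB : ∀ y, |g y| ≤ B) :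
    Filter.Tendsto (fun n => ∫⁻ x, ENNReal.ofReal |mol (K n) g x - g x| ∂cubeVol d)
      Filter.atTop (nhds 0) := by
  have hgi : Integrable g (cubeVol d) :=
    Integrable.of_bound hg.aestronglyMeasurable B (Filter.Eventually.of_forall hB)
  have hc : ∀ n, Continuous (mol (K n) g) := fun n =>
    mol_cont _ _ (hK n).smooth.continuous (hK n).per hgi
  have hb : ∀ n x, |mol (K n) g x| ≤ B := by
    intro n x
    have := mol_abs (hK n) g (fun _ => B) (integrable_const _) hB x
    rw [mol_const (K n) (L n) (hK n)] at this
    exact this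
  have h := tendsto_lintegral_of_dominated_convergence (μ := cubeVol d)
    (F := fun n x => ENNReal.ofReal |mol (K n) g x - g x|) (f := fun _ => 0)
    (fun _ => ENNReal.ofReal (2 * B))
    (fun n => by have := (hc n).measurable; have := hg.measurable; fun_prop)
    (fun n => Filter.Eventually.of_forall fun x => ENNReal.ofReal_le_ofReal (by
      refine (abs_sub _ _).trans ?_
      linarith [hB x, hb n x]))
    (by rw [lintegral_const]; exact ENNReal.mul_ne_top ENNReal.ofReal_ne_top (measure_ne_top _ _))
    (cube_open_ae.mono fun x hx => conv_pt x hx g hg B hB K L hK M hM hM0)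
  simpa using h

include hK hM hM0 in
lemma conv_L1 (f : (Fin d → ℝ) → ℝ) (hf : Integrable f (cubeVol d)) :
    Filter.Tendsto (fun n => ∫⁻ x, ENNReal.ofReal |mol (K n) f x - f x| ∂cubeVol d)
      Filter.atTop (nhds 0) := by
  rw [ENNReal.tendsto_nhds_zero]
  intro e he
  have he3 : e / 3 ≠ 0 := (ENNReal.div_pos he.ne' (by simp)).ne'
  obtain ⟨g, hgf, hgi⟩ := hf.exists_boundedContinuous_lintegral_sub_le he3
  simp only [Real.enorm_eq_ofReal_abs] at hgf
  have hc := conv_L1c K L hK M hM hM0 g g.continuous ‖g‖ (fun y => g.norm_coe_le_norm y)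
  filter_upwards [(ENNReal.tendsto_nhds_zero.1 hc) (e / 3) (pos_iff_ne_zero.2 he3)] with n hn
  have hkc := (hK n).smooth.continuous
  have hsubi : Integrable (fun y => f y - g y) (cubeVol d) := hf.sub hgi
  have h1 := mol_nn (hK n) (fun y => f y - g y) hsubi 1 le_rfl
  rw [nn_one, nn_one] at h1
  have c1 : Continuous (mol (K n) fun y => f y - g y) := mol_cont _ _ hkc (hK n).per hsubi
  have c2 : Continuous (mol (K n) g) := mol_cont _ _ hkc (hK n).per hgi
  calc _ ≤ ∫⁻ x, (ENNReal.ofReal |mol (K n) (fun y => f y - g y) x| +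
        (ENNReal.ofReal |mol (K n) g x - g x| + ENNReal.ofReal |f x - g x|)) ∂cubeVol d := by
        refine lintegral_mono fun x => ?_
        rw [← ENNReal.ofReal_add (abs_nonneg _) (abs_nonneg _),
          ← ENNReal.ofReal_add (abs_nonneg _) (by positivity)]
        refine ENNReal.ofReal_le_ofReal ?_
        rw [mol_sub _ _ _ hkc (hK n).per hf hgi]
        have e1 : mol (K n) f x - f x = (mol (K n) f x - mol (K n) g x) +
          ((mol (K n) g x - g x) + -(f x - g x)) := by ring
        rw [e1]
        refine (abs_add_le _ _).trans (add_le_add_right ((abs_add_le _ _).trans ?_) _)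
        rw [abs_neg]
    _ ≤ e / 3 + (e / 3 + e / 3) := by
        have m1 : Measurable fun x => ENNReal.ofReal |mol (K n) (fun y => f y - g y) x| := by
          have := c1.measurable; fun_prop
        have m2 : Measurable fun x => ENNReal.ofReal |mol (K n) g x - g x| := by
          have := c2.measurable; have := g.continuous.measurable; fun_prop
        rw [lintegral_add_left m1, lintegral_add_left m2]
        exact add_le_add (h1.trans hgf) (add_le_add hn hgf)
    _ = e := by rw [← add_assoc, ENNReal.add_thirds]

include hK hM hM0 in
lemma tr3 (f : (Fin d → ℝ) → ℝ) (hf : Integrable f (cubeVol d)) (hfm : Measurable f)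
    (hfp : SpacePeriodic f) (g : (Fin d → ℝ) → Fin d → ℝ)
    (hg : ∀ n x i, |mol (dK i (K n)) f x| ≤ |mol (K n) (tame fun y => g y i) x|)
    (r : ℝ) (hr : 1 ≤ r) (h : Fin d → ℝ) :
    nn (cubeVol d) r (fun x => ENNReal.ofReal ‖f (x + h) - f x‖)
      ≤ ENNReal.ofReal (euNorm h) * (d * eLpNorm g (ENNReal.ofReal r) (cubeVol d)) := by
  have hr0 : 0 < r := by linarith
  rw [nn_eq_eLpNorm _ r hr0 (fun x => f (x + h) - f x)]
  have c1 : ∀ n, Continuous (mol (K n) f) := fun n =>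
    mol_cont _ _ (hK n).smooth.continuous (hK n).per hf
  have m1 : ∀ n, AEStronglyMeasurable (fun x => mol (K n) f (x + h) - mol (K n) f x) (cubeVol d) :=
    fun n => by
      have := c1 n
      exact Continuous.aestronglyMeasurable (by fun_prop)
  refine eLpNorm_le_of_tendstoInMeasure (u := Filter.atTop)
    (f := fun n x => mol (K n) f (x + h) - mol (K n) f x)
    (Filter.Eventually.of_forall fun n => ?_) ?_ m1
  · rw [← nn_eq_eLpNorm _ r hr0 (fun x => mol (K n) f (x + h) - mol (K n) f x)]
    exact tr2 (hK n) f hf g (hg n) r hr h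
  · refine tendstoInMeasure_of_tendsto_eLpNorm (p := 1) one_ne_zero m1
      (Measurable.aestronglyMeasurable (by fun_prop)) ?_
    have hc := conv_L1 K L hK M hM hM0 f hf
    have hc2 := hc.add hc
    rw [add_zero] at hc2
    refine tendsto_of_tendsto_of_tendsto_of_le_of_le tendsto_const_nhds hc2
      (fun _ => zero_le) fun n => ?_
    show eLpNorm _ 1 _ ≤ _
    have mm : Measurable fun x => ENNReal.ofReal |mol (K n) f x - f x| := by
      have := (c1 n).measurable; fun_prop
    have hsh := lintegral_cube_shift (fun x => ENNReal.ofReal |mol (K n) f x - f x|)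
      (fun x m => by rw [mol_per _ _ (hK n).per, hfp]) h
    rw [eLpNorm_one_eq_lintegral_enorm]
    calc _ ≤ ∫⁻ x, (ENNReal.ofReal |mol (K n) f (x + h) - f (x + h)|
          + ENNReal.ofReal |mol (K n) f x - f x|) ∂cubeVol d := by
          refine lintegral_mono fun x => ?_
          rw [Real.enorm_eq_ofReal_abs, ← ENNReal.ofReal_add (abs_nonneg _) (abs_nonneg _)]
          refine ENNReal.ofReal_le_ofReal ?_
          simp only [Pi.sub_apply]
          rw [show mol (K n) f (x + h) - mol (K n) f x - (f (x + h) - f x)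
            = (mol (K n) f (x + h) - f (x + h)) - (mol (K n) f x - f x) by ring]
          exact abs_sub _ _
      _ = _ := by
          rw [lintegral_add_right _ mm, hsh]

end

lemma nn_cmul {Ω : Type*} [MeasurableSpace Ω] (μ : Measure Ω) (s : ℝ) (hs : 0 < s)
    (f : Ω → ℝ≥0∞) (a : ℝ≥0∞) (ha : a ≠ ∞) :
    nn μ s (fun x => f x * a) = nn μ s f * a := by
  unfold nn
  simp only [ENNReal.mul_rpow_of_nonneg _ _ hs.le]
  rw [lintegral_mul_const' _ _ (ENNReal.rpow_ne_top_of_nonneg hs.le ha),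
    ENNReal.mul_rpow_of_nonneg _ _ (by positivity), ← ENNReal.rpow_mul,
    mul_one_div_cancel hs.ne', ENNReal.rpow_one]

lemma nn_fin {Ω : Type*} [MeasurableSpace Ω] (μ : Measure Ω) (s : ℝ) (hs : 0 < s)
    (f : Ω → ℝ≥0∞) (hf : Measurable f) (h : nn μ s f ≠ ∞) : ∀ᵐ x ∂μ, f x ≠ ∞ := by
  have h1 : ∫⁻ x, f x ^ s ∂μ ≠ ∞ := by
    rw [← nn_pow μ s hs]
    exact ENNReal.rpow_ne_top_of_nonneg hs.le h
  filter_upwards [ae_lt_top (hf.pow_const s) h1] with x hx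
  intro h2
  rw [h2, ENNReal.top_rpow_of_pos hs] at hx
  exact lt_irrefl _ hx

lemma nn_QK_time {K : (Fin d → ℝ) → ℝ} {L : ℝ} (hK : IsKer K L) (s : ℝ)
    (F : ℝ → (Fin d → ℝ) × (Fin d → ℝ) → ℝ≥0∞) (hF : Measurable (Function.uncurry F)) :
    Measurable fun t => nn (QK K) s (F t) := by
  have := QK_prob hK
  unfold nn
  exact (Measurable.lintegral_prod_right' (f := fun z : ℝ × _ => F z.1 z.2 ^ s)
    (hF.pow_const s)).pow_const _

lemma nn_cube_time (s : ℝ)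
    (F : ℝ → (Fin d → ℝ) → ℝ≥0∞) (hF : Measurable (Function.uncurry F)) :
    Measurable fun t => nn (cubeVol d) s (F t) := by
  unfold nn
  exact (Measurable.lintegral_prod_right' (f := fun z : ℝ × _ => F z.1 z.2 ^ s)
    (hF.pow_const s)).pow_const _

/-- The four Hölder estimates in time. -/
lemma time_hol {Ω : Type*} [MeasurableSpace Ω] (μ : Measure Ω) [IsFiniteMeasure μ]
    (γ p a m : ℝ) (hγ : 1 < γ) (hp : 3 < p)
    (ha : 1 / a = 1 - 3 / p) (ha1 : 1 ≤ a) (ham : a ≤ m) (hm : (γ - 1) / m ≤ 2 / p) :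
    ∃ c : ℝ≥0∞, c ≠ ∞ ∧ ∀ N V D : Ω → ℝ≥0∞, Measurable N → Measurable V → Measurable D →
      (∫⁻ t, N t * V t ^ 3 ∂μ ≤ c * (nn μ m N * nn μ p V ^ 3)) ∧
      (∫⁻ t, N t ^ (γ - 1) * D t * V t ∂μ ≤ c * (nn μ m N ^ (γ - 1) * nn μ a D * nn μ p V)) ∧
      (∫⁻ t, N t * V t ^ 2 ∂μ ≤ c * (nn μ m N * nn μ p V ^ 2)) ∧
      (∫⁻ t, N t ^ (γ - 1) * D t ∂μ ≤ c * (nn μ m N ^ (γ - 1) * nn μ a D)) := by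
  have hp0 : 0 < p := by linarith
  have ha0 : 0 < a := by linarith
  have hm0 : 0 < m := by linarith
  have hma : 1 / m ≤ 1 - 3 / p := by
    rw [← ha]; exact one_div_le_one_div_of_le ha0 ham
  have h3p : 3 / p = 3 * (1 / p) := by ring
  have h2p : 2 / p = 2 * (1 / p) := by ring
  have hpp : 0 < 1 / p := by positivity
  have s1 : 1 / m + 3 / p + 0 / (1:ℝ) ≤ 1 := by linarith
  have s2 : (γ - 1) / m + 1 / a + 1 / p ≤ 1 := by linarith
  have s3 : 1 / m + 2 / p + 0 / (1:ℝ) ≤ 1 := by linarith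
  have s4 : (γ - 1) / m + 1 / a + 0 / (1:ℝ) ≤ 1 := by linarith
  set c1 := (μ Set.univ) ^ (1 - (1 / m + 3 / p + 0 / (1:ℝ))) with hc1
  set c2 := (μ Set.univ) ^ (1 - ((γ - 1) / m + 1 / a + 1 / p)) with hc2
  set c3 := (μ Set.univ) ^ (1 - (1 / m + 2 / p + 0 / (1:ℝ))) with hc3
  set c4 := (μ Set.univ) ^ (1 - ((γ - 1) / m + 1 / a + 0 / (1:ℝ))) with hc4
  have f1 : c1 ≠ ∞ := ENNReal.rpow_ne_top_of_nonneg (by linarith) (measure_ne_top _ _)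
  have f2 : c2 ≠ ∞ := ENNReal.rpow_ne_top_of_nonneg (by linarith) (measure_ne_top _ _)
  have f3 : c3 ≠ ∞ := ENNReal.rpow_ne_top_of_nonneg (by linarith) (measure_ne_top _ _)
  have f4 : c4 ≠ ∞ := ENNReal.rpow_ne_top_of_nonneg (by linarith) (measure_ne_top _ _)
  refine ⟨c1 + c2 + c3 + c4, by simp [f1, f2, f3, f4], fun N V D hN hV hD => ?_⟩
  have g1 : c1 ≤ c1 + c2 + c3 + c4 := by
    rw [add_assoc, add_assoc]; exact le_self_add
  have g2 : c2 ≤ c1 + c2 + c3 + c4 := by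
    rw [add_assoc]; exact le_add_self.trans le_self_add
  have g3 : c3 ≤ c1 + c2 + c3 + c4 := le_add_self.trans le_self_add
  have g4 : c4 ≤ c1 + c2 + c3 + c4 := le_add_self
  have i1 := hol3 μ N V V hN.aemeasurable hV.aemeasurable hV.aemeasurable 1 3 0 m p 1
    zero_le_one (by norm_num) le_rfl hm0 hp0 one_pos s1
  have i2 := hol3 μ N D V hN.aemeasurable hD.aemeasurable hV.aemeasurable (γ - 1) 1 1 m a p
    (by linarith) zero_le_one zero_le_one hm0 ha0 hp0 s2
  have i3 := hol3 μ N V V hN.aemeasurable hV.aemeasurable hV.aemeasurable 1 2 0 m p 1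
    zero_le_one (by norm_num) le_rfl hm0 hp0 one_pos s3
  have i4 := hol3 μ N D V hN.aemeasurable hD.aemeasurable hV.aemeasurable (γ - 1) 1 0 m a 1
    (by linarith) zero_le_one le_rfl hm0 ha0 one_pos s4
  have e3 : ∀ x : ℝ≥0∞, x ^ (3:ℝ) = x ^ 3 := fun x => by
    rw [← ENNReal.rpow_natCast]; norm_num
  have e2 : ∀ x : ℝ≥0∞, x ^ (2:ℝ) = x ^ 2 := fun x => by
    rw [← ENNReal.rpow_natCast]; norm_num
  simp only [ENNReal.rpow_one, ENNReal.rpow_zero, mul_one, e3, e2] at i1 i2 i3 i4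
  refine ⟨i1.trans ?_, i2.trans ?_, i3.trans ?_, i4.trans ?_⟩
  · rw [mul_comm]; exact mul_le_mul_left g1 _
  · rw [mul_comm]; exact mul_le_mul_left g2 _
  · rw [mul_comm]; exact mul_le_mul_left g3 _
  · rw [mul_comm]; exact mul_le_mul_left g4 _

section
variable (T : ℝ) (hT : 0 < T) (γ : ℝ) (hγ : 1 < γ)
    (ρ : ℝ → (Fin d → ℝ) → ℝ) (v : ℝ → (Fin d → ℝ) → Fin d → ℝ)
    (ρ₀ : (Fin d → ℝ) → ℝ) (v₀ : (Fin d → ℝ) → Fin d → ℝ)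
    (hsol : IsWeakSolution d T γ ρ v ρ₀ v₀)
    (c : ℝ) (hc : 0 < c) (hlow : ∀ᵐ z ∂(spaceTime d T), c ≤ ρ z.1 z.2)

include hsol in
lemma dU_time_meas {K : (Fin d → ℝ) → ℝ} {L : ℝ} (hK : IsKer K L) (q : ℝ) :
    Measurable fun t => nn (QK K) q (dU (v t)) := by
  refine nn_QK_time hK q _ ?_
  have h := hsol.v_meas
  have h1 : Measurable fun z : ℝ × ((Fin d → ℝ) × (Fin d → ℝ)) => v z.1 z.2.1 :=
    h.comp (by fun_prop : Measurable fun z : ℝ × ((Fin d → ℝ) × (Fin d → ℝ)) => (z.1, z.2.1))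
  have h2 : Measurable fun z : ℝ × ((Fin d → ℝ) × (Fin d → ℝ)) => v z.1 z.2.2 :=
    h.comp (by fun_prop : Measurable fun z : ℝ × ((Fin d → ℝ) × (Fin d → ℝ)) => (z.1, z.2.2))
  exact (h2.sub h1).norm.ennreal_ofReal

include hsol in
lemma dR_time_meas {K : (Fin d → ℝ) → ℝ} {L : ℝ} (hK : IsKer K L) (s : ℝ) :
    Measurable fun t => nn (QK K) s (dR (ρ t)) := by
  refine nn_QK_time hK s _ ?_
  have h := hsol.rho_meas
  have h1 : Measurable fun z : ℝ × ((Fin d → ℝ) × (Fin d → ℝ)) => ρ z.1 z.2.1 :=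
    h.comp (by fun_prop : Measurable fun z : ℝ × ((Fin d → ℝ) × (Fin d → ℝ)) => (z.1, z.2.1))
  have h2 : Measurable fun z : ℝ × ((Fin d → ℝ) × (Fin d → ℝ)) => ρ z.1 z.2.2 :=
    h.comp (by fun_prop : Measurable fun z : ℝ × ((Fin d → ℝ) × (Fin d → ℝ)) => (z.1, z.2.2))
  exact (h2.sub h1).norm.ennreal_ofReal

include hsol in
lemma rho_time_meas (s : ℝ) :
    Measurable fun t => nn (cubeVol d) s (fun y => ENNReal.ofReal (ρ t y)) :=
  nn_cube_time s _ (hsol.rho_meas.ennreal_ofReal)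

include hsol in
lemma energy_meas : Measurable fun t => energyAt d γ ρ v t := by
  have h1 : Measurable fun z : ℝ × (Fin d → ℝ) => ρ z.1 z.2 := hsol.rho_meas
  have h2 : Measurable fun z : ℝ × (Fin d → ℝ) => euNorm (v z.1 z.2) :=
    euNorm_meas.comp hsol.v_meas
  have h3 : Measurable fun z : ℝ × (Fin d → ℝ) => ((1 / 2 : ℝ) * ρ z.1 z.2 * euNorm (v z.1 z.2) ^ 2
      + (kappa γ / (γ - 1)) * ρ z.1 z.2 ^ γ) :=
    ((h1.const_mul _).mul (h2.pow_const 2)).add ((h1.pow_const γ).const_mul _)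
  exact (StronglyMeasurable.integral_prod_right' (ν := cubeVol d) h3.stronglyMeasurable).measurable

include hγ hsol hlow in
lemma energy_bdd : ∃ B : ℝ, ∀ᵐ t ∂(volume.restrict (Set.Ioo 0 T)), |energyAt d γ ρ v t| ≤ B := by
  obtain ⟨C, hC⟩ := slices_ae T γ ρ v ρ₀ v₀ hsol c hlow
  have hk : 0 < kappa γ / (γ - 1) := div_pos (kappa_pos γ hγ) (by linarith)
  refine ⟨1 / 2 * C + kappa γ / (γ - 1) * C, ?_⟩
  filter_upwards [hC] with t ht
  obtain ⟨hs, h1, h2⟩ := ht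
  have e : energyAt d γ ρ v t = 1 / 2 * (∫ x, ρ t x * euNorm (v t x) ^ 2 ∂cubeVol d)
      + kappa γ / (γ - 1) * ∫ x, ρ t x ^ γ ∂cubeVol d := by
    rw [← integral_const_mul, ← integral_const_mul,
      ← integral_add (hs.iki.const_mul _) (hs.ipi.const_mul _)]
    refine integral_congr_ae (Filter.Eventually.of_forall fun x => ?_)
    simp only; ring
  have p1 : 0 ≤ ∫ x, ρ t x * euNorm (v t x) ^ 2 ∂cubeVol d :=
    integral_nonneg fun x => mul_nonneg (hs.r0 x) (by positivity)
  have p2 : 0 ≤ ∫ x, ρ t x ^ γ ∂cubeVol d :=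
    integral_nonneg fun x => Real.rpow_nonneg (hs.r0 x) _
  rw [e, abs_of_nonneg (by positivity)]
  gcongr

include hT hγ hsol hc hlow in
lemma kern_est {K : (Fin d → ℝ) → ℝ} {L : ℝ} (hK : IsKer K L) (p q a s m mp : ℝ)
    (he : Exps γ q s m) (hsm : s ≤ m) (hp0 : 0 < p) (hmp : 0 < mp)
    (cH X Bv Bd : ℝ≥0∞) (hcH : cH ≠ ∞) (hX : X ≠ ∞) (hBv : Bv ≠ ∞) (hBd : Bd ≠ ∞)
    (HH : ∀ N V D : ℝ → ℝ≥0∞, Measurable N → Measurable V → Measurable D →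
      (∫⁻ t in Set.Ioo 0 T, N t * V t ^ 3 ≤ cH *
        (nn (volume.restrict (Set.Ioo 0 T)) mp N * nn (volume.restrict (Set.Ioo 0 T)) p V ^ 3)) ∧
      (∫⁻ t in Set.Ioo 0 T, N t ^ (γ - 1) * D t * V t ≤ cH *
        (nn (volume.restrict (Set.Ioo 0 T)) mp N ^ (γ - 1) * nn (volume.restrict (Set.Ioo 0 T)) a D
          * nn (volume.restrict (Set.Ioo 0 T)) p V)) ∧
      (∫⁻ t in Set.Ioo 0 T, N t * V t ^ 2 ≤ cH *
        (nn (volume.restrict (Set.Ioo 0 T)) mp N * nn (volume.restrict (Set.Ioo 0 T)) p V ^ 2)) ∧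
      (∫⁻ t in Set.Ioo 0 T, N t ^ (γ - 1) * D t ≤ cH *
        (nn (volume.restrict (Set.Ioo 0 T)) mp N ^ (γ - 1)
          * nn (volume.restrict (Set.Ioo 0 T)) a D)))
    (hN : nn (volume.restrict (Set.Ioo 0 T)) mp
      (fun t => nn (cubeVol d) m (fun y => ENNReal.ofReal (ρ t y))) ≤ X)
    (hV : nn (volume.restrict (Set.Ioo 0 T)) p (fun t => nn (QK K) q (dU (v t))) ≤ Bv)
    (hD : nn (volume.restrict (Set.Ioo 0 T)) a (fun t => nn (QK K) s (dR (ρ t))) ≤ Bd)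
    (χ : ℝ → ℝ) (hχ : ContDiff ℝ (⊤ : ℕ∞) χ) (hχs : TSupp T χ) (A0 A1 : ℝ)
    (hA0 : ∀ t ∈ Set.Ioo 0 T, |χ t| ≤ A0) (hA1 : ∀ t ∈ Set.Ioo 0 T, |deriv χ t| ≤ A1) :
    ENNReal.ofReal |∫ t in Set.Ioo 0 T, deriv χ t * energyAt d γ ρ v t| ≤
      ENNReal.ofReal A0 * (ENNReal.ofReal ((d:ℝ)^2 * (2 * L)) * (2 * (cH * (X * Bv ^ 3))
        + ENNReal.ofReal (kappa γ) * (ENNReal.ofReal (4 * γ) * (2 * (cH * (X ^ (γ - 1) * Bd * Bv))))))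
      + ENNReal.ofReal A1 * (ENNReal.ofReal d * (cH * (X * Bv ^ 2))
        + ENNReal.ofReal (kappa γ / (γ - 1)) * (ENNReal.ofReal γ * (4 * (cH * (X ^ (γ - 1) * Bd))))) := by
  set μ := volume.restrict (Set.Ioo 0 T) with hμ
  set k := kappa γ / (γ - 1) with hk
  have hγ1 : 0 < γ - 1 := by linarith
  have hk0 : 0 < k := div_pos (kappa_pos γ hγ) hγ1
  have hkk : k * (γ - 1) = kappa γ := by rw [hk]; field_simp
  set N : ℝ → ℝ≥0∞ := fun t => nn (cubeVol d) m (fun y => ENNReal.ofReal (ρ t y)) with hNd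
  set V : ℝ → ℝ≥0∞ := fun t => nn (QK K) q (dU (v t)) with hVd
  set D : ℝ → ℝ≥0∞ := fun t => nn (QK K) s (dR (ρ t)) with hDd
  have mN : Measurable N := rho_time_meas T γ ρ v ρ₀ v₀ hsol m
  have mV : Measurable V := dU_time_meas T γ ρ v ρ₀ v₀ hsol hK q
  have mD : Measurable D := dR_time_meas T γ ρ v ρ₀ v₀ hsol hK s
  obtain ⟨H1, H2, H3, H4⟩ := HH N V D mN mV mD
  have H1' : ∫⁻ t, N t * V t ^ 3 ∂μ ≤ cH * (X * Bv ^ 3) := H1.trans (by gcongr)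
  have H2' : ∫⁻ t, N t ^ (γ - 1) * D t * V t ∂μ ≤ cH * (X ^ (γ - 1) * Bd * Bv) :=
    H2.trans (by gcongr)
  have H3' : ∫⁻ t, N t * V t ^ 2 ∂μ ≤ cH * (X * Bv ^ 2) := H3.trans (by gcongr)
  have H4' : ∫⁻ t, N t ^ (γ - 1) * D t ∂μ ≤ cH * (X ^ (γ - 1) * Bd) := H4.trans (by gcongr)
  have fN := nn_fin μ mp hmp N mN (ne_top_of_le_ne_top hX hN)
  have fV := nn_fin μ p hp0 V mV (ne_top_of_le_ne_top hBv hV)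
  obtain ⟨C, hC⟩ := slices_ae T γ ρ v ρ₀ v₀ hsol c hlow
  have hIoo : ∀ᵐ t ∂μ, t ∈ Set.Ioo 0 T := ae_restrict_mem measurableSet_Ioo
  set en : ℝ → ℝ := fun t => energyAt d γ ρ v t with hen
  set e : ℝ → ℝ := fun t => ∫ x, Eden k γ K (ρ t) (v t) x ∂cubeVol d with hee
  have NrN : ∀ t, nn (cubeVol d) s (fun y => ENNReal.ofReal (ρ t y)) ≤ N t := by
    intro t
    have : Measurable fun y => ENNReal.ofReal (ρ t y) :=
      (hsol.rho_meas.comp measurable_prodMk_left).ennreal_ofReal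
    exact nn_exp _ _ this.aemeasurable s m (by linarith [he.r1]) hsm
  -- slice estimates
  have S1 : ∀ᵐ t ∂μ, ENNReal.ofReal |∫ x, Sden k γ K (ρ t) (v t) x ∂cubeVol d| ≤
      ENNReal.ofReal ((d:ℝ)^2 * (2 * L)) * (2 * (N t * V t ^ 3)
        + ENNReal.ofReal (kappa γ) * (ENNReal.ofReal (4 * γ) * (2 * (N t ^ (γ - 1) * D t * V t)))) := by
    filter_upwards [fN, fV, hC] with t h1 h2 h3
    refine (slice1 hK he hc h3.1 k hkk (ne_top_of_le_ne_top h1 (NrN t)) h2).trans ?_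
    have := NrN t
    gcongr
  have S2 : ∀ᵐ t ∂μ, ENNReal.ofReal |e t - en t| ≤ ENNReal.ofReal d * (N t * V t ^ 2)
      + ENNReal.ofReal k * (ENNReal.ofReal γ * (4 * (N t ^ (γ - 1) * D t))) := by
    filter_upwards [fN, fV, hC] with t h1 h2 h3
    refine (slice2 hK he hc h3.1 k hk0.le (ne_top_of_le_ne_top h1 (NrN t)) h2).trans ?_
    have := NrN t
    gcongr
  have T1 : ∫⁻ t, ENNReal.ofReal |∫ x, Sden k γ K (ρ t) (v t) x ∂cubeVol d| ∂μ ≤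
      ENNReal.ofReal ((d:ℝ)^2 * (2 * L)) * (2 * (cH * (X * Bv ^ 3))
        + ENNReal.ofReal (kappa γ) * (ENNReal.ofReal (4 * γ) * (2 * (cH * (X ^ (γ - 1) * Bd * Bv))))) := by
    refine (lintegral_mono_ae S1).trans ?_
    rw [lintegral_const_mul' _ _ ENNReal.ofReal_ne_top, lintegral_add_left (by fun_prop),
      lintegral_const_mul' _ _ (by simp), lintegral_const_mul' _ _ ENNReal.ofReal_ne_top,
      lintegral_const_mul' _ _ ENNReal.ofReal_ne_top, lintegral_const_mul' _ _ (by simp)]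
    gcongr
  have T2 : ∫⁻ t, ENNReal.ofReal |e t - en t| ∂μ ≤ ENNReal.ofReal d * (cH * (X * Bv ^ 2))
        + ENNReal.ofReal k * (ENNReal.ofReal γ * (4 * (cH * (X ^ (γ - 1) * Bd)))) := by
    refine (lintegral_mono_ae S2).trans ?_
    rw [lintegral_add_left (by fun_prop),
      lintegral_const_mul' _ _ ENNReal.ofReal_ne_top, lintegral_const_mul' _ _ ENNReal.ofReal_ne_top,
      lintegral_const_mul' _ _ ENNReal.ofReal_ne_top, lintegral_const_mul' _ _ (by simp)]
    gcongr
  have hχ' : Continuous (deriv χ) := hχ.continuous_deriv (by simp)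
  have hγp : X ^ (γ - 1) ≠ ∞ := ENNReal.rpow_ne_top_of_nonneg hγ1.le hX
  have T2f : ∫⁻ t, ENNReal.ofReal |e t - en t| ∂μ < ∞ := by
    refine T2.trans_lt (ENNReal.add_lt_top.2 ⟨?_, ?_⟩)
    · exact ENNReal.mul_lt_top ENNReal.ofReal_lt_top (ENNReal.mul_lt_top hcH.lt_top
        (ENNReal.mul_lt_top hX.lt_top (ENNReal.pow_lt_top hBv.lt_top)))
    · exact ENNReal.mul_lt_top ENNReal.ofReal_lt_top (ENNReal.mul_lt_top ENNReal.ofReal_lt_top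
        (ENNReal.mul_lt_top (by simp) (ENNReal.mul_lt_top hcH.lt_top
          (ENNReal.mul_lt_top hγp.lt_top hBd.lt_top))))
  have me : Measurable e := (StronglyMeasurable.integral_prod_right' (ν := cubeVol d)
    (Eden_meas T γ ρ v ρ₀ v₀ hsol k K L hK).stronglyMeasurable).measurable
  have men : Measurable en := energy_meas T γ ρ v ρ₀ v₀ hsol
  have idiff : Integrable (fun t => e t - en t) μ := by
    refine ⟨(me.sub men).aestronglyMeasurable, ?_⟩
    show ∫⁻ t, ‖e t - en t‖ₑ ∂μ < ∞
    simpa only [Real.enorm_eq_ofReal_abs] using T2f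
  obtain ⟨B, hB⟩ := energy_bdd T γ hγ ρ v ρ₀ v₀ hsol c hlow
  have ien : Integrable en μ := Integrable.of_bound men.aestronglyMeasurable B hB
  have bm : ∀ f : ℝ → ℝ, Integrable f μ → Integrable (fun t => deriv χ t * f t) μ := by
    intro f hf
    refine Integrable.bdd_mul (c := A1) hf hχ'.aestronglyMeasurable ?_
    filter_upwards [hIoo] with t ht
    exact hA1 t ht
  have hid := identity T hT γ hγ ρ v ρ₀ v₀ hsol c hc hlow k K L hK χ hχ hχs
  have dec : ∫ t, deriv χ t * en t ∂μ = -(∫ t, χ t * ∫ x, Sden k γ K (ρ t) (v t) x ∂cubeVol d ∂μ)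
      - ∫ t, deriv χ t * (e t - en t) ∂μ := by
    rw [← hid]
    have h1 := integral_add (bm _ ien) (bm _ idiff)
    have h2 : ∫ t, deriv χ t * e t ∂μ = ∫ t, (deriv χ t * en t + deriv χ t * (e t - en t)) ∂μ :=
      integral_congr_ae (Filter.Eventually.of_forall fun t => by simp only; ring)
    show _ = (∫ t, deriv χ t * e t ∂μ) - _
    rw [h2, h1]; ring
  rw [dec]
  have tri : ∀ x y : ℝ, ENNReal.ofReal |-x - y| ≤ ENNReal.ofReal |x| + ENNReal.ofReal |y| := by
    intro x y
    rw [← ENNReal.ofReal_add (abs_nonneg _) (abs_nonneg _)]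
    refine ENNReal.ofReal_le_ofReal ((abs_sub _ _).trans ?_)
    rw [abs_neg]
  refine (tri _ _).trans ?_
  have bb : ∀ (f g : ℝ → ℝ) (A : ℝ), (∀ t ∈ Set.Ioo 0 T, |f t| ≤ A) →
      ENNReal.ofReal |∫ t, f t * g t ∂μ| ≤ ENNReal.ofReal A * ∫⁻ t, ENNReal.ofReal |g t| ∂μ := by
    intro f g A hf
    rw [← Real.enorm_eq_ofReal_abs, ← lintegral_const_mul' _ _ ENNReal.ofReal_ne_top]
    refine (enorm_integral_le_lintegral_enorm _).trans (lintegral_mono_ae ?_)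
    filter_upwards [hIoo] with t ht
    rw [Real.enorm_eq_ofReal_abs, abs_mul, ENNReal.ofReal_mul (abs_nonneg _)]
    gcongr
    exact hf t ht
  refine add_le_add ((bb _ _ A0 hA0).trans ?_) ((bb _ _ A1 hA1).trans ?_)
  · exact mul_le_mul_right T1 _
  · exact mul_le_mul_right T2 _

end

lemma eps_pow_tendsto (ε : ℕ → ℝ) (hε : Filter.Tendsto ε Filter.atTop (nhds 0)) (β : ℝ) (hβ : 0 < β)
    (k : ℝ≥0∞) (hk : k ≠ ∞) :
    Filter.Tendsto (fun n => k * ENNReal.ofReal (ε n ^ β)) Filter.atTop (nhds 0) := by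
  have h1 : Filter.Tendsto (fun n => ε n ^ β) Filter.atTop (nhds 0) := by
    have := hε.rpow_const (p := β) (Or.inr hβ.le)
    rwa [Real.zero_rpow hβ.ne'] at this
  have h2 := ENNReal.tendsto_ofReal h1
  rw [ENNReal.ofReal_zero] at h2
  have h3 := ENNReal.Tendsto.const_mul (a := k) h2 (Or.inr hk)
  rwa [mul_zero] at h3

/-- The final limit. -/
lemma lim_aux (x A0 A1 LL cH X Xg BV BD k1 k2 k3 k4 k5 : ℝ≥0∞) (hA0 : A0 ≠ ∞) (hA1 : A1 ≠ ∞)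
    (hLL : LL ≠ ∞) (hcH : cH ≠ ∞) (hX : X ≠ ∞) (hXg : Xg ≠ ∞) (hBV : BV ≠ ∞) (hBD : BD ≠ ∞)
    (h1 : k1 ≠ ∞) (h2 : k2 ≠ ∞) (h3 : k3 ≠ ∞) (h4 : k4 ≠ ∞) (h5 : k5 ≠ ∞)
    (ε : ℕ → ℝ) (hε0 : ∀ n, 0 < ε n) (hε : Filter.Tendsto ε Filter.atTop (nhds 0))
    (α : ℝ) (hα : 1 / 3 < α)
    (h : ∀ n, x ≤ A0 * (LL * ENNReal.ofReal (ε n)⁻¹ * (2 * (cH * (X * (BV * ENNReal.ofReal (ε n ^ α)) ^ 3))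
        + k1 * (k2 * (2 * (cH * (Xg * (BD * ENNReal.ofReal (ε n)) * (BV * ENNReal.ofReal (ε n ^ α))))))))
      + A1 * (k3 * (cH * (X * (BV * ENNReal.ofReal (ε n ^ α)) ^ 2))
        + k4 * (k5 * (4 * (cH * (Xg * (BD * ENNReal.ofReal (ε n)))))))) : x = 0 := by
  have hb : ∀ n, x ≤ (A0 * LL * 2 * cH * X * BV ^ 3) * ENNReal.ofReal (ε n ^ (3 * α - 1))
      + (A0 * LL * k1 * k2 * 2 * cH * Xg * BD * BV) * ENNReal.ofReal (ε n ^ α)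
      + (A1 * k3 * cH * X * BV ^ 2) * ENNReal.ofReal (ε n ^ (2 * α))
      + (A1 * k4 * k5 * 4 * cH * Xg * BD) * ENNReal.ofReal (ε n ^ (1:ℝ)) := by
    intro n
    refine (h n).trans_eq ?_
    have hn := hε0 n
    have e1 : ENNReal.ofReal (ε n ^ (3 * α - 1))
        = ENNReal.ofReal (ε n)⁻¹ * ENNReal.ofReal (ε n ^ α) ^ 3 := by
      rw [← ENNReal.ofReal_pow (by positivity), ← ENNReal.ofReal_mul (by positivity)]
      congr 1
      rw [Real.rpow_sub hn, Real.rpow_one, ← Real.rpow_mul_natCast hn.le, mul_comm (3:ℝ) α]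
      push_cast
      field_simp
    have e2 : ENNReal.ofReal (ε n ^ (2 * α)) = ENNReal.ofReal (ε n ^ α) ^ 2 := by
      rw [← ENNReal.ofReal_pow (by positivity)]
      congr 1
      rw [← Real.rpow_mul_natCast hn.le, mul_comm (2:ℝ) α]
      push_cast
      rfl
    have e3 : ENNReal.ofReal (ε n)⁻¹ * ENNReal.ofReal (ε n) = 1 := by
      rw [← ENNReal.ofReal_mul (by positivity), inv_mul_cancel₀ hn.ne', ENNReal.ofReal_one]
    rw [e1, e2, Real.rpow_one]
    have e4 : (A0 * LL * k1 * k2 * 2 * cH * Xg * BD * BV) * ENNReal.ofReal (ε n ^ α)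
      = (A0 * LL * k1 * k2 * 2 * cH * Xg * BD * BV) * ENNReal.ofReal (ε n ^ α) *
        (ENNReal.ofReal (ε n)⁻¹ * ENNReal.ofReal (ε n)) := by rw [e3, mul_one]
    rw [e4]
    ring
  have t : Filter.Tendsto (fun n => (A0 * LL * 2 * cH * X * BV ^ 3) * ENNReal.ofReal (ε n ^ (3 * α - 1))
      + (A0 * LL * k1 * k2 * 2 * cH * Xg * BD * BV) * ENNReal.ofReal (ε n ^ α)
      + (A1 * k3 * cH * X * BV ^ 2) * ENNReal.ofReal (ε n ^ (2 * α))
      + (A1 * k4 * k5 * 4 * cH * Xg * BD) * ENNReal.ofReal (ε n ^ (1:ℝ))) Filter.atTop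
      (nhds (0 + 0 + 0 + 0)) := by
    refine Filter.Tendsto.add (Filter.Tendsto.add (Filter.Tendsto.add ?_ ?_) ?_) ?_
    · exact eps_pow_tendsto ε hε _ (by linarith) _
        (by repeat' (first | assumption | exact ENNReal.ofNat_ne_top | apply ENNReal.mul_ne_top | apply ENNReal.pow_ne_top))
    · exact eps_pow_tendsto ε hε _ (by linarith) _
        (by repeat' (first | assumption | exact ENNReal.ofNat_ne_top | apply ENNReal.mul_ne_top | apply ENNReal.pow_ne_top))
    · exact eps_pow_tendsto ε hε _ (by linarith) _
        (by repeat' (first | assumption | exact ENNReal.ofNat_ne_top | apply ENNReal.mul_ne_top | apply ENNReal.pow_ne_top))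
    · exact eps_pow_tendsto ε hε _ (by linarith) _
        (by repeat' (first | assumption | exact ENNReal.ofNat_ne_top | apply ENNReal.mul_ne_top | apply ENNReal.pow_ne_top))
  simp only [add_zero] at t
  exact le_antisymm (ge_of_tendsto' t hb) zero_le

lemma mom_root (C ε β s : ℝ) (hC : 0 < C) (hε : 0 < ε) (hs : 0 < s) :
    ENNReal.ofReal (C * ε ^ (β * s)) ^ (1 / s) = ENNReal.ofReal (C ^ (1 / s)) * ENNReal.ofReal (ε ^ β) := by
  rw [ENNReal.ofReal_rpow_of_nonneg (by positivity) (by positivity), ← ENNReal.ofReal_mul (by positivity),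
    Real.mul_rpow hC.le (by positivity), ← Real.rpow_mul hε.le]
  congr 3
  field_simp

lemma exp_aux (q : ℝ) (hq : 3 < q) : 1 ≤ q / (q - 3) ∧ 1 / (q / (q - 3)) = 1 - 3 / q := by
  have h : 0 < q - 3 := by linarith
  constructor
  · rw [le_div_iff₀ h]; linarith
  · field_simp

lemma exp_aux2 (γ q x : ℝ) (hγ : 1 < γ) (hq : 3 < q) : (γ - 1) / max x (q * (γ - 1) / 2) ≤ 2 / q := by
  have h1 : 0 < q * (γ - 1) / 2 := by
    have : 0 < γ - 1 := by linarith
    positivity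
  have h2 := le_max_right x (q * (γ - 1) / 2)
  rw [div_le_div_iff₀ (h1.trans_le h2) (by linarith)]
  linarith

/-- **Theorem 1.1** (local energy conservation, non-vacuum case).
If `(ρ,v)` is a weak solution of the isentropic compressible Euler equations on
`(0,T) × 𝕋^d` with `ρ ≥ c > 0` a.e.,
`ρ ∈ L^{max{p/(p-3), p(γ-1)/2}}(0,T;L^{max{q/(q-3), q(γ-1)/2}})`,
`∇ρ, ∂ₜρ ∈ L^{p/(p-3)}(0,T;L^{q/(q-3)})` and `v ∈ L^p(0,T;B^α_{q,∞})` with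
`α > 1/3`, `p,q > 3`, then the energy is locally conserved. -/
theorem local_energy_conservation_nonvacuum
    (d : ℕ) (hd : 2 ≤ d) (T : ℝ) (hT : 0 < T) (γ : ℝ) (hγ : 1 < γ)
    (p q : ℝ) (hp : 3 < p) (hq : 3 < q) (α : ℝ) (hα : 1 / 3 < α)
    (ρ : ℝ → (Fin d → ℝ) → ℝ) (v : ℝ → (Fin d → ℝ) → Fin d → ℝ)
    (ρ₀ : (Fin d → ℝ) → ℝ) (v₀ : (Fin d → ℝ) → Fin d → ℝ)
    (hsol : IsWeakSolution d T γ ρ v ρ₀ v₀)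
    (c : ℝ) (hc : 0 < c)
    (hlow : ∀ᵐ z ∂(spaceTime d T), c ≤ ρ z.1 z.2)
    (hρ : MemLpLq T (ENNReal.ofReal (max (p / (p - 3)) (p * (γ - 1) / 2)))
      (ENNReal.ofReal (max (q / (q - 3)) (q * (γ - 1) / 2))) ρ)
    (hgradρ : GradInLpLq T (ENNReal.ofReal (p / (p - 3))) (ENNReal.ofReal (q / (q - 3))) ρ)
    (hdtρ : DtInLpLq T (ENNReal.ofReal (p / (p - 3))) (ENNReal.ofReal (q / (q - 3))) ρ)
    (hv : MemLpBesov T (ENNReal.ofReal p) α (ENNReal.ofReal q) v) :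
    ∀ φ : ℝ → ℝ, ContDiff ℝ (⊤ : ℕ∞) φ →
      (∃ a b : ℝ, 0 < a ∧ b < T ∧ ∀ t, t ∉ Set.Icc a b → φ t = 0) →
      ∫ t in Set.Ioo 0 T, deriv φ t * energyAt d γ ρ v t = 0 := by
  intro φ hφ hφs
  have ⟨hs1, hsq⟩ := exp_aux q hq
  have ⟨ha1, hap⟩ := exp_aux p hp
  set s := q / (q - 3) with hs
  set a := p / (p - 3) with ha
  have hmq := exp_aux2 γ q s hγ hq
  have hmp := exp_aux2 γ p a hγ hp
  have hsm := le_max_left s (q * (γ - 1) / 2)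
  have ham := le_max_left a (p * (γ - 1) / 2)
  set m := max s (q * (γ - 1) / 2) with hm
  set mp := max a (p * (γ - 1) / 2) with hmpd
  have he : Exps γ q s m := ⟨hγ, hq, hs1, hsq, hs1.trans hsm, hmq⟩
  have hp0 : 0 < p := by linarith
  have hq0 : 0 < q := by linarith
  have hs0 : 0 < s := by linarith
  have ha0 : 0 < a := by linarith
  have hm0 : 0 < m := by linarith
  have hmp0 : 0 < mp := by linarith
  have hα0 : 0 < α := by linarith
  set μ := volume.restrict (Set.Ioo 0 T) with hμ
  -- finiteness
  set X := nn μ mp (fun t => nn (cubeVol d) m (fun y => ENNReal.ofReal (ρ t y))) with hXd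
  have hX : X ≠ ∞ := by
    unfold MemLpLq LpLqNorm timeLpOn at hρ
    rw [if_neg ENNReal.ofReal_ne_top, ENNReal.toReal_ofReal hmp0.le] at hρ
    refine ne_of_lt (lt_of_eq_of_lt ?_ hρ)
    rw [hXd]
    unfold nn
    congr 1
    refine lintegral_congr fun t => ?_
    congr 1
    simp only
    rw [← nn_eq_eLpNorm _ m hm0]
    unfold nn
    congr 1
    refine lintegral_congr fun x => ?_
    simp only
    rw [Real.norm_of_nonneg (hsol.rho_nonneg t x)]
  set Y := nn μ p (fun t => besovNorm α (ENNReal.ofReal q) (v t)) with hYd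
  have hY : Y ≠ ∞ := by
    unfold MemLpBesov LpBesovNorm timeLpOn at hv
    rw [if_neg ENNReal.ofReal_ne_top, ENNReal.toReal_ofReal hp0.le] at hv
    exact hv.ne
  obtain ⟨G, hG, hGm⟩ := hgradρ
  set Z := nn μ a (fun t => eLpNorm (G t) (ENNReal.ofReal s) (cubeVol d)) with hZd
  have hZ : Z ≠ ∞ := by
    have hGm' := hGm
    unfold MemLpLq LpLqNorm timeLpOn at hGm'
    rw [if_neg ENNReal.ofReal_ne_top, ENNReal.toReal_ofReal ha0.le] at hGm'
    exact hGm'.ne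
  -- kernels
  obtain ⟨J, hJ⟩ := exists_nat_ge (α * q + s + 2)
  have hαq : 0 < α * q := by positivity
  obtain ⟨C, L, hC, hL, hker⟩ := exists_ker d J
  set ε : ℕ → ℝ := fun n => 1 / ((n : ℝ) + 2) with hεd
  have hε0 : ∀ n, 0 < ε n := fun n => by simp only [hεd]; positivity
  have hε1 : ∀ n, ε n < 1 := fun n => by
    simp only [hεd]
    rw [div_lt_one (by positivity)]
    have : (0:ℝ) ≤ n := by positivity
    linarith
  have hεt : Filter.Tendsto ε Filter.atTop (nhds 0) := by
    refine Filter.Tendsto.div_atTop tendsto_const_nhds ?_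
    exact Filter.tendsto_atTop_add_const_right _ _ tendsto_natCast_atTop_atTop
  choose K hK hKm using fun n => hker (ε n) (hε0 n) (hε1 n)
  have hM2 : ∀ n, ∫⁻ h, ENNReal.ofReal (K n h) * ENNReal.ofReal (euNorm (lat h) ^ 2) ∂(cubeVol d)
      ≤ ENNReal.ofReal C * ENNReal.ofReal (ε n ^ (2:ℝ)) := by
    intro n
    rw [← ENNReal.ofReal_mul hC.le]
    have := hKm n 2 (by norm_num) (by linarith)
    simpa only [Real.rpow_two] using this
  have hM0 := eps_pow_tendsto ε hεt 2 (by norm_num) (ENNReal.ofReal C) ENNReal.ofReal_ne_top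
  -- velocity increments
  have hV : ∀ n, nn μ p (fun t => nn (QK (K n)) q (dU (v t)))
      ≤ (Y * ENNReal.ofReal (C ^ (1 / q))) * ENNReal.ofReal (ε n ^ α) := by
    intro n
    rw [mul_assoc, ← mom_root C (ε n) α q hC (hε0 n) hq0, hYd,
      ← nn_cmul _ _ hp0 _ _ (ENNReal.rpow_ne_top_of_nonneg (by positivity) ENNReal.ofReal_ne_top)]
    refine nn_mono _ _ hp0 _ _ (Filter.Eventually.of_forall fun t => ?_)
    exact V_bound (hK n) (v t) (hsol.v_periodic t) (hsol.v_meas.comp measurable_prodMk_left) q α hq0 _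
      (hKm n _ hαq.le (by linarith))
  -- density increments
  obtain ⟨C', hC'⟩ := slices_ae T γ ρ v ρ₀ v₀ hsol c hlow
  have hgr := ae_all_iff.2 fun n => grad_ae T γ hγ ρ v ρ₀ v₀ hsol c hlow G hG a s ha1 hs1 hGm
    (K n) _ (hK n)
  have hD : ∀ n, nn μ a (fun t => nn (QK (K n)) s (dR (ρ t)))
      ≤ (Z * ((d : ℝ≥0∞) * ENNReal.ofReal (C ^ (1 / s)))) * ENNReal.ofReal (ε n) := by
    intro n
    have e := mom_root C (ε n) 1 s hC (hε0 n) hs0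
    rw [Real.rpow_one] at e
    rw [mul_assoc, mul_assoc, ← e, hZd,
      ← nn_cmul _ _ ha0 _ _ (ENNReal.mul_ne_top (ENNReal.natCast_ne_top d)
        (ENNReal.rpow_ne_top_of_nonneg (by positivity) ENNReal.ofReal_ne_top))]
    refine nn_mono _ _ ha0 _ _ ?_
    filter_upwards [hC', hgr] with t ht hg
    have hsl := ht.1
    have := mom_bound (hK n) (ρ t) hsl.rp (dR_meas hsl.rm) s 1 hs0
      (d * eLpNorm (G t) (ENNReal.ofReal s) (cubeVol d)) (ENNReal.ofReal (C * ε n ^ (1 * s)))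
      (fun h => by
        rw [Real.rpow_one, mul_comm]
        exact tr3 K _ hK _ hM2 hM0 (ρ t) (hsl.ir hγ) hsl.rm hsl.rp (G t) hg s hs1 (lat h))
      (hKm n _ (by linarith) (by linarith))
    refine le_trans this (le_of_eq ?_)
    ring
  -- time Holder
  obtain ⟨cH, hcH, HH⟩ := time_hol μ γ p a mp hγ hp hap ha1 ham hmp
  -- bounds on the test function
  obtain ⟨A0, hA0⟩ := isCompact_Icc.exists_bound_of_continuousOn (s := Set.Icc 0 T)
    hφ.continuous.continuousOn
  obtain ⟨A1, hA1⟩ := isCompact_Icc.exists_bound_of_continuousOn (s := Set.Icc 0 T)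
    (hφ.continuous_deriv (by simp)).continuousOn
  have hBV : Y * ENNReal.ofReal (C ^ (1 / q)) ≠ ∞ := ENNReal.mul_ne_top hY ENNReal.ofReal_ne_top
  have hBD : Z * ((d : ℝ≥0∞) * ENNReal.ofReal (C ^ (1 / s))) ≠ ∞ :=
    ENNReal.mul_ne_top hZ (ENNReal.mul_ne_top (ENNReal.natCast_ne_top d) ENNReal.ofReal_ne_top)
  have key := lim_aux (ENNReal.ofReal |∫ t in Set.Ioo 0 T, deriv φ t * energyAt d γ ρ v t|)
    (ENNReal.ofReal A0) (ENNReal.ofReal A1) (ENNReal.ofReal ((d:ℝ)^2 * (2 * L))) cH X (X ^ (γ - 1))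
    _ _ (ENNReal.ofReal (kappa γ)) (ENNReal.ofReal (4 * γ)) (ENNReal.ofReal d)
    (ENNReal.ofReal (kappa γ / (γ - 1))) (ENNReal.ofReal γ)
    ENNReal.ofReal_ne_top ENNReal.ofReal_ne_top ENNReal.ofReal_ne_top hcH hX
    (ENNReal.rpow_ne_top_of_nonneg (by linarith) hX) hBV hBD
    ENNReal.ofReal_ne_top ENNReal.ofReal_ne_top ENNReal.ofReal_ne_top ENNReal.ofReal_ne_top
    ENNReal.ofReal_ne_top ε hε0 hεt α hα (fun n => by
      have := kern_est T hT γ hγ ρ v ρ₀ v₀ hsol c hc hlow (hK n) p q a s m mp he hsm hp0 hmp0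
        cH X _ _ hcH hX (ENNReal.mul_ne_top hBV ENNReal.ofReal_ne_top)
        (ENNReal.mul_ne_top hBD ENNReal.ofReal_ne_top) HH le_rfl (hV n) (hD n) φ hφ hφs A0 A1
        (fun t ht => hA0 t (Set.Ioo_subset_Icc_self ht))
        (fun t ht => hA1 t (Set.Ioo_subset_Icc_self ht))
      have e : ENNReal.ofReal ((d:ℝ)^2 * (2 * (L / ε n)))
          = ENNReal.ofReal ((d:ℝ)^2 * (2 * L)) * ENNReal.ofReal (ε n)⁻¹ := by
        rw [← ENNReal.ofReal_mul (by positivity)]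
        congr 1
        rw [div_eq_mul_inv]; ring
      rw [e] at this
      exact this)
  rw [ENNReal.ofReal_eq_zero] at key
  exact abs_eq_zero.1 (le_antisymm key (abs_nonneg _))

end CompressibleEuler
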